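/- For every integer ℓ ≥ 5, no 4-vertex-critical graph in 𝒢_ℓ contains an odd K4-subdivision. That is, if G is a finite simple graph with girth 2ℓ+1 and with no odd hole of length at least 2ℓ+3, and G is 4-vertex-critical, then no subgraph of G is an odd K4-subdivision. -/

import Mathlib

open SimpleGraph

variable {V : Type*}

/-- The list of internal vertices of a walk (its support minus the two ends). -/
def interiorL {G : SimpleGraph V} {a b : V} (p : G.Walk a b) : List V :=
  p.support.tail.dropLast

/-- `p` is an induced path of `G`: a path such that the only edges of `G` between
vertices of `p` are the edges of `p`. -/
def IsInducedPath (G : SimpleGraph V) {a b : V} (p : G.Walk a b) : Prop :=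
  p.IsPath ∧ ∀ x ∈ p.support, ∀ y ∈ p.support, G.Adj x y → s(x, y) ∈ p.edges

/-- A hole of `G`: an induced (chordless) cycle of length at least 4. -/
def IsHole (G : SimpleGraph V) {v : V} (c : G.Walk v v) : Prop :=
  c.IsCycle ∧ 4 ≤ c.length ∧
    ∀ x ∈ c.support, ∀ y ∈ c.support, G.Adj x y → s(x, y) ∈ c.edges

/-- An odd hole of `G`: a hole of odd length. -/
def IsOddHole (G : SimpleGraph V) {v : V} (c : G.Walk v v) : Prop :=
  IsHole G c ∧ Odd c.length

/-- `G ∈ 𝒢ℓ`: `G` has girth `2ℓ+1` and every odd hole of `G` has length exactly `2ℓ+1`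
(equivalently, no odd hole of length at least `2ℓ+3`). -/
def InGFamily (ℓ : ℕ) (G : SimpleGraph V) : Prop :=
  G.egirth = (2 * ℓ + 1 : ℕ) ∧
    ∀ (v : V) (c : G.Walk v v), IsOddHole G c → c.length = 2 * ℓ + 1

/-- `G` is `k`-vertex-critical: `χ(G) = k` and `χ(G − v) < k` for every vertex `v`. -/
def VertexCritical (k : ℕ) (G : SimpleGraph V) : Prop :=
  G.chromaticNumber = (k : ℕ∞) ∧
    ∀ v : V, (G.induce ({v}ᶜ : Set V)).chromaticNumber < (k : ℕ∞)

/-- An odd `K₄`-subdivision in `G`: four distinct branch vertices `u1, u2, u3, u4`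
joined by six internally disjoint paths (the arrises), such that the four face cycles
are all odd holes of `G`. -/
structure OddK4 (G : SimpleGraph V) where
  u1 : V
  u2 : V
  u3 : V
  u4 : V
  /-- the arris joining `u1` and `u2` -/
  P1 : G.Walk u1 u2
  /-- the arris joining `u3` and `u4` -/
  P2 : G.Walk u3 u4
  /-- the arris joining `u2` and `u3` -/
  Q1 : G.Walk u2 u3
  /-- the arris joining `u1` and `u4` -/
  Q2 : G.Walk u1 u4
  /-- the arris joining `u1` and `u3` -/
  L1 : G.Walk u1 u3
  /-- the arris joining `u2` and `u4` -/
  L2 : G.Walk u2 u4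
  hP1 : P1.IsPath
  hP2 : P2.IsPath
  hQ1 : Q1.IsPath
  hQ2 : Q2.IsPath
  hL1 : L1.IsPath
  hL2 : L2.IsPath
  /-- the four branch vertices are pairwise distinct -/
  hnodup : List.Nodup [u1, u2, u3, u4]
  /-- the interiors of the six arrises are pairwise disjoint -/
  hdisj : List.Pairwise List.Disjoint
    [interiorL P1, interiorL P2, interiorL Q1, interiorL Q2, interiorL L1, interiorL L2]
  /-- no branch vertex lies in the interior of an arris -/
  hbranch : ∀ x ∈ interiorL P1 ++ interiorL P2 ++ interiorL Q1 ++ interiorL Q2 ++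
      interiorL L1 ++ interiorL L2, x ∉ [u1, u2, u3, u4]
  /-- the face `u1u2u3` is an odd hole of `G` -/
  face1 : IsOddHole G (P1.append (Q1.append L1.reverse))
  /-- the face `u1u2u4` is an odd hole of `G` -/
  face2 : IsOddHole G (P1.append (L2.append Q2.reverse))
  /-- the face `u1u3u4` is an odd hole of `G` -/
  face3 : IsOddHole G (L1.append (P2.append Q2.reverse))
  /-- the face `u2u3u4` is an odd hole of `G` -/
  face4 : IsOddHole G (Q1.append (P2.append L2.reverse))

/-- The subgraph of `G` formed by an odd `K₄`-subdivision. -/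
def OddK4.toSubgraph {G : SimpleGraph V} (K : OddK4 G) : G.Subgraph :=
  K.P1.toSubgraph ⊔ K.P2.toSubgraph ⊔ K.Q1.toSubgraph ⊔ K.Q2.toSubgraph ⊔
    K.L1.toSubgraph ⊔ K.L2.toSubgraph

/-- The vertex set of an odd `K₄`-subdivision. -/
def OddK4.verts {G : SimpleGraph V} (K : OddK4 G) : Set V :=
  K.toSubgraph.verts

set_option linter.unusedSimpArgs false

/-- There is a path of length `n` from `x` to `y` with all vertices in `S`; the path is required
to be induced when `ind` holds. -/
def PathOn (G : SimpleGraph V) (ind : Prop) (x y : V) (n : ℕ) (S : Set V) : Prop :=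
  ∃ f : ℕ → V, f 0 = x ∧ f n = y ∧ (∀ c ≤ n, f c ∈ S) ∧
    ∀ a b, a < b → b ≤ n → f a ≠ f b ∧ (b = a + 1 → G.Adj (f a) (f b)) ∧
      (ind → G.Adj (f a) (f b) → b = a + 1)

/-- The sets `S` and `T` meet at most in `y`, and (when `ind` holds) every edge between them
has `y` as an end. -/
def SepAt (G : SimpleGraph V) (ind : Prop) (y : V) (S T : Set V) : Prop :=
  ∀ s ∈ S, ∀ t ∈ T, (s = t → s = y) ∧ (ind → G.Adj s t → s = y ∨ t = y)

section PathOn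

variable {G : SimpleGraph V} {ind : Prop} {x y z : V} {m n : ℕ} {S T U : Set V}

theorem SepAt.symm (h : SepAt G ind y S T) : SepAt G ind y T S := fun t ht s hs =>
  ⟨fun e => e ▸ (h s hs t ht).1 e.symm, fun hi e => ((h s hs t ht).2 hi e.symm).symm⟩

theorem SepAt.union_left (h : SepAt G ind y S U) (h' : SepAt G ind y T U) :
    SepAt G ind y (S ∪ T) U := by
  rintro s (hs | hs) t ht
  · exact h s hs t ht
  · exact h' s hs t ht

theorem PathOn.of_fun (f : ℕ → V) (N : ℕ)
    (hf : ∀ a b, a < b → b ≤ N → f a ≠ f b ∧ (b = a + 1 → G.Adj (f a) (f b)) ∧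
      (ind → G.Adj (f a) (f b) → b = a + 1)) {a b : ℕ} (hab : a ≤ b) (hb : b ≤ N) :
    PathOn G ind (f a) (f b) (b - a) {v | ∃ c, a ≤ c ∧ c ≤ b ∧ v = f c} := by
  refine ⟨fun t => f (a + t), rfl, by simp [Nat.add_sub_cancel' hab], ?_, ?_⟩
  · intro c hc
    exact ⟨a + c, by omega, by omega, rfl⟩
  · intro c d hcd hd
    obtain ⟨h1, h2, h3⟩ := hf (a + c) (a + d) (by omega) (by omega)
    exact ⟨h1, fun e => h2 (by omega), fun hi e => by have := h3 hi e; omega⟩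

theorem PathOn.of_adj (h : G.Adj x y) : PathOn G ind x y 1 {x, y} := by
  refine ⟨fun t => if t = 0 then x else y, by simp, by simp, ?_, ?_⟩
  · intro c hc
    by_cases h0 : c = 0 <;> simp [h0]
  · intro a b hab hb
    have ha : a = 0 := by omega
    have hb : b = 1 := by omega
    subst ha hb
    simp [h, h.ne]

theorem PathOn.mono (h : PathOn G ind x y n S) (hST : S ⊆ T) : PathOn G ind x y n T := by
  obtain ⟨f, h0, hn, hS, hf⟩ := h
  exact ⟨f, h0, hn, fun c hc => hST (hS c hc), hf⟩

theorem PathOn.weaken (h : PathOn G True x y n S) : PathOn G ind x y n S := by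
  obtain ⟨f, h0, hn, hS, hf⟩ := h
  exact ⟨f, h0, hn, hS, fun a b hab hb =>
    ⟨(hf a b hab hb).1, (hf a b hab hb).2.1, fun _ => (hf a b hab hb).2.2 trivial⟩⟩

theorem PathOn.symm (h : PathOn G ind x y n S) : PathOn G ind y x n S := by
  obtain ⟨f, h0, hn, hS, hf⟩ := h
  refine ⟨fun t => f (n - t), by simpa, by simpa, fun c _ => hS _ (by omega), ?_⟩
  intro a b hab hb
  obtain ⟨h1, h2, h3⟩ := hf (n - b) (n - a) (by omega) (by omega)
  exact ⟨h1.symm, fun e => (h2 (by omega)).symm, fun hi e => by have := h3 hi e.symm; omega⟩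

theorem PathOn.trans (h : PathOn G ind x y m S) (h' : PathOn G ind y z n T)
    (hsep : SepAt G ind y S T) : PathOn G ind x z (m + n) (S ∪ T) := by
  obtain ⟨f, hf0, hfm, hfS, hf⟩ := h
  obtain ⟨g, hg0, hgn, hgT, hg⟩ := h'
  refine ⟨fun t => if t ≤ m then f t else g (t - m), by simpa, ?_, ?_, ?_⟩
  · by_cases hn : n = 0
    · subst hn
      simp [hfm, ← hgn, hg0]
    · simp [hn, hgn]
  · intro c hc
    by_cases h : c ≤ m
    · simp [h, hfS c h]
    · simp only [h, if_false]
      exact Or.inr (hgT _ (by omega))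
  · intro a b hab hb
    by_cases h1 : b ≤ m
    · have h2 : a ≤ m := by omega
      simpa only [h1, h2, if_true] using hf a b hab h1
    · by_cases h2 : a ≤ m
      · simp only [h1, h2, if_true, if_false]
        have key := hg 0 (b - m) (by omega) (by omega)
        rw [hg0] at key
        rcases h2.eq_or_lt with rfl | h3
        · rw [hfm]
          exact ⟨key.1, fun e => key.2.1 (by omega), fun hi e => by have := key.2.2 hi e; omega⟩
        · have hs := hsep (f a) (hfS a h2) (g (b - m)) (hgT _ (by omega))
          have hne : f a ≠ y := hfm ▸ (hf a m h3 le_rfl).1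
          refine ⟨fun e => hne (hs.1 e), fun e => by omega, fun hi e => ?_⟩
          rcases hs.2 hi e with h | h
          · exact absurd h hne
          · exact absurd h.symm key.1
      · simp only [h1, h2, if_false]
        obtain ⟨k1, k2, k3⟩ := hg (a - m) (b - m) (by omega) (by omega)
        exact ⟨k1, fun e => k2 (by omega), fun hi e => by have := k3 hi e; omega⟩

end PathOn

/-- A closed walk running through the values of an injective cyclic sequence. -/
theorem exists_cycle_of_fun {G : SimpleGraph V} (C : ℕ → V) (N : ℕ) (hN : 3 ≤ N)
    (hinj : ∀ a b, a < b → b < N → C a ≠ C b)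
    (hadj : ∀ a, a + 1 < N → G.Adj (C a) (C (a + 1))) (hcl : G.Adj (C 0) (C (N - 1))) :
    ∃ c : G.Walk (C 0) (C 0), c.IsCycle ∧ c.length = N ∧
      (∀ v, v ∈ c.support → ∃ a < N, v = C a) ∧
      (∀ a, a + 1 < N → s(C a, C (a + 1)) ∈ c.edges) ∧ s(C 0, C (N - 1)) ∈ c.edges := by
  have key : ∀ m, m < N → ∃ p : G.Walk (C m) (C 0), p.IsPath ∧ p.length = m ∧
      (∀ v, v ∈ p.support ↔ ∃ a ≤ m, v = C a) ∧
      (∀ e, e ∈ p.edges ↔ ∃ a < m, e = s(C a, C (a + 1))) := by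
    intro m
    induction m with
    | zero => intro _; exact ⟨Walk.nil, by simp, by simp, by simp, by simp⟩
    | succ m ih =>
      intro hm
      obtain ⟨p, hp, hl, hs, he⟩ := ih (by omega)
      refine ⟨Walk.cons (hadj m hm).symm p, ?_, by simp [hl], ?_, ?_⟩
      · rw [Walk.cons_isPath_iff]
        refine ⟨hp, fun h => ?_⟩
        obtain ⟨a, ha, e⟩ := (hs _).1 h
        exact hinj a (m + 1) (by omega) hm e.symm
      · intro v
        rw [Walk.support_cons, List.mem_cons, hs]
        constructor
        · rintro (rfl | ⟨a, ha, rfl⟩)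
          · exact ⟨m + 1, le_rfl, rfl⟩
          · exact ⟨a, by omega, rfl⟩
        · rintro ⟨a, ha, rfl⟩
          rcases ha.eq_or_lt with rfl | h
          · exact Or.inl rfl
          · exact Or.inr ⟨a, by omega, rfl⟩
      · intro e
        rw [Walk.edges_cons, List.mem_cons, he]
        constructor
        · rintro (rfl | ⟨a, ha, rfl⟩)
          · exact ⟨m, by omega, Sym2.eq_swap⟩
          · exact ⟨a, by omega, rfl⟩
        · rintro ⟨a, ha, rfl⟩
          rcases (Nat.le_of_lt_succ ha).eq_or_lt with rfl | h
          · exact Or.inl Sym2.eq_swap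
          · exact Or.inr ⟨a, by omega, rfl⟩
  obtain ⟨p, hp, hl, hs, he⟩ := key (N - 1) (by omega)
  refine ⟨Walk.cons hcl p, ?_, by simp [hl]; omega, ?_, ?_, by simp⟩
  · rw [Walk.cons_isCycle_iff]
    refine ⟨hp, fun h => ?_⟩
    obtain ⟨a, ha, e⟩ := (he _).1 h
    rw [Sym2.eq_iff] at e
    rcases e with ⟨e1, e2⟩ | ⟨e1, e2⟩
    · have h0 : a = 0 := by
        by_contra h0
        exact hinj 0 a (by omega) (by omega) e1
      subst h0
      exact hinj 1 (N - 1) (by omega) (by omega) e2.symm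
    · exact hinj 0 (a + 1) (by omega) (by omega) e1
  · intro v hv
    rw [Walk.support_cons, List.mem_cons] at hv
    rcases hv with rfl | hv
    · exact ⟨0, by omega, rfl⟩
    · obtain ⟨a, ha, rfl⟩ := (hs v).1 hv
      exact ⟨a, by omega, rfl⟩
  · intro a ha
    rw [Walk.edges_cons, List.mem_cons]
    exact Or.inr ((he _).2 ⟨a, by omega, rfl⟩)

theorem InGFamily.girth_le_of_fun {G : SimpleGraph V} {ℓ : ℕ} (hG : InGFamily ℓ G)
    (C : ℕ → V) (N : ℕ) (hN : 3 ≤ N) (hinj : ∀ a b, a < b → b < N → C a ≠ C b)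
    (hadj : ∀ a, a + 1 < N → G.Adj (C a) (C (a + 1))) (hcl : G.Adj (C 0) (C (N - 1))) :
    2 * ℓ + 1 ≤ N := by
  obtain ⟨c, hc, hl, -⟩ := exists_cycle_of_fun C N hN hinj hadj hcl
  have := egirth_le_length hc
  rw [hG.1, hl] at this
  exact_mod_cast this

theorem InGFamily.odd_hole_of_fun {G : SimpleGraph V} {ℓ : ℕ} (hG : InGFamily ℓ G)
    (C : ℕ → V) (N : ℕ) (hN : 4 ≤ N) (hodd : Odd N)
    (hinj : ∀ a b, a < b → b < N → C a ≠ C b)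
    (hadj : ∀ a b, a < b → b < N → (G.Adj (C a) (C b) ↔ b = a + 1 ∨ a = 0 ∧ b = N - 1)) :
    N = 2 * ℓ + 1 := by
  obtain ⟨c, hc, hl, hs, he, hcl⟩ := exists_cycle_of_fun C N (by omega) hinj
    (fun a ha => (hadj a (a + 1) (by omega) ha).2 (Or.inl rfl))
    ((hadj 0 (N - 1) (by omega) (by omega)).2 (Or.inr ⟨rfl, rfl⟩))
  rw [← hl]
  refine hG.2 _ c ⟨⟨hc, by omega, ?_⟩, hl ▸ hodd⟩
  have main : ∀ a b, a < b → b < N → G.Adj (C a) (C b) → s(C a, C b) ∈ c.edges := by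
    intro a b hab hb h
    rcases (hadj a b hab hb).1 h with rfl | ⟨rfl, rfl⟩
    · exact he a hb
    · exact hcl
  intro x hx y hy hxy
  obtain ⟨a, ha, rfl⟩ := hs x hx
  obtain ⟨b, hb, rfl⟩ := hs y hy
  rcases lt_trichotomy a b with h | rfl | h
  · exact main a b h hb hxy
  · exact absurd rfl hxy.ne
  · rw [Sym2.eq_swap]
    exact main b a h ha hxy.symm

/-- Two paths with common ends that are otherwise disjoint form a cycle. -/
theorem InGFamily.girth_le {G : SimpleGraph V} {ℓ : ℕ} (hG : InGFamily ℓ G) {i₁ i₂ : Prop}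
    {x y : V} {m n : ℕ} {S T : Set V} (hP : PathOn G i₁ x y m S) (hR : PathOn G i₂ x y n T)
    (hST : ∀ v ∈ S, v ∈ T → v = x ∨ v = y) (hm : 1 ≤ m) (hmn : 3 ≤ m + n) :
    2 * ℓ + 1 ≤ m + n := by
  obtain ⟨f, hf0, hfm, hfS, hf⟩ := hP
  obtain ⟨g, hg0, hgn, hgT, hg⟩ := hR
  have hxy : x ≠ y := by
    have := (hf 0 m (by omega) le_rfl).1
    rwa [hf0, hfm] at this
  have hn : n ≠ 0 := by
    rintro rfl
    exact hxy (hg0.symm.trans hgn)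
  refine hG.girth_le_of_fun (fun t => if t ≤ m then f t else g (n + m - t)) (m + n) hmn ?_ ?_ ?_
  · intro a b hab hb
    by_cases h1 : b ≤ m
    · simpa only [h1, show a ≤ m by omega, if_true] using (hf a b hab h1).1
    · by_cases h2 : a ≤ m
      · simp only [h1, h2, if_true, if_false]
        intro e
        have h3 := (hg 0 (n + m - b) (by omega) (by omega)).1
        have h4 := (hg (n + m - b) n (by omega) le_rfl).1
        rcases hST _ (hfS a h2) (e ▸ hgT _ (by omega)) with h | h
        · exact h3 (by rw [hg0, ← e, h])
        · exact h4 (by rw [hgn, ← e, h])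
      · simp only [h1, h2, if_false]
        exact (hg _ _ (by omega) (by omega)).1.symm
  · intro a ha
    by_cases h1 : a + 1 ≤ m
    · simpa only [h1, show a ≤ m by omega, if_true] using
        (hf a (a + 1) (by omega) h1).2.1 rfl
    · by_cases h2 : a ≤ m
      · simp only [h1, h2, if_true, if_false]
        obtain rfl : a = m := by omega
        have := (hg (n - 1) n (by omega) le_rfl).2.1 (by omega)
        rw [hfm, show n + a - (a + 1) = n - 1 by omega, ← hgn]
        exact this.symm
      · simp only [h1, h2, if_false]
        exact ((hg (n + m - (a + 1)) (n + m - a) (by omega) (by omega)).2.1 (by omega)).symm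
  · simp only [Nat.zero_le, if_true, hf0]
    by_cases h1 : m + n - 1 ≤ m
    · simp only [h1, if_true]
      have := (hg 0 1 (by omega) (by omega)).2.1 rfl
      rwa [hg0, show 1 = n by omega, hgn, ← hfm, show m = m + n - 1 by omega] at this
    · simp only [h1, if_false]
      have := (hg 0 1 (by omega) (by omega)).2.1 rfl
      rwa [hg0, show 1 = n + m - (m + n - 1) by omega] at this

/-- Two induced paths with common ends and no other contact form a hole. -/
theorem InGFamily.even_or_eq {G : SimpleGraph V} {ℓ : ℕ} (hG : InGFamily ℓ G)
    {x y : V} {m n : ℕ} {S T : Set V} (hP : PathOn G True x y m S) (hR : PathOn G True x y n T)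
    (hST : ∀ s ∈ S, ∀ t ∈ T, s = t ∨ G.Adj s t → s = x ∨ s = y ∨ t = x ∨ t = y)
    (hm : 2 ≤ m) (hn : 2 ≤ n) : Even (m + n) ∨ m + n = 2 * ℓ + 1 := by
  obtain ⟨f, hf0, hfm, hfS, hf⟩ := hP
  obtain ⟨g, hg0, hgn, hgT, hg⟩ := hR
  rcases Nat.even_or_odd (m + n) with h | hodd
  · exact Or.inl h
  have hfx : ∀ a, 0 < a → a < m → f a ≠ x ∧ f a ≠ y := fun a h1 h2 =>
    ⟨fun e => (hf 0 a h1 h2.le).1 (by rw [hf0, e]), fun e => (hf a m h2 le_rfl).1 (by rw [hfm, e])⟩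
  have hgx : ∀ a, 0 < a → a < n → g a ≠ x ∧ g a ≠ y := fun a h1 h2 =>
    ⟨fun e => (hg 0 a h1 h2.le).1 (by rw [hg0, e]), fun e => (hg a n h2 le_rfl).1 (by rw [hgn, e])⟩
  have cross : ∀ a, 0 < a → a < m → ∀ b, 0 < b → b < n → f a ≠ g b ∧ ¬ G.Adj (f a) (g b) := by
    intro a h1 h2 b h3 h4
    have key : ¬ (f a = g b ∨ G.Adj (f a) (g b)) := fun e => by
      rcases hST _ (hfS a h2.le) _ (hgT b h4.le) e with h | h | h | h
      · exact (hfx a h1 h2).1 h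
      · exact (hfx a h1 h2).2 h
      · exact (hgx b h3 h4).1 h
      · exact (hgx b h3 h4).2 h
    exact ⟨fun e => key (Or.inl e), fun e => key (Or.inr e)⟩
  refine Or.inr (hG.odd_hole_of_fun (fun t => if t ≤ m then f t else g (n + m - t)) (m + n)
    (by omega) hodd ?_ ?_)
  · intro a b hab hb
    by_cases h1 : b ≤ m
    · simpa only [h1, show a ≤ m by omega, if_true] using (hf a b hab h1).1
    · by_cases h2 : a ≤ m
      · simp only [h1, h2, if_true, if_false]
        rcases Nat.eq_zero_or_pos a with rfl | ha
        · rw [hf0]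
          exact (hgx _ (by omega) (by omega)).1.symm
        · rcases h2.eq_or_lt with rfl | h3
          · rw [hfm]
            exact (hgx _ (by omega) (by omega)).2.symm
          · exact (cross a ha h3 _ (by omega) (by omega)).1
      · simp only [h1, h2, if_false]
        exact (hg _ _ (by omega) (by omega)).1.symm
  · intro a b hab hb
    by_cases h1 : b ≤ m
    · simp only [h1, show a ≤ m by omega, if_true]
      have := hf a b hab h1
      exact ⟨fun e => Or.inl (this.2.2 trivial e), fun e => this.2.1 (by omega)⟩
    · by_cases h2 : a ≤ m
      · simp only [h1, h2, if_true, if_false]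
        rcases Nat.eq_zero_or_pos a with rfl | ha
        · have := hg 0 (n + m - b) (by omega) (by omega)
          rw [hg0] at this
          rw [hf0]
          exact ⟨fun e => by have := this.2.2 trivial e; omega, fun e => this.2.1 (by omega)⟩
        · rcases h2.eq_or_lt with rfl | h3
          · have := hg (n + a - b) n (by omega) le_rfl
            rw [hgn] at this
            rw [hfm, G.adj_comm]
            exact ⟨fun e => by have := this.2.2 trivial e; omega, fun e => this.2.1 (by omega)⟩
          · refine iff_of_false (cross a ha h3 _ (by omega) (by omega)).2 (by omega)
      · simp only [h1, h2, if_false]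
        have := hg (n + m - b) (n + m - a) (by omega) (by omega)
        rw [G.adj_comm]
        exact ⟨fun e => by have := this.2.2 trivial e; omega, fun e => this.2.1 (by omega)⟩

/-- An induced path of length `n ≥ 2` from `x` to `y` whose interior avoids `M` and sees in `M`
only the ends of the path and vertices of `N`. -/
def Jump (G : SimpleGraph V) (M N : Set V) (x y : V) (n : ℕ) : Prop :=
  2 ≤ n ∧ ∃ T, PathOn G True x y n T ∧
    ∀ w ∈ T, w = x ∨ w = y ∨ w ∉ M ∧ ∀ m ∈ M, G.Adj w m → m = x ∨ m = y ∨ m ∈ N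

section Jump

variable {G : SimpleGraph V} {ℓ : ℕ} {M N : Set V} {x y : V} {n r : ℕ} {T : Set V}

theorem Jump.symm (h : Jump G M N x y n) : Jump G M N y x n := by
  obtain ⟨h2, T, hT, hM⟩ := h
  refine ⟨h2, T, hT.symm, fun w hw => ?_⟩
  rcases hM w hw with h | h | ⟨h, h'⟩
  · exact Or.inr (Or.inl h)
  · exact Or.inl h
  · refine Or.inr (Or.inr ⟨h, fun m hm e => ?_⟩)
    have := h' m hm e
    tauto

theorem Jump.ne (h : Jump G M N x y n) : x ≠ y := by
  obtain ⟨h2, T, ⟨f, rfl, rfl, -, hf⟩, -⟩ := h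
  exact (hf 0 n (by omega) le_rfl).1

theorem Jump.not_adj (h : Jump G M N x y n) : ¬ G.Adj x y := by
  obtain ⟨h2, T, ⟨f, rfl, rfl, -, hf⟩, -⟩ := h
  exact fun e => by have := (hf 0 n (by omega) le_rfl).2.2 trivial e; omega

theorem Jump.girth_le (h : Jump G M N x y n) (hG : InGFamily ℓ G) {ind : Prop}
    (hR : PathOn G ind x y r T) (hTM : T ⊆ M) : 2 * ℓ + 1 ≤ n + r := by
  have hne := h.ne
  obtain ⟨h2, S, hS, hM⟩ := h
  have hr : r ≠ 0 := by
    rintro rfl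
    obtain ⟨f, rfl, h, -⟩ := hR
    exact hne h
  refine hG.girth_le hS hR (fun v hv hvT => ?_) (by omega) (by omega)
  rcases hM v hv with h | h | ⟨h, -⟩
  · exact Or.inl h
  · exact Or.inr h
  · exact absurd (hTM hvT) h

theorem Jump.even_or_eq (h : Jump G M N x y n) (hG : InGFamily ℓ G)
    (hR : PathOn G True x y r T) (hTM : T ⊆ M) (hTN : ∀ v ∈ T, v ∉ N) :
    Even (n + r) ∨ n + r = 2 * ℓ + 1 := by
  have hne := h.ne
  have hna := h.not_adj
  obtain ⟨h2, S, hS, hM⟩ := h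
  refine hG.even_or_eq hS hR ?_ h2 ?_
  · intro s hs t ht e
    rcases hM s hs with h | h | ⟨h, h'⟩
    · exact Or.inl h
    · exact Or.inr (Or.inl h)
    · rcases e with rfl | e
      · exact absurd (hTM ht) h
      · rcases h' t (hTM ht) e with h | h | h
        · exact Or.inr (Or.inr (Or.inl h))
        · exact Or.inr (Or.inr (Or.inr h))
        · exact absurd h (hTN t ht)
  · obtain ⟨f, rfl, rfl, -, hf⟩ := hR
    by_contra hr
    rcases (show r = 0 ∨ r = 1 by omega) with rfl | rfl
    · exact hne rfl
    · exact hna ((hf 0 1 (by omega) le_rfl).2.1 rfl)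

end Jump

theorem getVert_mem_interiorL {G : SimpleGraph V} {u v : V} (p : G.Walk u v) {a : ℕ}
    (h0 : 0 < a) (h1 : a < p.length) : p.getVert a ∈ interiorL p := by
  have hl := p.length_support
  rw [interiorL, List.mem_iff_getElem]
  refine ⟨a - 1, by simp; omega, ?_⟩
  rw [List.getElem_dropLast, List.getElem_tail, Walk.support_getElem_eq_getVert]
  congr 1
  omega

theorem IsHole.getVert_eq_iff {G : SimpleGraph V} {v : V} {c : G.Walk v v} (h : IsHole G c)
    {s t : ℕ} (hs : s ≤ c.length) (ht : t ≤ c.length) :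
    c.getVert s = c.getVert t ↔ s = t ∨ s = 0 ∧ t = c.length ∨ s = c.length ∧ t = 0 := by
  have h4 := h.2.1
  have e0 : c.getVert 0 = c.getVert c.length := by simp
  constructor
  · intro e
    by_cases hs0 : s = 0
    · by_cases ht0 : t = 0
      · omega
      · subst hs0
        rw [e0] at e
        have := h.1.getVert_injOn (show 1 ≤ c.length ∧ c.length ≤ c.length by omega)
          (show 1 ≤ t ∧ t ≤ c.length by omega) e
        omega
    · by_cases ht0 : t = 0
      · subst ht0
        rw [e0] at e
        have := h.1.getVert_injOn (show 1 ≤ s ∧ s ≤ c.length by omega)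
          (show 1 ≤ c.length ∧ c.length ≤ c.length by omega) e
        omega
      · exact Or.inl (h.1.getVert_injOn (show 1 ≤ s ∧ s ≤ c.length by omega)
          (show 1 ≤ t ∧ t ≤ c.length by omega) e)
  · rintro (rfl | ⟨rfl, rfl⟩ | ⟨rfl, rfl⟩)
    · rfl
    · exact e0
    · exact e0.symm

theorem IsHole.adj_getVert_iff {G : SimpleGraph V} {v : V} {c : G.Walk v v} (h : IsHole G c)
    {s t : ℕ} (hs : s ≤ c.length) (ht : t ≤ c.length) :
    G.Adj (c.getVert s) (c.getVert t) ↔ s + 1 = t ∨ t + 1 = s ∨ s = 0 ∧ t + 1 = c.length ∨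
      s + 1 = c.length ∧ t = 0 ∨ s = 1 ∧ t = c.length ∨ s = c.length ∧ t = 1 := by
  have h4 := h.2.1
  have e0 : c.getVert 0 = c.getVert c.length := by simp
  have adj1 : ∀ a, a < c.length → G.Adj (c.getVert a) (c.getVert (a + 1)) :=
    fun a ha => c.adj_getVert_succ ha
  constructor
  · intro e
    have he := h.2.2 _ (c.getVert_mem_support s) _ (c.getVert_mem_support t) e
    obtain ⟨i, hi, hi'⟩ := (Walk.mk_mem_edges_iff_exists c).1 he
    rw [Sym2.eq_iff, h.getVert_eq_iff (by omega) hs, h.getVert_eq_iff (by omega) ht,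
      h.getVert_eq_iff (by omega) hs, h.getVert_eq_iff (by omega) ht] at hi'
    omega
  · rintro (rfl | rfl | ⟨rfl, h1⟩ | ⟨h1, rfl⟩ | ⟨rfl, rfl⟩ | ⟨rfl, rfl⟩)
    · exact adj1 s (by omega)
    · exact (adj1 t (by omega)).symm
    · rw [e0, ← h1]
      exact (adj1 t (by omega)).symm
    · rw [e0, ← h1]
      exact adj1 s (by omega)
    · rw [← e0]
      exact (adj1 0 (by omega)).symm
    · rw [← e0]
      exact adj1 0 (by omega)

/-- The sequence `p` of length `m` is an induced path. -/
def InducedSeq (G : SimpleGraph V) (m : ℕ) (p : ℕ → V) : Prop :=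
  ∀ a ≤ m, ∀ b ≤ m, (p a = p b ↔ a = b) ∧ (G.Adj (p a) (p b) ↔ a + 1 = b ∨ b + 1 = a)

/-- The sequences `p` and `q`, of lengths `m` and `n`, only meet at their common start, and the
only other edge between them joins their ends, when `r = 1`. -/
def InducedCorner (G : SimpleGraph V) (m n r : ℕ) (p q : ℕ → V) : Prop :=
  ∀ a ≤ m, ∀ b ≤ n, (p a = q b ↔ a = 0 ∧ b = 0) ∧
    (G.Adj (p a) (q b) ↔ a = 0 ∧ b = 1 ∨ a = 1 ∧ b = 0 ∨ a = m ∧ b = n ∧ r = 1)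

theorem InducedSeq.rev {G : SimpleGraph V} {m : ℕ} {p : ℕ → V} (h : InducedSeq G m p) :
    InducedSeq G m fun c => p (m - c) := by
  intro a ha b hb
  rw [(h _ (Nat.sub_le m a) _ (Nat.sub_le m b)).1, (h _ (Nat.sub_le m a) _ (Nat.sub_le m b)).2]
  omega

theorem InducedCorner.symm {G : SimpleGraph V} {m n r : ℕ} {p q : ℕ → V}
    (h : InducedCorner G m n r p q) : InducedCorner G n m r q p := by
  intro a ha b hb
  rw [eq_comm, (h b hb a ha).1, G.adj_comm, (h b hb a ha).2]
  omega

theorem IsHole.triangle {G : SimpleGraph V} {u v w : V} {p : G.Walk u v} {q : G.Walk v w}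
    {r : G.Walk u w} (h : IsHole G (p.append (q.append r.reverse)))
    (hp : 1 ≤ p.length) (hq : 1 ≤ q.length) (hr : 1 ≤ r.length) :
    InducedSeq G p.length p.getVert ∧ InducedSeq G q.length q.getVert ∧
    InducedSeq G r.length r.getVert ∧
    InducedCorner G p.length r.length q.length p.getVert r.getVert ∧
    InducedCorner G p.length q.length r.length (fun c => p.getVert (p.length - c)) q.getVert ∧
    InducedCorner G q.length r.length p.length (fun c => q.getVert (q.length - c))
      (fun c => r.getVert (r.length - c)) := by
  set c := p.append (q.append r.reverse) with hc
  have hl : c.length = p.length + q.length + r.length := by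
    simp [hc]
    omega
  have ep : ∀ a ≤ p.length, p.getVert a = c.getVert a := by
    intro a ha
    simp [hc, Walk.getVert_append', ha]
  have eq : ∀ a ≤ q.length, q.getVert a = c.getVert (p.length + a) := by
    intro a ha
    simp [hc, Walk.getVert_append p, Walk.getVert_append' q, ha]
  have er : ∀ a ≤ r.length, r.getVert a = c.getVert (p.length + q.length + (r.length - a)) := by
    intro a ha
    rw [hc, Walk.getVert_append, if_neg (by omega), Walk.getVert_append, if_neg (by omega),
      Walk.getVert_reverse]
    congr 1
    omega
  have h4 := h.2.1
  refine ⟨?_, ?_, ?_, ?_, ?_, ?_⟩ <;> intro a ha b hb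
  · rw [ep a ha, ep b hb, h.getVert_eq_iff (by omega) (by omega),
      h.adj_getVert_iff (by omega) (by omega)]
    omega
  · rw [eq a ha, eq b hb, h.getVert_eq_iff (by omega) (by omega),
      h.adj_getVert_iff (by omega) (by omega)]
    omega
  · rw [er a ha, er b hb, h.getVert_eq_iff (by omega) (by omega),
      h.adj_getVert_iff (by omega) (by omega)]
    omega
  · rw [ep a ha, er b hb, h.getVert_eq_iff (by omega) (by omega),
      h.adj_getVert_iff (by omega) (by omega)]
    omega
  · simp only
    rw [ep _ (Nat.sub_le _ a), eq b hb, h.getVert_eq_iff (by omega) (by omega),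
      h.adj_getVert_iff (by omega) (by omega)]
    omega
  · simp only
    rw [eq _ (Nat.sub_le _ a), er _ (Nat.sub_le _ b), h.getVert_eq_iff (by omega) (by omega),
      h.adj_getVert_iff (by omega) (by omega)]
    omega

/-- The labels `i`, `j`, `k`, `l` are distinct. -/
structure Distinct4 (i j k l : Fin 4) : Prop where
  ij : i ≠ j
  ik : i ≠ k
  il : i ≠ l
  jk : j ≠ k
  jl : j ≠ l
  kl : k ≠ l

namespace Distinct4

variable {i j k l : Fin 4}

theorem swap12 (h : Distinct4 i j k l) : Distinct4 j i k l :=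
  ⟨h.ij.symm, h.jk, h.jl, h.ik, h.il, h.kl⟩

theorem swap23 (h : Distinct4 i j k l) : Distinct4 i k j l :=
  ⟨h.ik, h.ij, h.il, h.jk.symm, h.kl, h.jl⟩

theorem swap34 (h : Distinct4 i j k l) : Distinct4 i j l k :=
  ⟨h.ij, h.il, h.ik, h.jl, h.jk, h.kl.symm⟩

theorem swap13 (h : Distinct4 i j k l) : Distinct4 k j i l := h.swap12.swap23.swap12

theorem swap24 (h : Distinct4 i j k l) : Distinct4 i l k j := h.swap23.swap34.swap23

theorem swap_pairs (h : Distinct4 i j k l) : Distinct4 k l i j := h.swap13.swap24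

theorem eq_or (h : Distinct4 i j k l) (m : Fin 4) : m = i ∨ m = j ∨ m = k ∨ m = l := by
  obtain ⟨h1, h2, h3, h4, h5, h6⟩ := h
  revert i j k l m
  decide

theorem exists_of_ne₃ (h1 : i ≠ j) (h2 : i ≠ k) (h3 : j ≠ k) : ∃ l, Distinct4 i j k l := by
  have : ∀ i j k : Fin 4, i ≠ j → i ≠ k → j ≠ k → ∃ l, i ≠ l ∧ j ≠ l ∧ k ≠ l := by decide
  obtain ⟨l, h4, h5, h6⟩ := this i j k h1 h2 h3
  exact ⟨l, h1, h2, h4, h3, h5, h6⟩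

theorem exists_of_ne (h1 : i ≠ j) : ∃ k l, Distinct4 i j k l := by
  have : ∀ i j : Fin 4, i ≠ j → ∃ k, i ≠ k ∧ j ≠ k := by decide
  obtain ⟨k, h2, h3⟩ := this i j h1
  exact ⟨k, exists_of_ne₃ h1 h2 h3⟩

end Distinct4

/-- An odd `K₄`-subdivision whose faces have length `2ℓ+1`, with coordinates: `pos i j c` is the
vertex at distance `c` from the branch vertex `i` on the arris joining `i` and `j`. -/
structure Frame (G : SimpleGraph V) (ℓ : ℕ) where
  len : Fin 4 → Fin 4 → ℕ
  pos : Fin 4 → Fin 4 → ℕ → V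
  len_comm : ∀ i j, len i j = len j i
  pos_rev : ∀ i j c, c ≤ len i j → pos j i c = pos i j (len i j - c)
  pos_zero : ∀ i j k, pos i j 0 = pos i k 0
  one_le : ∀ i j, i ≠ j → 1 ≤ len i j
  face : ∀ i j k, i ≠ j → i ≠ k → j ≠ k → len i j + len j k + len i k = 2 * ℓ + 1
  same : ∀ i j, i ≠ j → InducedSeq G (len i j) (pos i j)
  corner : ∀ i j k, i ≠ j → i ≠ k → j ≠ k →
    InducedCorner G (len i j) (len i k) (len j k) (pos i j) (pos i k)
  opp_ne : ∀ i j k l, Distinct4 i j k l → ∀ a ≤ len i j, ∀ b ≤ len k l, pos i j a ≠ pos k l b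

namespace OddK4

variable {G : SimpleGraph V} (K : OddK4 G)

/-- The length of the arris joining two branch vertices. -/
def len : Fin 4 → Fin 4 → ℕ
  | 0, 1 => K.P1.length
  | 1, 0 => K.P1.length
  | 2, 3 => K.P2.length
  | 3, 2 => K.P2.length
  | 1, 2 => K.Q1.length
  | 2, 1 => K.Q1.length
  | 0, 3 => K.Q2.length
  | 3, 0 => K.Q2.length
  | 0, 2 => K.L1.length
  | 2, 0 => K.L1.length
  | 1, 3 => K.L2.length
  | 3, 1 => K.L2.length
  | 0, 0 => 0
  | 1, 1 => 0
  | 2, 2 => 0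
  | 3, 3 => 0

/-- The vertex at a given distance from the first branch vertex along an arris. -/
def pos : Fin 4 → Fin 4 → ℕ → V
  | 0, 1 => K.P1.getVert
  | 1, 0 => fun c => K.P1.getVert (K.P1.length - c)
  | 2, 3 => K.P2.getVert
  | 3, 2 => fun c => K.P2.getVert (K.P2.length - c)
  | 1, 2 => K.Q1.getVert
  | 2, 1 => fun c => K.Q1.getVert (K.Q1.length - c)
  | 0, 3 => K.Q2.getVert
  | 3, 0 => fun c => K.Q2.getVert (K.Q2.length - c)
  | 0, 2 => K.L1.getVert
  | 2, 0 => fun c => K.L1.getVert (K.L1.length - c)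
  | 1, 3 => K.L2.getVert
  | 3, 1 => fun c => K.L2.getVert (K.L2.length - c)
  | 0, 0 => fun _ => K.u1
  | 1, 1 => fun _ => K.u2
  | 2, 2 => fun _ => K.u3
  | 3, 3 => fun _ => K.u4

theorem len_comm (i j : Fin 4) : K.len i j = K.len j i := by
  fin_cases i <;> fin_cases j <;> rfl

theorem pos_rev (i j : Fin 4) (c : ℕ) (h : c ≤ K.len i j) :
    K.pos j i c = K.pos i j (K.len i j - c) := by
  fin_cases i <;> fin_cases j <;>
    first
    | rfl
    | (simp only [len, pos] at h ⊢
       congr 1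
       omega)

/-- The branch vertices, indexed by `Fin 4`. -/
def branch : Fin 4 → V
  | 0 => K.u1
  | 1 => K.u2
  | 2 => K.u3
  | 3 => K.u4

theorem pos_zero (i j : Fin 4) : K.pos i j 0 = K.branch i := by
  fin_cases i <;> fin_cases j <;> simp [pos, branch]

theorem branch_ne {i j : Fin 4} (h : i ≠ j) : K.branch i ≠ K.branch j := by
  have := K.hnodup
  simp only [List.nodup_cons, List.mem_cons, List.not_mem_nil, or_false, not_or] at this
  obtain ⟨⟨h1, h2, h3⟩, ⟨h4, h5⟩, h6, -⟩ := this
  fin_cases i <;> fin_cases j <;> simp_all [branch, eq_comm]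

theorem one_le_len {i j : Fin 4} (h : i ≠ j) : 1 ≤ K.len i j := by
  by_contra h0
  have h0 : K.len i j = 0 := by omega
  have := K.pos_rev i j 0 (Nat.zero_le _)
  rw [h0, pos_zero, pos_zero] at this
  exact K.branch_ne h this.symm

theorem triple_aux (P : Fin 4 → Fin 4 → Fin 4 → Prop) (h23 : ∀ i j k, P i j k → P i k j)
    (h12 : ∀ i j k, P i j k → P j i k) (h012 : P 0 1 2) (h013 : P 0 1 3) (h023 : P 0 2 3)
    (h123 : P 1 2 3) (i j k : Fin 4) (hij : i ≠ j) (hik : i ≠ k) (hjk : j ≠ k) : P i j k := by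
  have six : ∀ a b c, P a b c → P a b c ∧ P a c b ∧ P b a c ∧ P b c a ∧ P c a b ∧ P c b a :=
    fun a b c h => ⟨h, h23 _ _ _ h, h12 _ _ _ h, h23 _ _ _ (h12 _ _ _ h),
      h12 _ _ _ (h23 _ _ _ h), h23 _ _ _ (h12 _ _ _ (h23 _ _ _ h))⟩
  have s1 := six _ _ _ h012
  have s2 := six _ _ _ h013
  have s3 := six _ _ _ h023
  have s4 := six _ _ _ h123
  clear h23 h12 six h012 h013 h023 h123
  fin_cases i <;> fin_cases j <;> fin_cases k <;> simp at hij hik hjk ⊢ <;> tauto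

/-- The coordinates on the face through three branch vertices are those of a hole. -/
def FaceFacts (ℓ : ℕ) (i j k : Fin 4) : Prop :=
  K.len i j + K.len j k + K.len i k = 2 * ℓ + 1 ∧
  InducedSeq G (K.len i j) (K.pos i j) ∧ InducedSeq G (K.len j k) (K.pos j k) ∧
  InducedSeq G (K.len i k) (K.pos i k) ∧
  InducedCorner G (K.len i j) (K.len i k) (K.len j k) (K.pos i j) (K.pos i k) ∧
  InducedCorner G (K.len i j) (K.len j k) (K.len i k) (K.pos j i) (K.pos j k) ∧
  InducedCorner G (K.len j k) (K.len i k) (K.len i j) (K.pos k j) (K.pos k i)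

theorem inducedSeq_rev {i j : Fin 4} (h : InducedSeq G (K.len i j) (K.pos i j)) :
    InducedSeq G (K.len j i) (K.pos j i) := by
  intro a ha b hb
  rw [K.len_comm j i] at ha hb
  rw [K.pos_rev i j a ha, K.pos_rev i j b hb]
  exact h.rev a ha b hb

theorem faceFacts {ℓ : ℕ} (hG : InGFamily ℓ G) (i j k : Fin 4) (hij : i ≠ j) (hik : i ≠ k)
    (hjk : j ≠ k) : K.FaceFacts ℓ i j k := by
  have len01 : 1 ≤ K.P1.length := K.one_le_len (show (0 : Fin 4) ≠ 1 by decide)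
  have len23 : 1 ≤ K.P2.length := K.one_le_len (show (2 : Fin 4) ≠ 3 by decide)
  have len12 : 1 ≤ K.Q1.length := K.one_le_len (show (1 : Fin 4) ≠ 2 by decide)
  have len03 : 1 ≤ K.Q2.length := K.one_le_len (show (0 : Fin 4) ≠ 3 by decide)
  have len02 : 1 ≤ K.L1.length := K.one_le_len (show (0 : Fin 4) ≠ 2 by decide)
  have len13 : 1 ≤ K.L2.length := K.one_le_len (show (1 : Fin 4) ≠ 3 by decide)
  have total : ∀ {u v w : V} (p : G.Walk u v) (q : G.Walk v w) (r : G.Walk u w),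
      IsOddHole G (p.append (q.append r.reverse)) →
        p.length + q.length + r.length = 2 * ℓ + 1 := by
    intro u v w p q r h
    have := hG.2 _ _ h
    simp only [Walk.length_append, Walk.length_reverse] at this
    omega
  refine triple_aux (K.FaceFacts ℓ) ?_ ?_ ⟨total _ _ _ K.face1, K.face1.1.triangle len01 len12 len02⟩
    ⟨total _ _ _ K.face2, K.face2.1.triangle len01 len13 len03⟩
    ⟨total _ _ _ K.face3, K.face3.1.triangle len02 len23 len03⟩
    ⟨total _ _ _ K.face4, K.face4.1.triangle len12 len23 len13⟩ i j k hij hik hjk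
  · rintro i j k ⟨h1, h2, h3, h4, h5, h6, h7⟩
    rw [FaceFacts, K.len_comm k j]
    exact ⟨by omega, h4, K.len_comm j k ▸ K.inducedSeq_rev h3, h2, h5.symm, h7.symm, h6.symm⟩
  · rintro i j k ⟨h1, h2, h3, h4, h5, h6, h7⟩
    rw [FaceFacts, K.len_comm j i]
    exact ⟨by omega, K.len_comm j i ▸ K.inducedSeq_rev h2, h4, h3, h6, h5, h7.symm⟩

theorem quadruple_aux (P : Fin 4 → Fin 4 → Fin 4 → Fin 4 → Prop)
    (h12 : ∀ i j k l, P i j k l → P j i k l) (hs : ∀ i j k l, P i j k l → P k l i j)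
    (h0123 : P 0 1 2 3) (h1203 : P 1 2 0 3) (h0213 : P 0 2 1 3)
    (i j k l : Fin 4) (h : Distinct4 i j k l) : P i j k l := by
  have all : ∀ i j k l, P i j k l → P i j k l ∧ P j i k l ∧ P i j l k ∧ P j i l k ∧
      P k l i j ∧ P k l j i ∧ P l k i j ∧ P l k j i := by
    intro i j k l h
    have h1 := h12 _ _ _ _ h
    have h2 := hs _ _ _ _ h
    have h3 := hs _ _ _ _ h1
    have h4 := h12 _ _ _ _ h2
    have h5 := h12 _ _ _ _ h3
    exact ⟨h, h1, hs _ _ _ _ h4, hs _ _ _ _ h5, h2, h3, h4, h5⟩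
  obtain ⟨a1, a2, a3, a4, a5, a6, a7, a8⟩ := all _ _ _ _ h0123
  obtain ⟨b1, b2, b3, b4, b5, b6, b7, b8⟩ := all _ _ _ _ h1203
  obtain ⟨c1, c2, c3, c4, c5, c6, c7, c8⟩ := all _ _ _ _ h0213
  obtain ⟨h1, h2, h3, h4, h5, h6⟩ := h
  clear h12 hs all h0123 h1203 h0213
  have label : l = 0 ∨ l = 1 ∨ l = 2 ∨ l = 3 := by omega
  fin_cases i <;> fin_cases j <;> simp at h1 <;> fin_cases k <;> simp at h2 h4 <;>
    rcases label with rfl | rfl | rfl | rfl <;> simp at h3 h5 h6 <;> assumption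

theorem opp_ne (i j k l : Fin 4) (h : Distinct4 i j k l) (a : ℕ) (ha : a ≤ K.len i j) (b : ℕ)
    (hb : b ≤ K.len k l) : K.pos i j a ≠ K.pos k l b := by
  have hd := K.hdisj
  have hbr := K.hbranch
  simp only [List.pairwise_cons, List.mem_cons, List.not_mem_nil, or_false, forall_eq_or_imp,
    forall_eq] at hd
  simp only [List.mem_append] at hbr
  have nb : ∀ (m : Fin 4) (x : V), x = K.branch m → x ∈ [K.u1, K.u2, K.u3, K.u4] := by
    intro m x hx
    subst hx
    fin_cases m <;> simp [branch]
  have key : ∀ {u v w z : V} (p : G.Walk u v) (q : G.Walk w z) (i j k l : Fin 4)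
      (h : Distinct4 i j k l), u = K.branch i → v = K.branch j → w = K.branch k →
      z = K.branch l → (∀ x ∈ interiorL p, x ∉ [K.u1, K.u2, K.u3, K.u4]) →
      (∀ x ∈ interiorL q, x ∉ [K.u1, K.u2, K.u3, K.u4]) → List.Disjoint (interiorL p) (interiorL q) →
      ∀ a ≤ p.length, ∀ b ≤ q.length, p.getVert a ≠ q.getVert b := by
    intro u v w z p q i j k l h hu hv hw hz hp hq hpq a ha b hb e
    have ca : p.getVert a = K.branch i ∨ p.getVert a = K.branch j ∨ p.getVert a ∈ interiorL p := by
      rcases Nat.eq_zero_or_pos a with rfl | h0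
      · simp [hu]
      · rcases ha.eq_or_lt with rfl | h1
        · simp [hv]
        · exact Or.inr (Or.inr (getVert_mem_interiorL p h0 h1))
    have cb : q.getVert b = K.branch k ∨ q.getVert b = K.branch l ∨ q.getVert b ∈ interiorL q := by
      rcases Nat.eq_zero_or_pos b with rfl | h0
      · simp [hw]
      · rcases hb.eq_or_lt with rfl | h1
        · simp [hz]
        · exact Or.inr (Or.inr (getVert_mem_interiorL q h0 h1))
    rw [← e] at cb
    rcases ca with ca | ca | ca <;> rcases cb with cb | cb | cb
    · exact K.branch_ne h.ik (ca.symm.trans cb)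
    · exact K.branch_ne h.il (ca.symm.trans cb)
    · exact hq _ cb (nb _ _ ca)
    · exact K.branch_ne h.jk (ca.symm.trans cb)
    · exact K.branch_ne h.jl (ca.symm.trans cb)
    · exact hq _ cb (nb _ _ ca)
    · exact hp _ ca (nb _ _ cb)
    · exact hp _ ca (nb _ _ cb)
    · exact hpq ca cb
  let Q : Fin 4 → Fin 4 → Fin 4 → Fin 4 → Prop := fun i j k l =>
    ∀ a ≤ K.len i j, ∀ b ≤ K.len k l, K.pos i j a ≠ K.pos k l b
  have r12 : ∀ i j k l, Q i j k l → Q j i k l := by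
    intro i j k l h a ha b hb
    rw [K.len_comm j i] at ha
    rw [K.pos_rev i j a ha]
    exact h _ (Nat.sub_le _ _) b hb
  have rs : ∀ i j k l, Q i j k l → Q k l i j := fun i j k l h a ha b hb => (h b hb a ha).symm
  have q1 : Q 0 1 2 3 := key K.P1 K.P2 0 1 2 3 (by constructor <;> decide) rfl rfl rfl rfl
    (fun x hx => hbr x (by tauto)) (fun x hx => hbr x (by tauto)) (by tauto)
  have q2 : Q 1 2 0 3 := key K.Q1 K.Q2 1 2 0 3 (by constructor <;> decide) rfl rfl rfl rfl
    (fun x hx => hbr x (by tauto)) (fun x hx => hbr x (by tauto)) (by tauto)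
  have q3 : Q 0 2 1 3 := key K.L1 K.L2 0 2 1 3 (by constructor <;> decide) rfl rfl rfl rfl
    (fun x hx => hbr x (by tauto)) (fun x hx => hbr x (by tauto)) (by tauto)
  exact quadruple_aux Q r12 rs q1 q2 q3 i j k l h a ha b hb

/-- Coordinates on an odd `K₄`-subdivision. -/
def frame {ℓ : ℕ} (hG : InGFamily ℓ G) : Frame G ℓ where
  len := K.len
  pos := K.pos
  len_comm := K.len_comm
  pos_rev := K.pos_rev
  pos_zero i j k := by rw [K.pos_zero, K.pos_zero]
  one_le _ _ := K.one_le_len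
  face i j k h1 h2 h3 := (K.faceFacts hG i j k h1 h2 h3).1
  same i j h := by
    obtain ⟨k, l, hd⟩ := Distinct4.exists_of_ne h
    exact (K.faceFacts hG i j k hd.ij hd.ik hd.jk).2.1
  corner i j k h1 h2 h3 := (K.faceFacts hG i j k h1 h2 h3).2.2.2.2.1
  opp_ne := K.opp_ne

end OddK4

namespace Distinct4

theorem ne_facts {i j k l : Fin 4} (h : Distinct4 i j k l) :
    (i ≠ j ∧ j ≠ i ∧ i ≠ k ∧ k ≠ i ∧ i ≠ l ∧ l ≠ i) ∧
      j ≠ k ∧ k ≠ j ∧ j ≠ l ∧ l ≠ j ∧ k ≠ l ∧ l ≠ k :=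
  ⟨⟨h.ij, h.ij.symm, h.ik, h.ik.symm, h.il, h.il.symm⟩,
    h.jk, h.jk.symm, h.jl, h.jl.symm, h.kl, h.kl.symm⟩

end Distinct4

namespace Frame

variable {G : SimpleGraph V} {ℓ : ℕ} (F : Frame G ℓ) {i j k l : Fin 4}

theorem pos_len (i j k : Fin 4) : F.pos i j (F.len i j) = F.pos j k 0 := by
  rw [F.pos_zero j k i, F.pos_rev i j 0 (Nat.zero_le _), Nat.sub_zero]

theorem pos_symm (i j : Fin 4) {c : ℕ} (h : c ≤ F.len i j) :
    F.pos i j c = F.pos j i (F.len i j - c) := by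
  rw [F.pos_rev i j _ (Nat.sub_le _ _), Nat.sub_sub_self h]

theorem len_basic (h : Distinct4 i j k l) : F.len j i = F.len i j ∧ F.len k l = F.len i j ∧
    F.len l k = F.len i j ∧ F.len k i = F.len i k ∧ F.len j l = F.len i k ∧
    F.len l j = F.len i k ∧ F.len l i = F.len i l ∧ F.len j k = F.len i l ∧
    F.len k j = F.len i l ∧ F.len i j + F.len i k + F.len i l = 2 * ℓ + 1 ∧
    1 ≤ F.len i j ∧ 1 ≤ F.len i k ∧ 1 ≤ F.len i l := by
  have h1 := F.face i j k h.ij h.ik h.jk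
  have h2 := F.face i j l h.ij h.il h.jl
  have h3 := F.face i k l h.ik h.il h.kl
  have h4 := F.face j k l h.jk h.jl h.kl
  have h5 := F.one_le i j h.ij
  have h6 := F.one_le i k h.ik
  have h7 := F.one_le i l h.il
  have := F.len_comm i j
  have := F.len_comm i k
  have := F.len_comm i l
  have := F.len_comm j k
  have := F.len_comm j l
  have := F.len_comm k l
  omega

/-- The part of an arris between the coordinates `a` and `b`. -/
def seg (i j : Fin 4) (a b : ℕ) : Set V := {v | ∃ c, a ≤ c ∧ c ≤ b ∧ v = F.pos i j c}

/-- The vertices of the subdivision. -/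
def verts : Set V := {v | ∃ i j c, i ≠ j ∧ c ≤ F.len i j ∧ v = F.pos i j c}

theorem pos_mem_verts (h : i ≠ j) {c : ℕ} (hc : c ≤ F.len i j) : F.pos i j c ∈ F.verts :=
  ⟨i, j, c, h, hc, rfl⟩

theorem seg_subset_verts (h : i ≠ j) {a b : ℕ} (hb : b ≤ F.len i j) : F.seg i j a b ⊆ F.verts := by
  rintro _ ⟨c, -, hc, rfl⟩
  exact F.pos_mem_verts h (hc.trans hb)

theorem seg_path {ind : Prop} (h : i ≠ j) {a b : ℕ} (hab : a ≤ b) (hb : b ≤ F.len i j) :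
    PathOn G ind (F.pos i j a) (F.pos i j b) (b - a) (F.seg i j a b) := by
  refine PathOn.of_fun (F.pos i j) (F.len i j) (fun a b hab hb => ?_) hab hb
  have := F.same i j h a (by omega) b hb
  rw [Ne, this.1, this.2]
  omega

theorem seg_path_full {ind : Prop} (h : i ≠ j) (m n : Fin 4) :
    PathOn G ind (F.pos i m 0) (F.pos j n 0) (F.len i j) (F.seg i j 0 (F.len i j)) := by
  have := F.seg_path (ind := ind) h (Nat.zero_le _) le_rfl
  rwa [F.pos_len i j n, F.pos_zero i j m, Nat.sub_zero] at this

/-- The condition on coordinates for `pos i j c = pos k l d`. -/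
def SameCoord (i j : Fin 4) (c : ℕ) (k l : Fin 4) (d : ℕ) : Prop :=
  i = k ∧ j = l ∧ c = d ∨ i = l ∧ j = k ∧ c + d = F.len i j ∨
    i = k ∧ c = 0 ∧ d = 0 ∨ i = l ∧ c = 0 ∧ d = F.len k l ∨
    j = k ∧ c = F.len i j ∧ d = 0 ∨ j = l ∧ c = F.len i j ∧ d = F.len k l

theorem eq_iff (hij : i ≠ j) (hkl : k ≠ l) {c d : ℕ} (hc : c ≤ F.len i j) (hd : d ≤ F.len k l) :
    F.pos i j c = F.pos k l d ↔ F.SameCoord i j c k l d := by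
  unfold SameCoord
  by_cases hik : i = k
  · subst hik
    by_cases hjl : j = l
    · subst hjl
      rw [(F.same i j hij c hc d hd).1]
      simp only [hij, hij.symm, eq_self, true_and, false_and, or_false, false_or]
      omega
    · rw [(F.corner i j l hij hkl hjl c hc d hd).1]
      simp only [hij.symm, hkl, hjl, eq_self, true_and, false_and, or_false, false_or]
  · by_cases hil : i = l
    · subst hil
      rw [F.pos_symm k i hd]
      have hd' : F.len k i - d ≤ F.len i k := by rw [F.len_comm i k]; omega
      by_cases hjk : j = k
      · subst hjk
        rw [(F.same i j hij c hc _ hd').1]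
        have := F.len_comm i j
        simp only [hij, hij.symm, eq_self, true_and, false_and, or_false, false_or]
        omega
      · rw [(F.corner i j k hij hik hjk c hc _ hd').1]
        simp only [hik, hij.symm, hjk, eq_self, true_and, false_and, or_false, false_or]
        omega
    · rw [F.pos_symm i j hc]
      have hc' : F.len i j - c ≤ F.len j i := by rw [F.len_comm j i]; omega
      by_cases hjk : j = k
      · subst hjk
        rw [(F.corner j i l hij.symm hkl hil _ hc' d hd).1]
        simp only [hik, hil, hkl, eq_self, true_and, false_and, or_false, false_or]
        omega
      · by_cases hjl : j = l
        · subst hjl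
          rw [F.pos_symm k j hd]
          have hd' : F.len k j - d ≤ F.len j k := by rw [F.len_comm j k]; omega
          rw [(F.corner j i k hij.symm hjk hik _ hc' _ hd').1]
          simp only [hik, hil, hjk, eq_self, true_and, false_and, false_or]
          omega
        · simp only [hik, hil, hjk, hjl, false_and, or_false, iff_false]
          exact F.opp_ne j i k l ⟨hij.symm, hjk, hjl, hik, hil, hkl⟩ _ hc' _ hd

theorem sep_seg_of_eq {m n : Fin 4} (hij : i ≠ j) (hkl : k ≠ l) (hmn : m ≠ n) {a b c d : ℕ}
    (hb : b ≤ F.len i j) (hd : d ≤ F.len k l)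
    (h : ∀ s, a ≤ s → s ≤ b → ∀ t, c ≤ t → t ≤ d → F.SameCoord i j s k l t →
      F.SameCoord i j s m n 0) :
    SepAt G False (F.pos m n 0) (F.seg i j a b) (F.seg k l c d) := by
  rintro _ ⟨s, h1, h2, rfl⟩ _ ⟨t, h3, h4, rfl⟩
  rw [F.eq_iff hij hkl (h2.trans hb) (h4.trans hd), F.eq_iff hij hmn (h2.trans hb) (Nat.zero_le _)]
  exact ⟨h s h1 h2 t h3 h4, False.elim⟩

theorem len_le (hG : InGFamily ℓ G) (h : Distinct4 i j k l) : F.len i j ≤ ℓ := by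
  have hne := h.ne_facts
  obtain ⟨e1, e2, e3, e4, e5, e6, e7, e8, e9, e10, e11, e12, e13⟩ := F.len_basic h
  have h1 := (F.seg_path_full (ind := False) h.ik j j).trans (F.seg_path_full h.jk.symm j i)
    (F.sep_seg_of_eq h.ik h.jk.symm h.jk.symm le_rfl le_rfl (by simp [SameCoord, hne]; omega))
  have h2 := (F.seg_path_full (ind := False) h.il j j).trans (F.seg_path_full h.jl.symm j i)
    (F.sep_seg_of_eq h.il h.jl.symm h.jl.symm le_rfl le_rfl (by simp [SameCoord, hne]; omega))
  have := hG.girth_le h1 h2 ?_ (by omega) (by omega)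
  · omega
  · rintro _ (⟨c, -, hc, rfl⟩ | ⟨c, -, hc, rfl⟩) (⟨d, -, hd, e⟩ | ⟨d, -, hd, e⟩)
    · rw [F.eq_iff h.ik h.il hc hd] at e
      rw [F.eq_iff h.ik h.ij hc (Nat.zero_le _), F.eq_iff h.ik h.ij.symm hc (Nat.zero_le _)]
      simp [hne, SameCoord] at e ⊢
      omega
    · rw [F.eq_iff h.ik h.jl.symm hc hd] at e
      simp [hne, SameCoord] at e
    · rw [F.eq_iff h.jk.symm h.il hc hd] at e
      simp [hne, SameCoord] at e
    · rw [F.eq_iff h.jk.symm h.jl.symm hc hd] at e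
      rw [F.eq_iff h.jk.symm h.ij hc (Nat.zero_le _),
        F.eq_iff h.jk.symm h.ij.symm hc (Nat.zero_le _)]
      simp [hne, SameCoord] at e ⊢
      omega

theorem len_facts (hG : InGFamily ℓ G) (h : Distinct4 i j k l) :
    F.len j i = F.len i j ∧ F.len k l = F.len i j ∧
    F.len l k = F.len i j ∧ F.len k i = F.len i k ∧ F.len j l = F.len i k ∧
    F.len l j = F.len i k ∧ F.len l i = F.len i l ∧ F.len j k = F.len i l ∧
    F.len k j = F.len i l ∧ F.len i j + F.len i k + F.len i l = 2 * ℓ + 1 ∧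
    1 ≤ F.len i j ∧ 1 ≤ F.len i k ∧ 1 ≤ F.len i l ∧
    F.len i j ≤ ℓ ∧ F.len i k ≤ ℓ ∧ F.len i l ≤ ℓ := by
  have := F.len_basic h
  have := F.len_le hG h
  have := F.len_le hG h.swap23
  have := F.len_le hG h.swap24
  omega

/-- Adjacent inner vertices of opposite arrises would close a cycle along the arris `i k`. -/
theorem le_of_adj_opp (hG : InGFamily ℓ G) (h : Distinct4 i j k l) {a b : ℕ} (ha0 : 0 < a)
    (ha : a < F.len i j) (hb : b < F.len k l) (e : G.Adj (F.pos i j a) (F.pos k l b)) :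
    2 * ℓ ≤ a + F.len i k + b := by
  have hne := h.ne_facts
  obtain ⟨e1, e2, e3, e4, e5, e6, e7, e8, e9, e10, e11, e12, e13⟩ := F.len_basic h
  have h1 := ((F.seg_path (ind := False) h.ij (Nat.zero_le a) ha.le).symm.trans
    (F.pos_zero i k j ▸ F.seg_path_full h.ik k l)
    (F.sep_seg_of_eq h.ij h.ik h.ij ha.le le_rfl
      (by simp [SameCoord, hne]; omega))).trans (F.seg_path h.kl (Nat.zero_le b) hb.le)
    (SepAt.union_left (F.sep_seg_of_eq h.ij h.kl h.kl ha.le hb.le (by simp [SameCoord, hne]))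
      (F.sep_seg_of_eq h.ik h.kl h.kl le_rfl hb.le (by simp [SameCoord, hne]; omega)))
  have := hG.girth_le (PathOn.of_adj (ind := False) e) h1 (by
    rintro v hv -
    simpa using hv) le_rfl (by omega)
  omega

theorem not_adj_opp (hG : InGFamily ℓ G) (h : Distinct4 i j k l) {a b : ℕ} (ha0 : 0 < a)
    (ha : a < F.len i j) (hb0 : 0 < b) (hb : b < F.len k l) :
    ¬ G.Adj (F.pos i j a) (F.pos k l b) := by
  intro e
  obtain ⟨e1, e2, e3, e4, e5, e6, e7, e8, e9, e10, e11, e12, e13, e14, e15, e16⟩ :=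
    F.len_facts hG h
  have h1 := F.le_of_adj_opp hG h ha0 ha hb e
  have h2 := F.le_of_adj_opp hG h.swap34 (b := F.len k l - b) ha0 ha (by omega)
    (by rwa [F.pos_rev k l _ (by omega), show F.len k l - (F.len k l - b) = b by omega])
  have h3 := F.le_of_adj_opp hG h.swap12 (a := F.len i j - a) (by omega) (by omega) hb
    (by rwa [F.pos_rev i j _ (by omega), show F.len i j - (F.len i j - a) = a by omega])
  have h4 := F.le_of_adj_opp hG h.swap34.swap12 (a := F.len i j - a) (b := F.len k l - b)
    (by omega) (by omega) (by omega)
    (by rwa [F.pos_rev i j _ (by omega), F.pos_rev k l _ (by omega),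
          show F.len i j - (F.len i j - a) = a by omega,
          show F.len k l - (F.len k l - b) = b by omega])
  omega

theorem adj_iff_opp (hG : InGFamily ℓ G) (h : Distinct4 i j k l) {c d : ℕ} (hc : c ≤ F.len i j)
    (hd : d ≤ F.len k l) : G.Adj (F.pos i j c) (F.pos k l d) ↔ c = 0 ∧ d = 0 ∧ F.len i k = 1 ∨
      c = 0 ∧ d = F.len k l ∧ F.len i l = 1 ∨ c = F.len i j ∧ d = 0 ∧ F.len j k = 1 ∨
      c = F.len i j ∧ d = F.len k l ∧ F.len j l = 1 := by
  obtain ⟨e1, e2, e3, e4, e5, e6, e7, e8, e9, e10, e11, e12, e13, e14, e15, e16⟩ :=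
    F.len_facts hG h
  rcases Nat.eq_zero_or_pos c with rfl | h0
  · rw [← F.pos_len k i j,
      (F.corner k i l h.ik.symm h.kl h.il _ le_rfl d hd).2]
    omega
  rcases Nat.eq_or_lt_of_le hc with rfl | h1
  · rw [F.pos_len i j k, ← F.pos_len k j k,
      (F.corner k j l h.jk.symm h.kl h.jl _ le_rfl d hd).2]
    omega
  rcases Nat.eq_zero_or_pos d with rfl | h2
  · rw [← F.pos_len i k l,
      (F.corner i j k h.ij h.ik h.jk c hc _ le_rfl).2]
    omega
  rcases Nat.eq_or_lt_of_le hd with rfl | h3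
  · rw [F.pos_len k l i, ← F.pos_len i l i,
      (F.corner i j l h.ij h.il h.jl c hc _ le_rfl).2]
    omega
  have := F.not_adj_opp hG h h0 h1 h2 h3
  simp only [this, false_iff]
  omega

/-- The condition on coordinates for `pos i j c` and `pos k l d` to be adjacent. -/
def AdjCoord (i j : Fin 4) (c : ℕ) (k l : Fin 4) (d : ℕ) : Prop :=
  i = k ∧ j = l ∧ (c + 1 = d ∨ d + 1 = c) ∨
    i = l ∧ j = k ∧ (c + d = F.len i j + 1 ∨ c + d + 1 = F.len i j) ∨
    i = k ∧ j ≠ l ∧ (c = 0 ∧ d = 1 ∨ c = 1 ∧ d = 0) ∨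
    i = l ∧ j ≠ k ∧ (c = 0 ∧ d + 1 = F.len k l ∨ c = 1 ∧ d = F.len k l) ∨
    j = k ∧ i ≠ l ∧ (c = F.len i j ∧ d = 1 ∨ c + 1 = F.len i j ∧ d = 0) ∨
    j = l ∧ i ≠ k ∧ (c = F.len i j ∧ d + 1 = F.len k l ∨ c + 1 = F.len i j ∧ d = F.len k l) ∨
    i ≠ k ∧ c = 0 ∧ d = 0 ∧ F.len i k = 1 ∨
    i ≠ l ∧ c = 0 ∧ d = F.len k l ∧ F.len i l = 1 ∨
    j ≠ k ∧ c = F.len i j ∧ d = 0 ∧ F.len j k = 1 ∨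
    j ≠ l ∧ c = F.len i j ∧ d = F.len k l ∧ F.len j l = 1

theorem adj_iff (hG : InGFamily ℓ G) (hij : i ≠ j) (hkl : k ≠ l) {c d : ℕ} (hc : c ≤ F.len i j)
    (hd : d ≤ F.len k l) : G.Adj (F.pos i j c) (F.pos k l d) ↔ F.AdjCoord i j c k l d := by
  unfold AdjCoord
  have l1 := F.one_le i j hij
  have l2 := F.one_le k l hkl
  by_cases hik : i = k
  · subst hik
    by_cases hjl : j = l
    · subst hjl
      rw [(F.same i j hij c hc d hd).2]
      have := F.len_comm i j
      simp [hij, hij.symm]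
      omega
    · have := F.len_comm j i
      rw [(F.corner i j l hij hkl hjl c hc d hd).2]
      simp [hij, hij.symm, hkl, hkl.symm, hjl]
      omega
  · by_cases hil : i = l
    · subst hil
      rw [F.pos_symm k i hd]
      have hd' : F.len k i - d ≤ F.len i k := by rw [F.len_comm i k]; omega
      by_cases hjk : j = k
      · subst hjk
        rw [(F.same i j hij c hc _ hd').2]
        have := F.len_comm i j
        simp [hij, hij.symm]
        omega
      · rw [(F.corner i j k hij hik hjk c hc _ hd').2]
        have := F.len_comm i j
        have := F.len_comm i k
        simp [hik, hij, hij.symm, hjk]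
        omega
    · rw [F.pos_symm i j hc]
      have hc' : F.len i j - c ≤ F.len j i := by rw [F.len_comm j i]; omega
      have := F.len_comm i j
      by_cases hjk : j = k
      · subst hjk
        rw [(F.corner j i l hij.symm hkl hil _ hc' d hd).2]
        simp [hik, hil, hkl, hij]
        omega
      · by_cases hjl : j = l
        · subst hjl
          rw [F.pos_symm k j hd]
          have := F.len_comm k j
          have hd' : F.len k j - d ≤ F.len j k := by rw [F.len_comm j k]; omega
          rw [(F.corner j i k hij.symm hjk hik _ hc' _ hd').2]
          simp [hik, hil, hjk]
          omega
        · have h : Distinct4 i j k l := ⟨hij, hik, hil, hjk, hjl, hkl⟩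
          rw [← F.pos_symm i j hc]
          simpa only [hik, hil, hjk, hjl, false_and, false_or, ne_eq, not_false_eq_true, true_and]
            using F.adj_iff_opp hG h hc hd

end Frame

namespace Frame

variable {G : SimpleGraph V} {ℓ : ℕ} (F : Frame G ℓ) {i j k l : Fin 4}

/-- The branch vertex with label `i`. -/
def br (i : Fin 4) : V := F.pos i i 0

theorem pos_zero_eq_br (i j : Fin 4) : F.pos i j 0 = F.br i := F.pos_zero i j i

theorem pos_len_eq_br (i j : Fin 4) : F.pos i j (F.len i j) = F.br j := F.pos_len i j j

theorem path_full (h : i ≠ j) :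
    PathOn G True (F.br i) (F.br j) (F.len i j) (F.seg i j 0 (F.len i j)) :=
  F.seg_path_full h i j

theorem path_to_start (h : i ≠ j) {a : ℕ} (ha : a ≤ F.len i j) :
    PathOn G True (F.pos i j a) (F.br i) a (F.seg i j 0 a) := by
  have := (F.seg_path (ind := True) h (Nat.zero_le a) ha).symm
  rwa [F.pos_zero_eq_br, Nat.sub_zero] at this

theorem path_to_end (h : i ≠ j) {a : ℕ} (ha : a ≤ F.len i j) :
    PathOn G True (F.pos i j a) (F.br j) (F.len i j - a) (F.seg i j a (F.len i j)) := by
  have := F.seg_path (ind := True) h ha le_rfl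
  rwa [F.pos_len_eq_br] at this

/-- `pos i j c` is the branch vertex with label `m`. -/
def AtBr (i j : Fin 4) (c : ℕ) (m : Fin 4) : Prop := i = m ∧ c = 0 ∨ j = m ∧ c = F.len i j

theorem sep_br (hG : InGFamily ℓ G) {m : Fin 4} (hij : i ≠ j) (hkl : k ≠ l)
    {a b c d : ℕ} (hb : b ≤ F.len i j) (hd : d ≤ F.len k l)
    (h : ∀ s, a ≤ s → s ≤ b → ∀ t, c ≤ t → t ≤ d →
      (F.SameCoord i j s k l t → F.AtBr i j s m) ∧ (F.AdjCoord i j s k l t →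
        F.AtBr i j s m ∨ F.AtBr k l t m)) :
    SepAt G True (F.br m) (F.seg i j a b) (F.seg k l c d) := by
  have key : ∀ {i j s}, F.AtBr i j s m → F.pos i j s = F.br m := by
    rintro i j s (⟨rfl, rfl⟩ | ⟨rfl, rfl⟩)
    · exact F.pos_zero_eq_br i j
    · exact F.pos_len_eq_br i j
  rintro _ ⟨s, h1, h2, rfl⟩ _ ⟨t, h3, h4, rfl⟩
  rw [F.eq_iff hij hkl (h2.trans hb) (h4.trans hd), F.adj_iff hG hij hkl (h2.trans hb) (h4.trans hd)]
  exact ⟨fun e => key ((h s h1 h2 t h3 h4).1 e), fun _ e => ((h s h1 h2 t h3 h4).2 e).imp key key⟩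

/-- There is an induced path of length `n` from `x` to `y` in the subdivision minus `A`. -/
def Route (A : Set V) (x y : V) (n : ℕ) : Prop :=
  ∃ T : Set V, T ⊆ F.verts ∧ (∀ v ∈ T, v ∉ A) ∧ PathOn G True x y n T

variable {F} in
theorem Route.symm {A : Set V} {x y : V} {n : ℕ} (h : F.Route A x y n) : F.Route A y x n := by
  obtain ⟨T, h1, h2, h3⟩ := h
  exact ⟨T, h1, h2, h3.symm⟩

variable {F} in
theorem Route.girth_le {A N : Set V} {x y : V} {n r : ℕ} (h : F.Route A x y r) (hG : InGFamily ℓ G)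
    (hJ : Jump G F.verts N x y n) : 2 * ℓ + 1 ≤ n + r := by
  obtain ⟨T, h1, -, h3⟩ := h
  exact hJ.girth_le hG h3 h1

variable {F} in
theorem Route.even_or_eq {A N : Set V} {x y : V} {n r : ℕ} (h : F.Route A x y r)
    (hG : InGFamily ℓ G) (hJ : Jump G F.verts N x y n) (hN : ∀ v ∈ F.verts, v ∈ N → v ∈ A) :
    (n + r) % 2 = 0 ∨ n + r = 2 * ℓ + 1 := by
  obtain ⟨T, h1, h2, h3⟩ := h
  rw [← Nat.even_iff]
  exact hJ.even_or_eq hG h3 h1 fun v hv hvN => h2 v hv (hN v (h1 hv) hvN)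

theorem not_mem_seg (hij : i ≠ j) (hkl : k ≠ l) {a b c d : ℕ} (hb : b ≤ F.len i j)
    (hd : d ≤ F.len k l)
    (h : ∀ s, a ≤ s → s ≤ b → ∀ t, c ≤ t → t ≤ d → ¬ F.SameCoord i j s k l t) :
    ∀ v ∈ F.seg i j a b, v ∉ F.seg k l c d := by
  rintro _ ⟨s, h1, h2, rfl⟩ ⟨t, h3, h4, e⟩
  exact h s h1 h2 t h3 h4 ((F.eq_iff hij hkl (h2.trans hb) (h4.trans hd)).1 e)

theorem route_arris (h : i ≠ j) {a b : ℕ} (hab : a ≤ b) (hb : b ≤ F.len i j) :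
    F.Route ∅ (F.pos i j a) (F.pos i j b) (b - a) :=
  ⟨_, F.seg_subset_verts h hb, by simp, F.seg_path h hab hb⟩

theorem route_face (hG : InGFamily ℓ G) (h : Distinct4 i j k l) {a b : ℕ} (hab : a + 2 ≤ b)
    (hb : b ≤ F.len i j) :
    F.Route (F.seg i j (a + 1) (b - 1)) (F.pos i j a) (F.pos i j b)
      (a + F.len i k + F.len k j + (F.len i j - b)) := by
  have hne := h.ne_facts
  obtain ⟨e1, e2, e3, e4, e5, e6, e7, e8, e9, e10, e11, e12, e13, e14, e15, e16⟩ :=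
    F.len_facts hG h
  have P := ((((F.path_to_start h.ij (by omega : a ≤ F.len i j)).trans
    (F.path_full h.ik) ?_).trans
    (F.path_full h.jk.symm) ?_).trans
    (F.path_to_end h.ij (by omega : b ≤ F.len i j)).symm ?_)
  · refine ⟨_, ?_, ?_, P⟩
    · simp only [Set.union_subset_iff]
      exact ⟨⟨⟨F.seg_subset_verts h.ij (by omega),
        F.seg_subset_verts h.ik le_rfl⟩,
        F.seg_subset_verts h.jk.symm le_rfl⟩,
        F.seg_subset_verts h.ij le_rfl⟩
    · rintro v (((hv | hv) | hv) | hv) <;> revert v <;>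
      refine F.not_mem_seg (by simp [hne]) (by simp [hne]) (by omega) (by omega) ?_ <;>
      · intro s h1 h2 t h3 h4
        simp [SameCoord, hne] <;> omega
  · refine F.sep_br hG (by simp [hne]) (by simp [hne]) (by omega) (by omega) ?_ <;>
    · intro s h1 h2 t h3 h4
      simp [SameCoord, AdjCoord, AtBr, hne] <;> omega
  · refine SepAt.union_left ?_ ?_ <;>
    refine F.sep_br hG (by simp [hne]) (by simp [hne]) (by omega) (by omega) ?_ <;>
    · intro s h1 h2 t h3 h4
      simp [SameCoord, AdjCoord, AtBr, hne] <;> omega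
  · refine SepAt.union_left (SepAt.union_left ?_ ?_) ?_ <;>
    refine F.sep_br hG (by simp [hne]) (by simp [hne]) (by omega) (by omega) ?_ <;>
    · intro s h1 h2 t h3 h4
      simp [SameCoord, AdjCoord, AtBr, hne] <;> omega

theorem route_long (hG : InGFamily ℓ G) (h : Distinct4 i j k l) {a b : ℕ} (hab : a + 2 ≤ b)
    (hb : b ≤ F.len i j) (hil : 2 ≤ F.len i l) :
    F.Route (F.seg i j (a + 1) (b - 1)) (F.pos i j a) (F.pos i j b)
      (a + F.len i k + F.len k l + F.len l j + (F.len i j - b)) := by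
  have hne := h.ne_facts
  obtain ⟨e1, e2, e3, e4, e5, e6, e7, e8, e9, e10, e11, e12, e13, e14, e15, e16⟩ :=
    F.len_facts hG h
  have P := (((((F.path_to_start h.ij (by omega : a ≤ F.len i j)).trans
    (F.path_full h.ik) ?_).trans
    (F.path_full h.kl) ?_).trans
    (F.path_full h.jl.symm) ?_).trans
    (F.path_to_end h.ij (by omega : b ≤ F.len i j)).symm ?_)
  · refine ⟨_, ?_, ?_, P⟩
    · simp only [Set.union_subset_iff]
      exact ⟨⟨⟨⟨F.seg_subset_verts h.ij (by omega),
        F.seg_subset_verts h.ik le_rfl⟩,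
        F.seg_subset_verts h.kl le_rfl⟩,
        F.seg_subset_verts h.jl.symm le_rfl⟩,
        F.seg_subset_verts h.ij le_rfl⟩
    · rintro v ((((hv | hv) | hv) | hv) | hv) <;> revert v <;>
      refine F.not_mem_seg (by simp [hne]) (by simp [hne]) (by omega) (by omega) ?_ <;>
      · intro s h1 h2 t h3 h4
        simp [SameCoord, hne] <;> omega
  · refine F.sep_br hG (by simp [hne]) (by simp [hne]) (by omega) (by omega) ?_ <;>
    · intro s h1 h2 t h3 h4
      simp [SameCoord, AdjCoord, AtBr, hne] <;> omega
  · refine SepAt.union_left ?_ ?_ <;>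
    refine F.sep_br hG (by simp [hne]) (by simp [hne]) (by omega) (by omega) ?_ <;>
    · intro s h1 h2 t h3 h4
      simp [SameCoord, AdjCoord, AtBr, hne] <;> omega
  · refine SepAt.union_left (SepAt.union_left ?_ ?_) ?_ <;>
    refine F.sep_br hG (by simp [hne]) (by simp [hne]) (by omega) (by omega) ?_ <;>
    · intro s h1 h2 t h3 h4
      simp [SameCoord, AdjCoord, AtBr, hne] <;> omega
  · refine SepAt.union_left (SepAt.union_left (SepAt.union_left ?_ ?_) ?_) ?_ <;>
    refine F.sep_br hG (by simp [hne]) (by simp [hne]) (by omega) (by omega) ?_ <;>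
    · intro s h1 h2 t h3 h4
      simp [SameCoord, AdjCoord, AtBr, hne] <;> omega

theorem route_corner (hG : InGFamily ℓ G) (h : Distinct4 i j k l) {s t : ℕ} (hs : s ≤ F.len i j)
    (ht : t ≤ F.len i k) (hst : s < F.len i j ∨ t < F.len i k) :
    F.Route ∅ (F.pos i j s) (F.pos i k t)
      (s + t) := by
  have hne := h.ne_facts
  obtain ⟨e1, e2, e3, e4, e5, e6, e7, e8, e9, e10, e11, e12, e13, e14, e15, e16⟩ :=
    F.len_facts hG h
  have P := ((F.path_to_start h.ij (by omega : s ≤ F.len i j)).trans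
    (F.path_to_start h.ik (by omega : t ≤ F.len i k)).symm ?_)
  · refine ⟨_, ?_, ?_, P⟩
    · simp only [Set.union_subset_iff]
      exact ⟨F.seg_subset_verts h.ij (by omega),
        F.seg_subset_verts h.ik (by omega)⟩
    · simp
  · refine F.sep_br hG (by simp [hne]) (by simp [hne]) (by omega) (by omega) ?_ <;>
    · intro s h1 h2 t h3 h4
      simp [SameCoord, AdjCoord, AtBr, hne] <;> omega

theorem route_across (hG : InGFamily ℓ G) (h : Distinct4 i j k l) {s t : ℕ} (hs : s ≤ F.len i j)
    (ht : t ≤ F.len i k) (hs0 : 1 ≤ s) (ht0 : 1 ≤ t) :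
    F.Route (F.seg i j 0 (s - 1)) (F.pos i j s) (F.pos i k t)
      (F.len i j - s + F.len j k + (F.len i k - t)) := by
  have hne := h.ne_facts
  obtain ⟨e1, e2, e3, e4, e5, e6, e7, e8, e9, e10, e11, e12, e13, e14, e15, e16⟩ :=
    F.len_facts hG h
  have P := (((F.path_to_end h.ij (by omega : s ≤ F.len i j)).trans
    (F.path_full h.jk) ?_).trans
    (F.path_to_end h.ik (by omega : t ≤ F.len i k)).symm ?_)
  · refine ⟨_, ?_, ?_, P⟩
    · simp only [Set.union_subset_iff]
      exact ⟨⟨F.seg_subset_verts h.ij le_rfl,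
        F.seg_subset_verts h.jk le_rfl⟩,
        F.seg_subset_verts h.ik le_rfl⟩
    · rintro v ((hv | hv) | hv) <;> revert v <;>
      refine F.not_mem_seg (by simp [hne]) (by simp [hne]) (by omega) (by omega) ?_ <;>
      · intro s h1 h2 t h3 h4
        simp [SameCoord, hne] <;> omega
  · refine F.sep_br hG (by simp [hne]) (by simp [hne]) (by omega) (by omega) ?_ <;>
    · intro s h1 h2 t h3 h4
      simp [SameCoord, AdjCoord, AtBr, hne] <;> omega
  · refine SepAt.union_left ?_ ?_ <;>
    refine F.sep_br hG (by simp [hne]) (by simp [hne]) (by omega) (by omega) ?_ <;>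
    · intro s h1 h2 t h3 h4
      simp [SameCoord, AdjCoord, AtBr, hne] <;> omega

theorem route_around (hG : InGFamily ℓ G) (h : Distinct4 i j k l) {s t : ℕ} (hs : s ≤ F.len i j)
    (ht : t < F.len i k) (hs0 : 2 ≤ s) :
    F.Route ∅ (F.pos i j s) (F.pos i k t)
      (F.len i j - s + F.len j l + F.len l i + t) := by
  have hne := h.ne_facts
  obtain ⟨e1, e2, e3, e4, e5, e6, e7, e8, e9, e10, e11, e12, e13, e14, e15, e16⟩ :=
    F.len_facts hG h
  have P := ((((F.path_to_end h.ij (by omega : s ≤ F.len i j)).trans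
    (F.path_full h.jl) ?_).trans
    (F.path_full h.il.symm) ?_).trans
    (F.path_to_start h.ik (by omega : t ≤ F.len i k)).symm ?_)
  · refine ⟨_, ?_, ?_, P⟩
    · simp only [Set.union_subset_iff]
      exact ⟨⟨⟨F.seg_subset_verts h.ij le_rfl,
        F.seg_subset_verts h.jl le_rfl⟩,
        F.seg_subset_verts h.il.symm le_rfl⟩,
        F.seg_subset_verts h.ik (by omega)⟩
    · simp
  · refine F.sep_br hG (by simp [hne]) (by simp [hne]) (by omega) (by omega) ?_ <;>
    · intro s h1 h2 t h3 h4
      simp [SameCoord, AdjCoord, AtBr, hne] <;> omega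
  · refine SepAt.union_left ?_ ?_ <;>
    refine F.sep_br hG (by simp [hne]) (by simp [hne]) (by omega) (by omega) ?_ <;>
    · intro s h1 h2 t h3 h4
      simp [SameCoord, AdjCoord, AtBr, hne] <;> omega
  · refine SepAt.union_left (SepAt.union_left ?_ ?_) ?_ <;>
    refine F.sep_br hG (by simp [hne]) (by simp [hne]) (by omega) (by omega) ?_ <;>
    · intro s h1 h2 t h3 h4
      simp [SameCoord, AdjCoord, AtBr, hne] <;> omega

theorem route_top (hG : InGFamily ℓ G) (h : Distinct4 i j k l) {s t : ℕ} (hs : s ≤ F.len i j)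
    (ht : t ≤ F.len i k) (hs0 : 1 ≤ s) (ht0 : 1 ≤ t)
    (hjk : 2 ≤ F.len j k) :
    F.Route ∅ (F.pos i j s) (F.pos i k t)
      (F.len i j - s + F.len j l + F.len l k + (F.len i k - t)) := by
  have hne := h.ne_facts
  obtain ⟨e1, e2, e3, e4, e5, e6, e7, e8, e9, e10, e11, e12, e13, e14, e15, e16⟩ :=
    F.len_facts hG h
  have P := ((((F.path_to_end h.ij (by omega : s ≤ F.len i j)).trans
    (F.path_full h.jl) ?_).trans
    (F.path_full h.kl.symm) ?_).trans
    (F.path_to_end h.ik (by omega : t ≤ F.len i k)).symm ?_)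
  · refine ⟨_, ?_, ?_, P⟩
    · simp only [Set.union_subset_iff]
      exact ⟨⟨⟨F.seg_subset_verts h.ij le_rfl,
        F.seg_subset_verts h.jl le_rfl⟩,
        F.seg_subset_verts h.kl.symm le_rfl⟩,
        F.seg_subset_verts h.ik le_rfl⟩
    · simp
  · refine F.sep_br hG (by simp [hne]) (by simp [hne]) (by omega) (by omega) ?_ <;>
    · intro s h1 h2 t h3 h4
      simp [SameCoord, AdjCoord, AtBr, hne] <;> omega
  · refine SepAt.union_left ?_ ?_ <;>
    refine F.sep_br hG (by simp [hne]) (by simp [hne]) (by omega) (by omega) ?_ <;>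
    · intro s h1 h2 t h3 h4
      simp [SameCoord, AdjCoord, AtBr, hne] <;> omega
  · refine SepAt.union_left (SepAt.union_left ?_ ?_) ?_ <;>
    refine F.sep_br hG (by simp [hne]) (by simp [hne]) (by omega) (by omega) ?_ <;>
    · intro s h1 h2 t h3 h4
      simp [SameCoord, AdjCoord, AtBr, hne] <;> omega

theorem route_all (hG : InGFamily ℓ G) (h : Distinct4 i j k l) {s t : ℕ} (hs : s + 2 ≤ F.len i j)
    (ht : t ≤ F.len i k) (ht0 : 2 ≤ t)
    (hkl : 2 ≤ F.len k l) :
    F.Route (F.seg i k 1 (t - 1)) (F.pos i j s) (F.pos i k t)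
      (s + F.len i l + F.len l j + F.len j k + (F.len i k - t)) := by
  have hne := h.ne_facts
  obtain ⟨e1, e2, e3, e4, e5, e6, e7, e8, e9, e10, e11, e12, e13, e14, e15, e16⟩ :=
    F.len_facts hG h
  have P := (((((F.path_to_start h.ij (by omega : s ≤ F.len i j)).trans
    (F.path_full h.il) ?_).trans
    (F.path_full h.jl.symm) ?_).trans
    (F.path_full h.jk) ?_).trans
    (F.path_to_end h.ik (by omega : t ≤ F.len i k)).symm ?_)
  · refine ⟨_, ?_, ?_, P⟩
    · simp only [Set.union_subset_iff]
      exact ⟨⟨⟨⟨F.seg_subset_verts h.ij (by omega),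
        F.seg_subset_verts h.il le_rfl⟩,
        F.seg_subset_verts h.jl.symm le_rfl⟩,
        F.seg_subset_verts h.jk le_rfl⟩,
        F.seg_subset_verts h.ik le_rfl⟩
    · rintro v ((((hv | hv) | hv) | hv) | hv) <;> revert v <;>
      refine F.not_mem_seg (by simp [hne]) (by simp [hne]) (by omega) (by omega) ?_ <;>
      · intro s h1 h2 t h3 h4
        simp [SameCoord, hne] <;> omega
  · refine F.sep_br hG (by simp [hne]) (by simp [hne]) (by omega) (by omega) ?_ <;>
    · intro s h1 h2 t h3 h4
      simp [SameCoord, AdjCoord, AtBr, hne] <;> omega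
  · refine SepAt.union_left ?_ ?_ <;>
    refine F.sep_br hG (by simp [hne]) (by simp [hne]) (by omega) (by omega) ?_ <;>
    · intro s h1 h2 t h3 h4
      simp [SameCoord, AdjCoord, AtBr, hne] <;> omega
  · refine SepAt.union_left (SepAt.union_left ?_ ?_) ?_ <;>
    refine F.sep_br hG (by simp [hne]) (by simp [hne]) (by omega) (by omega) ?_ <;>
    · intro s h1 h2 t h3 h4
      simp [SameCoord, AdjCoord, AtBr, hne] <;> omega
  · refine SepAt.union_left (SepAt.union_left (SepAt.union_left ?_ ?_) ?_) ?_ <;>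
    refine F.sep_br hG (by simp [hne]) (by simp [hne]) (by omega) (by omega) ?_ <;>
    · intro s h1 h2 t h3 h4
      simp [SameCoord, AdjCoord, AtBr, hne] <;> omega

theorem route_opp (hG : InGFamily ℓ G) (h : Distinct4 i j k l) {a b : ℕ} (ha : a < F.len i j)
    (hb : b < F.len k l) :
    F.Route ∅ (F.pos i j a) (F.pos k l b)
      (a + F.len i k + b) := by
  have hne := h.ne_facts
  obtain ⟨e1, e2, e3, e4, e5, e6, e7, e8, e9, e10, e11, e12, e13, e14, e15, e16⟩ :=
    F.len_facts hG h
  have P := (((F.path_to_start h.ij (by omega : a ≤ F.len i j)).trans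
    (F.path_full h.ik) ?_).trans
    (F.path_to_start h.kl (by omega : b ≤ F.len k l)).symm ?_)
  · refine ⟨_, ?_, ?_, P⟩
    · simp only [Set.union_subset_iff]
      exact ⟨⟨F.seg_subset_verts h.ij (by omega),
        F.seg_subset_verts h.ik le_rfl⟩,
        F.seg_subset_verts h.kl (by omega)⟩
    · simp
  · refine F.sep_br hG (by simp [hne]) (by simp [hne]) (by omega) (by omega) ?_ <;>
    · intro s h1 h2 t h3 h4
      simp [SameCoord, AdjCoord, AtBr, hne] <;> omega
  · refine SepAt.union_left ?_ ?_ <;>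
    refine F.sep_br hG (by simp [hne]) (by simp [hne]) (by omega) (by omega) ?_ <;>
    · intro s h1 h2 t h3 h4
      simp [SameCoord, AdjCoord, AtBr, hne] <;> omega

end Frame

namespace Frame

variable {G : SimpleGraph V} {ℓ : ℕ} {F : Frame G ℓ} {i j k l : Fin 4}

theorem not_jump_arris (hℓ : 5 ≤ ℓ) (hG : InGFamily ℓ G) (h : Distinct4 i j k l) {a b n : ℕ}
    (hab : a < b) (hb : b ≤ F.len i j) {N : Set V}
    (hN : ∀ v ∈ F.verts, v ∈ N → v ∈ F.seg i j (a + 1) (b - 1)) :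
    ¬ Jump G F.verts N (F.pos i j a) (F.pos i j b) n := by
  intro hJ
  obtain ⟨e1, e2, e3, e4, e5, e6, e7, e8, e9, e10, e11, e12, e13, e14, e15, e16⟩ :=
    F.len_facts hG h
  have hab2 : a + 2 ≤ b := by
    by_contra hlt
    refine hJ.not_adj ((F.same i j h.ij a (by omega) b hb).2.2 ?_)
    omega
  have g0 := (F.route_arris h.ij hab.le hb).girth_le hG hJ
  have r1 := F.route_face hG h hab2 hb
  have g1 := r1.girth_le hG hJ
  have p1 := r1.even_or_eq hG hJ hN
  rcases Nat.lt_or_ge (F.len i l) 2 with hil | hil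
  · have p2 := (F.route_long hG h.swap34 hab2 hb (by omega)).even_or_eq hG hJ hN
    omega
  · have p2 := (F.route_long hG h hab2 hb hil).even_or_eq hG hJ hN
    omega

theorem not_jump_branch (hℓ : 5 ≤ ℓ) (hG : InGFamily ℓ G) (h : Distinct4 i j k l) {t n : ℕ}
    (ht0 : 0 < t) (ht : t < F.len i k) : ¬ Jump G F.verts ∅ (F.br j) (F.pos i k t) n := by
  intro hJ
  obtain ⟨e1, e2, e3, e4, e5, e6, e7, e8, e9, e10, e11, e12, e13, e14, e15, e16⟩ :=
    F.len_facts hG h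
  have hJ1 := hJ
  rw [← F.pos_len_eq_br i j] at hJ1
  have hJ2 := hJ
  rw [← F.pos_len_eq_br k j, F.pos_symm i k ht.le] at hJ2
  have N0 : ∀ v ∈ F.verts, v ∈ (∅ : Set V) → v ∈ (∅ : Set V) := fun _ _ h => h
  have r1 := F.route_corner hG h le_rfl ht.le (Or.inr ht)
  have g1 := r1.girth_le hG hJ1
  have p1 := r1.even_or_eq hG hJ1 N0
  have r2 := F.route_corner hG h.swap13 (t := F.len i k - t) le_rfl (by omega) (Or.inr (by omega))
  have g2 := r2.girth_le hG hJ2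
  have p2 := r2.even_or_eq hG hJ2 N0
  rcases Nat.lt_or_ge (F.len i j) 2 with h2 | h2
  · have r3 := F.route_around hG h.swap13 (t := F.len i k - t) le_rfl (by omega) (by omega)
    have g3 := r3.girth_le hG hJ2
    have p3 := r3.even_or_eq hG hJ2 N0
    omega
  · have r4 := F.route_around hG h le_rfl ht h2
    have g4 := r4.girth_le hG hJ1
    have p4 := r4.even_or_eq hG hJ1 N0
    rcases Nat.lt_or_ge (F.len k j) 2 with h3 | h3
    · omega
    · have r3 := F.route_around hG h.swap13 (t := F.len i k - t) le_rfl (by omega) (by omega)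
      have g3 := r3.girth_le hG hJ2
      have p3 := r3.even_or_eq hG hJ2 N0
      omega

theorem jump_corner (hG : InGFamily ℓ G) (h : Distinct4 i j k l) {s t n : ℕ}
    (hs0 : 0 < s) (hs : s < F.len i j) (ht0 : 0 < t) (ht : t < F.len i k)
    (hJ : Jump G F.verts ∅ (F.pos i j s) (F.pos i k t) n) :
    F.len j k = 1 ∧ s = 1 ∧ t = 1 ∧ 2 * ℓ + 1 ≤ n + 2 := by
  obtain ⟨e1, e2, e3, e4, e5, e6, e7, e8, e9, e10, e11, e12, e13, e14, e15, e16⟩ :=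
    F.len_facts hG h
  have N0 : ∀ v ∈ F.verts, v ∈ (∅ : Set V) → v ∈ (∅ : Set V) := fun _ _ h => h
  have N1 : ∀ A : Set V, ∀ v ∈ F.verts, v ∈ (∅ : Set V) → v ∈ A := fun _ _ _ h => h.elim
  have r1 := F.route_corner hG h hs.le ht.le (Or.inr ht)
  have g1 := r1.girth_le hG hJ
  have p1 := r1.even_or_eq hG hJ N0
  have r2 := F.route_across hG h hs.le ht.le hs0 ht0
  have g2 := r2.girth_le hG hJ
  have p2 := r2.even_or_eq hG hJ (N1 _)
  have p3 : 2 ≤ s → _ := fun h2 => (F.route_around hG h hs.le ht h2).even_or_eq hG hJ N0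
  have p3' : 2 ≤ t → _ := fun h2 =>
    (F.route_around hG h.swap23 ht.le hs h2).symm.even_or_eq hG hJ N0
  have p4 : 2 ≤ F.len j k → _ := fun h2 =>
    (F.route_top hG h hs.le ht.le hs0 ht0 h2).even_or_eq hG hJ N0
  have p5 : s + 2 ≤ F.len i j → 2 ≤ t → _ := fun h1 h2 =>
    (F.route_all hG h h1 ht.le h2 (by omega)).even_or_eq hG hJ (N1 _)
  have p5' : t + 2 ≤ F.len i k → 2 ≤ s → _ := fun h1 h2 =>
    (F.route_all hG h.swap23 h1 hs.le h2 (by omega)).symm.even_or_eq hG hJ (N1 _)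
  by_cases par : (n + (s + t)) % 2 = 0
  · have hn : n = s + t := by
      clear p3 p3' p4 p5 p5'
      omega
    clear p4 p5 p5'
    by_cases a1 : 2 ≤ s
    · have := p3 a1
      clear p3 p3'
      omega
    · clear p3
      by_cases a2 : 2 ≤ t
      · have := p3' a2
        clear p3'
        omega
      · omega
  · clear p3 p3' g1
    have hn : n + (s + t) = 2 * ℓ + 1 := by
      clear p2 g2 p4 p5 p5'
      omega
    clear p1
    have hjk : F.len j k = 1 := by
      by_contra hne
      have := p4 (by omega)
      clear p4 p5 p5' p2 g2
      omega
    clear p4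
    have hst : s + t ≤ ℓ := by
      clear p5 p5' p2
      omega
    clear p2 g2
    have h1 : t = 1 ∨ s + 1 = F.len i j := by
      by_contra hne
      have := p5 (by omega) (by omega)
      clear p5 p5'
      omega
    have h2 : s = 1 ∨ t + 1 = F.len i k := by
      by_contra hne
      have := p5' (by omega) (by omega)
      clear p5 p5'
      omega
    clear p5 p5'
    omega

theorem jump_opp (hG : InGFamily ℓ G) (h : Distinct4 i j k l) {a b n : ℕ}
    (ha0 : 0 < a) (ha : a < F.len i j) (hb0 : 0 < b) (hb : b < F.len k l)
    (hJ : Jump G F.verts ∅ (F.pos i j a) (F.pos k l b) n) :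
    n = F.len i l ∧ a + b = F.len i j ∧ ℓ + 1 ≤ a + F.len i l ∧
        ℓ + 1 ≤ F.len i j - a + F.len i l ∨
      n = F.len i k ∧ a = b ∧ ℓ + 1 ≤ a + F.len i k ∧ ℓ + 1 ≤ F.len i j - a + F.len i k := by
  obtain ⟨e1, e2, e3, e4, e5, e6, e7, e8, e9, e10, e11, e12, e13, e14, e15, e16⟩ :=
    F.len_facts hG h
  have N0 : ∀ v ∈ F.verts, v ∈ (∅ : Set V) → v ∈ (∅ : Set V) := fun _ _ h => h
  have r1 := F.route_opp hG h ha hb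
  have r2 := F.route_opp hG h.swap34 (b := F.len k l - b) ha (by omega)
  have r3 := F.route_opp hG h.swap12 (a := F.len i j - a) (by omega) hb
  have r4 := F.route_opp hG h.swap12.swap34 (a := F.len i j - a) (b := F.len k l - b) (by omega)
    (by omega)
  rw [← F.pos_symm i j ha.le] at r3 r4
  rw [← F.pos_symm k l hb.le] at r2 r4
  have g1 := r1.girth_le hG hJ
  have p1 := r1.even_or_eq hG hJ N0
  have g2 := r2.girth_le hG hJ
  have p2 := r2.even_or_eq hG hJ N0
  have g3 := r3.girth_le hG hJ
  have p3 := r3.even_or_eq hG hJ N0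
  have g4 := r4.girth_le hG hJ
  have p4 := r4.even_or_eq hG hJ N0
  omega

end Frame

theorem PathOn.length_pos {G : SimpleGraph V} {ind : Prop} {x y : V} {n : ℕ} {S : Set V}
    (h : PathOn G ind x y n S) (hxy : x ≠ y) : 1 ≤ n := by
  obtain ⟨f, h0, hn, -⟩ := h
  rcases Nat.eq_zero_or_pos n with rfl | h
  · exact absurd (h0.symm.trans hn) hxy
  · exact h

theorem PathOn.two {G : SimpleGraph V} {x y w : V} (hx : G.Adj x w) (hy : G.Adj w y)
    (hxy : x ≠ y) : PathOn G False x y 2 {x, w, y} := by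
  refine ((PathOn.of_adj hx).trans (PathOn.of_adj hy) ?_).mono ?_
  · rintro s (rfl | rfl) t (rfl | rfl)
    · exact ⟨fun e => e, False.elim⟩
    · exact ⟨fun e => absurd e hxy, False.elim⟩
    · exact ⟨fun _ => rfl, False.elim⟩
    · exact ⟨fun _ => rfl, False.elim⟩
  · rintro v ((rfl | rfl) | (rfl | rfl)) <;> simp

theorem InGFamily.not_two_nbrs {G : SimpleGraph V} {ℓ : ℕ} (hG : InGFamily ℓ G) {ind : Prop}
    {x y w : V} {r : ℕ} {T : Set V} (hR : PathOn G ind x y r T) (hr : r + 2 ≤ 2 * ℓ) (hxy : x ≠ y)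
    (hw : w ∉ T) (hx : G.Adj x w) (hy : G.Adj w y) : False := by
  have h1 := hR.length_pos hxy
  have := hG.girth_le (PathOn.two hx hy hxy) hR (by
    rintro v (rfl | rfl | rfl) hv
    · exact Or.inl rfl
    · exact absurd hv hw
    · exact Or.inr rfl) (by omega) (by omega)
  omega

namespace Frame

variable {G : SimpleGraph V} {ℓ : ℕ} (F : Frame G ℓ) {i j k l : Fin 4}

theorem mem_verts_cases {x : V} (hx : x ∈ F.verts) : (∃ i, x = F.br i) ∨
    ∃ i j a, i ≠ j ∧ 0 < a ∧ a < F.len i j ∧ x = F.pos i j a := by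
  obtain ⟨i, j, c, hij, hc, rfl⟩ := hx
  rcases Nat.eq_zero_or_pos c with rfl | h0
  · exact Or.inl ⟨i, F.pos_zero_eq_br i j⟩
  · rcases Nat.eq_or_lt_of_le hc with rfl | h1
    · exact Or.inl ⟨j, F.pos_len_eq_br i j⟩
    · exact Or.inr ⟨i, j, c, hij, h0, h1, rfl⟩

/-- `x` and `y` lie on a common arris. -/
def OnArris (x y : V) : Prop :=
  ∃ i j k l a b, Distinct4 i j k l ∧ a < b ∧ b ≤ F.len i j ∧ x = F.pos i j a ∧ y = F.pos i j b

/-- `x` and `y` are inner vertices of two arrises with a common end. -/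
def OnCorner (x y : V) : Prop :=
  ∃ i j k l s t, Distinct4 i j k l ∧ 0 < s ∧ s < F.len i j ∧ 0 < t ∧ t < F.len i k ∧
    x = F.pos i j s ∧ y = F.pos i k t

/-- `x` is a branch vertex, and `y` an inner vertex of an arris not containing `x`. -/
def OnBranch (x y : V) : Prop :=
  ∃ i j k l t, Distinct4 i j k l ∧ 0 < t ∧ t < F.len i k ∧ x = F.br j ∧ y = F.pos i k t

/-- `x` and `y` are inner vertices of opposite arrises. -/
def OnOpposite (x y : V) : Prop :=
  ∃ i j k l a b, Distinct4 i j k l ∧ 0 < a ∧ a < F.len i j ∧ 0 < b ∧ b < F.len k l ∧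
    x = F.pos i j a ∧ y = F.pos k l b

theorem onArris_of_pos (hij : i ≠ j) {a b : ℕ} (ha : a ≤ F.len i j) (hb : b ≤ F.len i j)
    (hab : a ≠ b) : F.OnArris (F.pos i j a) (F.pos i j b) := by
  obtain ⟨k, l, h⟩ := Distinct4.exists_of_ne hij
  rcases Nat.lt_or_gt_of_ne hab with hlt | hlt
  · exact ⟨i, j, k, l, a, b, h, hlt, hb, rfl, rfl⟩
  · refine ⟨j, i, k, l, F.len i j - a, F.len i j - b, h.swap12, by omega, ?_, F.pos_symm i j ha,
      F.pos_symm i j hb⟩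
    rw [F.len_comm j i]
    omega

theorem pair_branch (hij : i ≠ j) {a : ℕ} (ha0 : 0 < a) (ha : a < F.len i j) (m : Fin 4) :
    (F.OnArris (F.br m) (F.pos i j a) ∧ F.OnArris (F.pos i j a) (F.br m)) ∨
      F.OnBranch (F.br m) (F.pos i j a) := by
  by_cases hi : m = i
  · subst hi
    rw [← F.pos_zero_eq_br m j]
    exact Or.inl ⟨F.onArris_of_pos hij (Nat.zero_le _) ha.le ha0.ne,
      F.onArris_of_pos hij ha.le (Nat.zero_le _) ha0.ne'⟩
  · by_cases hj : m = j
    · subst hj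
      rw [← F.pos_len_eq_br i m]
      exact Or.inl ⟨F.onArris_of_pos hij le_rfl ha.le ha.ne',
        F.onArris_of_pos hij ha.le le_rfl ha.ne⟩
    · obtain ⟨l, h⟩ := Distinct4.exists_of_ne₃ (Ne.symm hi) hij hj
      exact Or.inr ⟨i, m, j, l, a, h, ha0, ha, rfl, rfl⟩

theorem pair_corner (hij : i ≠ j) (hik : i ≠ k) {a b : ℕ} (ha0 : 0 < a) (ha : a < F.len i j)
    (hb0 : 0 < b) (hb : b < F.len i k) (hne : F.pos i j a ≠ F.pos i k b) :
    F.OnArris (F.pos i j a) (F.pos i k b) ∨ F.OnCorner (F.pos i j a) (F.pos i k b) := by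
  by_cases hjk : j = k
  · subst hjk
    exact Or.inl (F.onArris_of_pos hij ha.le hb.le (fun e => hne (by rw [e])))
  · obtain ⟨l, h⟩ := Distinct4.exists_of_ne₃ hij hik hjk
    exact Or.inr ⟨i, j, k, l, a, b, h, ha0, ha, hb0, hb, rfl, rfl⟩

theorem pair_cases {x y : V} (hx : x ∈ F.verts) (hy : y ∈ F.verts) (hxy : x ≠ y) :
    F.OnArris x y ∨ F.OnCorner x y ∨ F.OnBranch x y ∨ F.OnBranch y x ∨ F.OnOpposite x y := by
  rcases F.mem_verts_cases hx with ⟨i, rfl⟩ | ⟨i, j, a, hij, ha0, ha, rfl⟩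
  · rcases F.mem_verts_cases hy with ⟨j, rfl⟩ | ⟨k, l, b, hkl, hb0, hb, rfl⟩
    · have hij : i ≠ j := fun e => hxy (by rw [e])
      have := F.one_le i j hij
      have := F.onArris_of_pos hij (Nat.zero_le _) le_rfl (by omega : 0 ≠ F.len i j)
      rw [F.pos_zero_eq_br, F.pos_len_eq_br] at this
      exact Or.inl this
    · rcases F.pair_branch hkl hb0 hb i with h | h
      · exact Or.inl h.1
      · exact Or.inr (Or.inr (Or.inl h))
  · rcases F.mem_verts_cases hy with ⟨k, rfl⟩ | ⟨k, l, b, hkl, hb0, hb, rfl⟩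
    · rcases F.pair_branch hij ha0 ha k with h | h
      · exact Or.inl h.2
      · exact Or.inr (Or.inr (Or.inr (Or.inl h)))
    · have e1 := F.pos_symm i j ha.le
      have e2 := F.pos_symm k l hb.le
      have c1 := F.len_comm i j
      have c2 := F.len_comm k l
      by_cases hik : i = k
      · subst hik
        rcases F.pair_corner hij hkl ha0 ha hb0 hb hxy with h | h
        · exact Or.inl h
        · exact Or.inr (Or.inl h)
      by_cases hil : i = l
      · subst hil
        rw [e2] at hxy ⊢
        rcases F.pair_corner hij hkl.symm ha0 ha (by omega) (by omega) hxy with h | h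
        · exact Or.inl h
        · exact Or.inr (Or.inl h)
      by_cases hjk : j = k
      · subst hjk
        rw [e1] at hxy ⊢
        rcases F.pair_corner hij.symm hkl (by omega) (by omega) hb0 hb hxy with h | h
        · exact Or.inl h
        · exact Or.inr (Or.inl h)
      by_cases hjl : j = l
      · subst hjl
        rw [e1, e2] at hxy ⊢
        rcases F.pair_corner hij.symm hkl.symm (by omega) (by omega) (by omega) (by omega) hxy
          with h | h
        · exact Or.inl h
        · exact Or.inr (Or.inl h)
      exact Or.inr (Or.inr (Or.inr (Or.inr ⟨i, j, k, l, a, b, ⟨hij, hik, hil, hjk, hjl, hkl⟩, ha0,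
        ha, hb0, hb, rfl, rfl⟩)))

variable {F}

/-- Jumps between vertices of the subdivision join a corner with an opposite arris of length
one, or opposite arrises. -/
theorem jump_cases (hℓ : 5 ≤ ℓ) (hG : InGFamily ℓ G) {x y : V} {n : ℕ} (hx : x ∈ F.verts)
    (hy : y ∈ F.verts) (hJ : Jump G F.verts ∅ x y n) :
    (∃ i j k l, Distinct4 i j k l ∧ F.len j k = 1 ∧ x = F.pos i j 1 ∧ y = F.pos i k 1 ∧
      2 * ℓ + 1 ≤ n + 2) ∨
    ∃ i j k l a b, Distinct4 i j k l ∧ 0 < a ∧ a < F.len i j ∧ x = F.pos i j a ∧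
      y = F.pos k l b ∧ n = F.len i l ∧ a + b = F.len i j ∧ ℓ + 1 ≤ a + F.len i l ∧
        ℓ + 1 ≤ F.len i j - a + F.len i l := by
  rcases F.pair_cases hx hy hJ.ne with ⟨i, j, k, l, a, b, h, hab, hb, rfl, rfl⟩ |
    ⟨i, j, k, l, s, t, h, hs0, hs, ht0, ht, rfl, rfl⟩ | ⟨i, j, k, l, t, h, ht0, ht, rfl, rfl⟩ |
    ⟨i, j, k, l, t, h, ht0, ht, rfl, rfl⟩ | ⟨i, j, k, l, a, b, h, ha0, ha, hb0, hb, rfl, rfl⟩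
  · exact absurd hJ (not_jump_arris hℓ hG h hab hb fun _ _ h => h.elim)
  · obtain ⟨h1, rfl, rfl, h2⟩ := jump_corner hG h hs0 hs ht0 ht hJ
    exact Or.inl ⟨i, j, k, l, h, h1, rfl, rfl, h2⟩
  · exact absurd hJ (not_jump_branch hℓ hG h ht0 ht)
  · exact absurd hJ.symm (not_jump_branch hℓ hG h ht0 ht)
  · right
    rcases jump_opp hG h ha0 ha hb0 hb hJ with ⟨h1, h2, h3, h4⟩ | ⟨h1, h2, h3, h4⟩
    · exact ⟨i, j, k, l, a, b, h, ha0, ha, rfl, rfl, h1, h2, h3, h4⟩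
    · have := F.len_basic h
      exact ⟨i, j, l, k, a, F.len k l - b, h.swap34, ha0, ha, rfl, F.pos_symm k l hb.le, h1,
        by omega, h3, h4⟩

theorem four_le_of_jump (hℓ : 5 ≤ ℓ) (hG : InGFamily ℓ G) {x y : V} {n : ℕ} (hx : x ∈ F.verts)
    (hy : y ∈ F.verts) (hJ : Jump G F.verts ∅ x y n) : 4 ≤ n := by
  rcases jump_cases hℓ hG hx hy hJ with ⟨i, j, k, l, h, -, -, -, hn⟩ |
    ⟨i, j, k, l, a, b, h, ha0, ha, -, -, rfl, h2, h3, h4⟩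
  · omega
  · have := F.len_facts hG h
    omega

theorem Route.mono {A B : Set V} {x y : V} {n : ℕ} (h : F.Route A x y n) (hBA : B ⊆ A) :
    F.Route B x y n := by
  obtain ⟨T, h1, h2, h3⟩ := h
  exact ⟨T, h1, fun v hv hB => h2 v hv (hBA hB), h3⟩

theorem exists_short_route (hℓ : 5 ≤ ℓ) (hG : InGFamily ℓ G) {x y : V} (hx : x ∈ F.verts)
    (hy : y ∈ F.verts) (hxy : x ≠ y) : ∃ r, r + 2 ≤ 2 * ℓ ∧ F.Route ∅ x y r := by
  have hbr : ∀ {x y}, F.OnBranch x y → ∃ r, r + 2 ≤ 2 * ℓ ∧ F.Route ∅ x y r := by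
    rintro _ _ ⟨i, j, k, l, t, h, ht0, ht, rfl, rfl⟩
    have := F.len_facts hG h
    have r1 := F.route_corner hG h le_rfl ht.le (Or.inr ht)
    have r2 := F.route_corner hG h.swap13 (t := F.len i k - t) le_rfl (by omega)
      (Or.inr (by omega))
    rw [← F.pos_symm i k ht.le, F.pos_len_eq_br] at r2
    rw [F.pos_len_eq_br] at r1
    rcases Nat.lt_or_ge ℓ (F.len i j + t) with h1 | h1
    · exact ⟨_, by omega, r2⟩
    · exact ⟨_, by omega, r1⟩
  rcases F.pair_cases hx hy hxy with ⟨i, j, k, l, a, b, h, hab, hb, rfl, rfl⟩ |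
    ⟨i, j, k, l, s, t, h, hs0, hs, ht0, ht, rfl, rfl⟩ | h | h |
    ⟨i, j, k, l, a, b, h, ha0, ha, hb0, hb, rfl, rfl⟩
  · have := F.len_le hG h
    exact ⟨b - a, by omega, F.route_arris h.ij hab.le hb⟩
  · have := F.len_facts hG h
    rcases Nat.lt_or_ge ℓ (s + t) with h1 | h1
    · exact ⟨_, by omega, (F.route_across hG h hs.le ht.le hs0 ht0).mono (Set.empty_subset _)⟩
    · exact ⟨_, by omega, F.route_corner hG h hs.le ht.le (Or.inr ht)⟩
  · exact hbr h
  · obtain ⟨r, h1, h2⟩ := hbr h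
    exact ⟨r, h1, h2.symm⟩
  · have := F.len_facts hG h
    have r1 := F.route_opp hG h ha hb
    have r2 := F.route_opp hG h.swap34 (b := F.len k l - b) ha (by omega)
    have r3 := F.route_opp hG h.swap12 (a := F.len i j - a) (by omega) hb
    have r4 := F.route_opp hG h.swap12.swap34 (a := F.len i j - a) (b := F.len k l - b) (by omega)
      (by omega)
    rw [← F.pos_symm i j ha.le] at r3 r4
    rw [← F.pos_symm k l hb.le] at r2 r4
    by_cases c1 : a + F.len i k + b + 2 ≤ 2 * ℓ
    · exact ⟨_, c1, r1⟩
    by_cases c2 : a + F.len i l + (F.len k l - b) + 2 ≤ 2 * ℓ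
    · exact ⟨_, c2, r2⟩
    by_cases c3 : F.len i j - a + F.len j k + b + 2 ≤ 2 * ℓ
    · exact ⟨_, c3, r3⟩
    · exact ⟨_, by omega, r4⟩

theorem one_nbr (hℓ : 5 ≤ ℓ) (hG : InGFamily ℓ G) {x y w : V} (hw : w ∉ F.verts)
    (hx : x ∈ F.verts) (hy : y ∈ F.verts) (hwx : G.Adj w x) (hwy : G.Adj w y) : x = y := by
  by_contra hxy
  obtain ⟨r, hr, T, hT, -, hP⟩ := exists_short_route hℓ hG hx hy hxy
  exact hG.not_two_nbrs hP hr hxy (fun h => hw (hT h)) hwx.symm hwy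

end Frame

/-- There is a walk of length `n` from `x` to `y` all of whose vertices are in `B`. -/
def WalkIn (G : SimpleGraph V) (B : Set V) (x y : V) (n : ℕ) : Prop :=
  ∃ f : ℕ → V, f 0 = x ∧ f n = y ∧ (∀ c ≤ n, f c ∈ B) ∧ ∀ c < n, G.Adj (f c) (f (c + 1))

section Walks

variable {G : SimpleGraph V} {B : Set V} {x y z : V} {m n : ℕ}

theorem WalkIn.of_adj (hx : x ∈ B) (hy : y ∈ B) (h : G.Adj x y) : WalkIn G B x y 1 := by
  refine ⟨fun c => if c = 0 then x else y, by simp, by simp, fun c _ => ?_, fun c hc => ?_⟩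
  · dsimp only
    split_ifs
    · exact hx
    · exact hy
  · obtain rfl : c = 0 := by omega
    simpa using h

theorem WalkIn.refl (hx : x ∈ B) : WalkIn G B x x 0 :=
  ⟨fun _ => x, rfl, rfl, fun _ _ => hx, fun _ hc => absurd hc (Nat.not_lt_zero _)⟩

theorem WalkIn.trans (h : WalkIn G B x y m) (h' : WalkIn G B y z n) :
    WalkIn G B x z (m + n) := by
  obtain ⟨f, hf0, hfm, hfB, hf⟩ := h
  obtain ⟨g, hg0, hgn, hgB, hg⟩ := h'
  have hgf : ∀ c, m ≤ c → (if c ≤ m then f c else g (c - m)) = g (c - m) := by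
    intro c hc
    split_ifs with h
    · obtain rfl : c = m := le_antisymm h hc
      rw [hfm, Nat.sub_self, hg0]
    · rfl
  refine ⟨fun c => if c ≤ m then f c else g (c - m), by simpa using hf0, ?_, fun c hc => ?_,
    fun c hc => ?_⟩
  · dsimp only
    rw [hgf _ (Nat.le_add_right m n), Nat.add_sub_cancel_left, hgn]
  · dsimp only
    split_ifs with h
    · exact hfB c h
    · exact hgB _ (by omega)
  · dsimp only
    rcases Nat.lt_or_ge c m with h | h
    · rw [if_pos h.le, if_pos (Nat.succ_le_of_lt h)]
      exact hf c h
    · rw [hgf c h, hgf (c + 1) (by omega), Nat.sub_add_comm h]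
      exact hg _ (by omega)

theorem WalkIn.of_fun {f : ℕ → V} {N a b : ℕ} (hB : ∀ c ≤ N, f c ∈ B)
    (hf : ∀ c < N, G.Adj (f c) (f (c + 1))) (hab : a ≤ b) (hb : b ≤ N) :
    WalkIn G B (f a) (f b) (b - a) :=
  ⟨fun c => f (a + c), rfl, congrArg f (by omega), fun c hc => hB _ (by omega),
    fun c hc => hf (a + c) (by omega)⟩

/-- A shortest walk to a vertex with property `Q` is induced, reaches such a vertex only at its
end, and only its last two vertices are adjacent to such vertices. -/
theorem WalkIn.exists_shortest {Q : V → Prop} (h : ∃ n y, Q y ∧ WalkIn G B x y n) :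
    ∃ (n : ℕ) (f : ℕ → V), f 0 = x ∧ Q (f n) ∧ (∀ c ≤ n, f c ∈ B) ∧
      (∀ a b, a < b → b ≤ n → f a ≠ f b ∧ (b = a + 1 → G.Adj (f a) (f b)) ∧
        (G.Adj (f a) (f b) → b = a + 1)) ∧
      (∀ c < n, ¬ Q (f c)) ∧ ∀ c ≤ n, ∀ m ∈ B, Q m → G.Adj (f c) m → n ≤ c + 1 := by
  classical
  have hmin := fun m hm => Nat.find_min h (m := m) hm
  obtain ⟨y, hQ, f, hf0, hfn, hfB, hf⟩ := Nat.find_spec h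
  set n := Nat.find h
  subst hfn
  have pre : ∀ c ≤ n, WalkIn G B x (f c) c := fun c hc => by
    have := WalkIn.of_fun hfB hf (Nat.zero_le c) hc
    rwa [hf0, Nat.sub_zero] at this
  have hQlt : ∀ c < n, ¬ Q (f c) := fun c hc hQc => hmin c hc ⟨f c, hQc, pre c hc.le⟩
  have hind : ∀ a b, a < b → b ≤ n → G.Adj (f a) (f b) → b = a + 1 := by
    intro a b hab hb e
    by_contra hne
    refine hmin (a + 1 + (n - b)) (by omega) ⟨f n, hQ, ?_⟩
    exact ((pre a (by omega)).trans (WalkIn.of_adj (hfB a (by omega)) (hfB b hb) e)).trans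
      (WalkIn.of_fun hfB hf hb le_rfl)
  refine ⟨n, f, hf0, hQ, hfB, fun a b hab hb => ⟨fun e => ?_, ?_, hind a b hab hb⟩, hQlt, ?_⟩
  · rcases Nat.eq_or_lt_of_le hb with rfl | hlt
    · exact hQlt a hab (e ▸ hQ)
    · have := hind a (b + 1) (by omega) hlt (e ▸ hf b hlt)
      omega
  · rintro rfl
    exact hf a hb
  · intro c hc m hm hQm e
    by_contra hlt
    exact hmin (c + 1) (by omega) ⟨m, hQm, (pre c hc).trans (WalkIn.of_adj (hfB c hc) hm e)⟩

end Walks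

/-- `f` is a proper colouring of the subgraph induced on `A`. -/
def ProperOn (G : SimpleGraph V) (A : Set V) (f : V → Fin 3) : Prop :=
  ∀ a ∈ A, ∀ b ∈ A, G.Adj a b → f a ≠ f b

section Critical

variable {G : SimpleGraph V}

theorem VertexCritical.not_properOn_univ (h : VertexCritical 4 G) (f : V → Fin 3) :
    ¬ ProperOn G Set.univ f := by
  intro hf
  have hc : G.Colorable 3 := ⟨Coloring.mk f fun {a b} hab => hf a trivial b trivial hab⟩
  have h1 := chromaticNumber_le_iff_colorable.2 hc
  rw [h.1] at h1
  exact absurd h1 (by decide)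

theorem VertexCritical.exists_properOn (h : VertexCritical 4 G) (v : V) :
    ∃ f, ProperOn G {v}ᶜ f := by
  have hc : (G.induce ({v}ᶜ : Set V)).Colorable 3 := by
    rw [← chromaticNumber_le_iff_colorable]
    have := h.2 v
    rw [show ((4 : ℕ) : ℕ∞) = ((3 : ℕ) : ℕ∞) + 1 from rfl,
      ENat.lt_add_one_iff (ENat.natCast_ne_top 3)] at this
    exact this
  obtain ⟨C⟩ := hc
  classical
  refine ⟨fun w => if hw : w ∈ ({v}ᶜ : Set V) then C ⟨w, hw⟩ else 0, fun a ha b hb hab => ?_⟩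
  dsimp only
  rw [dif_pos ha, dif_pos hb]
  exact C.valid hab

theorem exists_kempe {A : Set V} {f : V → Fin 3} (hf : ProperOn G A f) (c : Fin 3) {x y : V}
    (hy : y ∈ A) (hxc : f x ≠ c) (hyc : f y ≠ c) :
    (∃ f', ProperOn G A f' ∧ (∀ w, f' w = c ↔ f w = c) ∧ f' x = f x ∧ f' y ≠ f y) ∨
    ∃ n S, PathOn G True x y n S ∧ (∀ w ∈ S, w ∈ A ∧ f w ≠ c) ∧ (Even n ↔ f x = f y) := by
  classical
  set B : Set V := {w | w ∈ A ∧ f w ≠ c}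
  by_cases hr : ∃ n, WalkIn G B x y n
  · right
    obtain ⟨n, hn⟩ := hr
    obtain ⟨n, g, h0, hgn, hgB, hg, -, -⟩ := WalkIn.exists_shortest (Q := (· = y)) ⟨n, y, rfl, hn⟩
    refine ⟨n, B, ⟨g, h0, hgn, hgB, fun a b hab hb =>
      ⟨(hg a b hab hb).1, (hg a b hab hb).2.1, fun _ => (hg a b hab hb).2.2⟩⟩, fun w hw => hw, ?_⟩
    have aux : ∀ c p q r : Fin 3, p ≠ c → q ≠ c → p ≠ q → r ≠ c → (¬ r = p ↔ r = q) := by decide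
    have key : ∀ m ≤ n, (Even m ↔ f x = f (g m)) := by
      intro m
      induction m with
      | zero => simp [h0]
      | succ m ih =>
        intro hm
        have ih := ih (by omega)
        have h1 := hf _ (hgB m (by omega)).1 _ (hgB (m + 1) hm).1
          ((hg m (m + 1) (by omega) hm).2.1 rfl)
        have h2 := (hgB m (by omega)).2
        have h3 := (hgB (m + 1) hm).2
        rw [Nat.even_add_one, ih]
        exact aux c _ _ _ h2 h3 h1 hxc
    rw [← hgn]
    exact key n le_rfl
  · left
    obtain ⟨d, hd1, hd2⟩ : ∃ d, d ≠ c ∧ d ≠ f y := by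
      generalize f y = q
      clear hyc hxc hr B
      revert c q
      decide
    have hyB : y ∈ B := ⟨hy, hyc⟩
    refine ⟨fun w => if ∃ n, WalkIn G B w y n then Equiv.swap (f y) d (f w) else f w, ?_, ?_, ?_, ?_⟩
    · intro a ha b hb hab
      have h1 := hf a ha b hb hab
      have key : ∀ a b, G.Adj a b → a ∈ A → f a ≠ c → (∃ n, WalkIn G B b y n) →
          ∃ n, WalkIn G B a y n := by
        rintro a b hab ha hac ⟨n, hn⟩
        have hbB : b ∈ B := by
          obtain ⟨g, h0, -, hg, -⟩ := hn
          exact h0 ▸ hg 0 (Nat.zero_le _)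
        have haB : a ∈ B := ⟨ha, hac⟩
        exact ⟨_, (WalkIn.of_adj haB hbB hab).trans hn⟩
      have hB : ∀ a, (∃ n, WalkIn G B a y n) → f a ≠ c := by
        rintro a ⟨n, g, h0, -, hg, -⟩
        exact h0 ▸ (hg 0 (Nat.zero_le _)).2
      have hs : ∀ p, p ≠ c → Equiv.swap (f y) d p ≠ c := by
        intro p hp e
        rw [Equiv.swap_apply_def] at e
        split_ifs at e
        · exact hd1 e
        · exact hyc e
        · exact hp e
      dsimp only
      by_cases ha' : ∃ n, WalkIn G B a y n <;> by_cases hb' : ∃ n, WalkIn G B b y n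
      · rw [if_pos ha', if_pos hb']
        exact fun e => h1 ((Equiv.swap _ _).injective e)
      · rw [if_pos ha', if_neg hb']
        have : f b = c := by
          by_contra hbc
          exact hb' (key b a hab.symm hb hbc ha')
        rw [this]
        exact hs _ (hB a ha')
      · rw [if_neg ha', if_pos hb']
        have : f a = c := by
          by_contra hac
          exact ha' (key a b hab ha hac hb')
        rw [this]
        exact (hs _ (hB b hb')).symm
      · rw [if_neg ha', if_neg hb']
        exact h1
    · intro w
      dsimp only
      split_ifs
      · rw [Equiv.swap_apply_def]
        split_ifs with e1 e2
        · rw [e1]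
          exact iff_of_false hd1 hyc
        · rw [e2]
          exact iff_of_false hyc hd1
        · rfl
      · rfl
    · exact if_neg hr
    · dsimp only
      rw [if_pos ⟨0, WalkIn.refl hyB⟩, Equiv.swap_apply_left]
      exact hd2

end Critical

section Center

variable {G : SimpleGraph V} {ℓ : ℕ}

theorem PathOn.two_le {ind : Prop} {x y : V} {n : ℕ} {S : Set V} (h : PathOn G ind x y n S)
    (hxy : x ≠ y) (hadj : ¬ G.Adj x y) : 2 ≤ n := by
  have h1 := h.length_pos hxy
  obtain ⟨f, h0, hn, -, hf⟩ := h
  by_contra hlt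
  obtain rfl : n = 1 := by omega
  exact hadj (h0 ▸ hn ▸ (hf 0 1 one_pos le_rfl).2.1 rfl)

theorem InGFamily.not_triangle (hG : InGFamily ℓ G) (hℓ : 5 ≤ ℓ) {x y w : V} (hx : G.Adj w x)
    (hy : G.Adj w y) : ¬ G.Adj x y := fun h =>
  hG.not_two_nbrs (ind := False) (PathOn.of_adj h) (by omega) h.ne
    (by rintro (rfl | rfl); exacts [hx.ne rfl, hy.ne rfl]) hx.symm hy

theorem exists_perm_fin_three :
    ∀ p q a c : Fin 3, a ≠ c → ∃ σ : Equiv.Perm (Fin 3), σ p = a ∧ σ q ≠ c := by decide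

theorem fin_three_eq : ∀ c p q r : Fin 3, p ≠ c → q ≠ c → r ≠ c → p ≠ q → r ≠ p → r = q := by
  omega

theorem fin_three_not_iff :
    ∀ c p q r : Fin 3, p ≠ c → q ≠ c → r ≠ c → p ≠ q → ¬ (r = q ↔ r = p) := by omega

theorem not_star_cutset (hℓ : 5 ≤ ℓ) (hG : InGFamily ℓ G) (hcrit : VertexCritical 4 G)
    {v x y : V} {Z : Set V} (hvx : G.Adj v x) (hvy : G.Adj v y) (hxy : x ≠ y) (hZ : Z.Nonempty)
    (hv : v ∉ Z) (hx : x ∉ Z) (hy : y ∉ Z)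
    (hcut : ∀ z ∈ Z, ∀ w, w ∉ Z → G.Adj z w → w = x ∨ w = y) : False := by
  classical
  obtain ⟨z, hz⟩ := hZ
  obtain ⟨f, hf⟩ := hcrit.exists_properOn z
  obtain ⟨g, hg⟩ := hcrit.exists_properOn v
  replace hf : ProperOn G Zᶜ f := fun a ha b hb =>
    hf a (fun e => ha (e ▸ hz)) b (fun e => hb (e ▸ hz))
  have hA : ∀ a ∈ Z ∪ {x, y}, a ∈ ({v}ᶜ : Set V) := by
    rintro a (ha | rfl | rfl) rfl
    · exact hv ha
    · exact hvx.ne rfl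
    · exact hvy.ne rfl
  replace hg : ProperOn G (Z ∪ {x, y}) g := fun a ha b hb => hg a (hA a ha) b (hA b hb)
  have hxA : x ∈ Z ∪ {x, y} := by simp
  have hyA : y ∈ Z ∪ {x, y} := by simp
  have hxc := (hf v hv x hx hvx).symm
  have hyc := (hf v hv y hy hvy).symm
  obtain ⟨σ, hσ1, hσ2⟩ := exists_perm_fin_three (g x) (g y) (f x) (f v) hxc
  replace hg : ProperOn G (Z ∪ {x, y}) (fun w => σ (g w)) := fun a ha b hb hab e =>
    hg a ha b hb hab (σ.injective e)
  generalize hg' : (fun w => σ (g w)) = g' at hg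
  have hgx : g' x = f x := by rw [← hg']; exact hσ1
  have hgyc : g' y ≠ f v := by rw [← hg']; exact hσ2
  clear hg' hσ1 hσ2
  have glue : ∀ f g, ProperOn G Zᶜ f → ProperOn G (Z ∪ {x, y}) g → g x = f x → g y ≠ f y := by
    intro f g hf hg hgx hgy
    refine hcrit.not_properOn_univ (fun w => if w ∈ Z then g w else f w) ?_
    have key : ∀ a ∈ Z, ∀ b, b ∉ Z → G.Adj a b → g a ≠ f b := by
      intro a ha b hb hab
      rcases hcut a ha b hb hab with rfl | rfl
      · rw [← hgx]
        exact hg a (Or.inl ha) b hxA hab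
      · rw [← hgy]
        exact hg a (Or.inl ha) b hyA hab
    intro a _ b _ hab
    dsimp only
    split_ifs with ha hb hb
    · exact hg a (Or.inl ha) b (Or.inl hb) hab
    · exact key a ha b hb hab
    · exact (key b hb a ha hab.symm).symm
    · exact hf a ha b hb hab
  have hne := glue f g' hf hg hgx
  rcases exists_kempe hf (f v) hy hxc hyc with ⟨f', h1, h2, h3, h4⟩ | ⟨m, S, hS, hSA, hm⟩
  · refine glue f' g' h1 hg (hgx.trans h3.symm) (fin_three_eq (f v) _ _ _ hyc ?_ hgyc h4.symm hne)
    exact fun e => hyc ((h2 y).1 e)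
  rcases exists_kempe hg (f v) hyA (hgx ▸ hxc) hgyc with ⟨f', h1, h2, h3, h4⟩ | ⟨n, T, hT, hTA, hn⟩
  · refine glue f f' hf h1 (h3.trans hgx) (fin_three_eq (f v) _ _ _ hgyc hyc ?_ hne h4)
    exact fun e => hgyc ((h2 y).1 e)
  have hadj := hG.not_triangle hℓ hvx hvy
  have hm2 := hS.two_le hxy hadj
  have hn2 := hT.two_le hxy hadj
  have hP := PathOn.two hvx.symm hvy hxy
  have g1 := hG.girth_le hP hS (by
    rintro w (rfl | rfl | rfl) hw
    · exact Or.inl rfl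
    · exact absurd rfl (hSA w hw).2
    · exact Or.inr rfl) (by omega) (by omega)
  have g2 := hG.girth_le hP hT (by
    rintro w (rfl | rfl | rfl) hw
    · exact Or.inl rfl
    · exact absurd rfl (hA w (hTA w hw).1)
    · exact Or.inr rfl) (by omega) (by omega)
  rcases hG.even_or_eq hS hT (by
    intro s hs t ht hst
    rcases (hTA t ht).1 with h | h | h
    · rcases hst with rfl | hst
      · exact absurd h (hSA s hs).1
      · rcases hcut t h s (hSA s hs).1 hst.symm with h | h
        · exact Or.inl h
        · exact Or.inr (Or.inl h)
    · exact Or.inr (Or.inr (Or.inl h))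
    · exact Or.inr (Or.inr (Or.inr h))) hm2 hn2 with h | h
  · rw [Nat.even_add, hm, hn, hgx] at h
    exact fin_three_not_iff (f v) _ _ _ hgyc hyc hxc hne h
  · omega

theorem exists_last {P : ℕ → Prop} {n : ℕ} (h : ∃ c, 0 < c ∧ c < n ∧ P c) :
    ∃ c, 0 < c ∧ c < n ∧ P c ∧ ∀ d, c < d → d < n → ¬ P d := by
  induction n with
  | zero => obtain ⟨c, -, hc, -⟩ := h; omega
  | succ n ih =>
    by_cases hn : 0 < n ∧ P n
    · exact ⟨n, hn.1, by omega, hn.2, fun d h1 h2 => by omega⟩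
    · obtain ⟨c, h1, h2, h3, h4⟩ := ih (by
        obtain ⟨c, h1, h2, h3⟩ := h
        refine ⟨c, h1, ?_, h3⟩
        by_contra hc
        obtain rfl : c = n := by omega
        exact hn ⟨h1, h3⟩)
      refine ⟨c, h1, by omega, h3, fun d h5 h6 hd => ?_⟩
      rcases Nat.lt_or_ge d n with h | h
      · exact h4 d h5 h hd
      · obtain rfl : d = n := by omega
        exact hn ⟨by omega, hd⟩

/-- An induced path leaving `M` from `f 0`, returning to `M` at `f n`, and seeing in `M`
besides its ends only `x` and `y`. -/
structure Excursion (G : SimpleGraph V) (M : Set V) (x y : V) (n : ℕ) (f : ℕ → V) : Prop where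
  two_le : 2 ≤ n
  ind : ∀ a b, a < b → b ≤ n → f a ≠ f b ∧ (b = a + 1 → G.Adj (f a) (f b)) ∧
    (True → G.Adj (f a) (f b) → b = a + 1)
  left_mem : f 0 ∈ M
  right_mem : f n ∈ M
  not_mem : ∀ c, 0 < c → c < n → f c ∉ M
  nbr : ∀ c, 0 < c → c < n → ∀ m ∈ M, G.Adj (f c) m → m = f 0 ∨ m = f n ∨ m = x ∨ m = y
  one : ∀ c, 0 < c → c < n → ∀ p ∈ M, ∀ q ∈ M, G.Adj (f c) p → G.Adj (f c) q → p = q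
  left : x ∈ M ∧ x ≠ f 0 ∧ x ≠ f n
  right : y ∈ M ∧ y ≠ f 0 ∧ y ≠ f n

namespace Excursion

variable {M : Set V} {x y : V} {n : ℕ} {f : ℕ → V}

theorem symm (E : Excursion G M x y n f) : Excursion G M y x n f :=
  { E with
    nbr := fun c h1 h2 m hm e => by
      rcases E.nbr c h1 h2 m hm e with h | h | h | h
      · exact Or.inl h
      · exact Or.inr (Or.inl h)
      · exact Or.inr (Or.inr (Or.inr h))
      · exact Or.inr (Or.inr (Or.inl h))
    left := E.right
    right := E.left }

theorem ne (E : Excursion G M x y n f) {c : ℕ} (hc : c ≤ n) : f c ≠ x := by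
  rcases Nat.eq_zero_or_pos c with rfl | h0
  · exact E.left.2.1.symm
  · rcases Nat.eq_or_lt_of_le hc with rfl | h1
    · exact E.left.2.2.symm
    · exact fun e => E.not_mem c h0 h1 (e ▸ E.left.1)

theorem not_adj_zero (E : Excursion G M x y n f) {c d : ℕ} (hc : 0 < c) (hcd : c ≤ d) (hd : d < n)
    (h : G.Adj (f c) x) : ¬ G.Adj (f d) (f 0) := by
  intro e
  obtain rfl : d = 1 := (E.ind 0 d (by omega) hd.le).2.2 trivial e.symm
  obtain rfl : c = 1 := by omega
  exact E.left.2.1 (E.one 1 hc hd x E.left.1 _ E.left_mem h e)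

theorem jump_of_nbrs (E : Excursion G M x y n f) {N : Set V}
    (hN : ∀ c, 0 < c → c < n → ∀ m, m = x ∨ m = y → G.Adj (f c) m → m ∈ N) :
    Jump G M N (f 0) (f n) n := by
  refine ⟨E.two_le, _, PathOn.of_fun f n E.ind (Nat.zero_le n) le_rfl, ?_⟩
  rintro _ ⟨c, -, hc, rfl⟩
  rcases Nat.eq_zero_or_pos c with rfl | h0
  · exact Or.inl rfl
  rcases Nat.eq_or_lt_of_le hc with rfl | h1
  · exact Or.inr (Or.inl rfl)
  refine Or.inr (Or.inr ⟨E.not_mem c h0 h1, fun m hm e => ?_⟩)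
  rcases E.nbr c h0 h1 m hm e with h | h | h
  · exact Or.inl h
  · exact Or.inr (Or.inl h)
  · exact Or.inr (Or.inr (hN c h0 h1 m h e))

theorem sepAt (E : Excursion G M x y n f) {c b : ℕ} (hb : b ≤ n)
    (hlast : ∀ d, c < d → d ≤ b → ¬ G.Adj (f d) x) :
    SepAt G True (f c) {x, f c} {v | ∃ d, c ≤ d ∧ d ≤ b ∧ v = f d} := by
  rintro s (rfl | rfl) _ ⟨d, h1, h2, rfl⟩
  · refine ⟨fun e => absurd e.symm (E.ne (by omega)), fun _ e => Or.inr ?_⟩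
    rcases Nat.eq_or_lt_of_le h1 with rfl | hlt
    · rfl
    · exact absurd e.symm (hlast d hlt h2)
  · exact ⟨fun _ => rfl, fun _ _ => Or.inl rfl⟩

theorem jump_from_last (E : Excursion G M x y n f) {c : ℕ} (hc0 : 0 < c) (hc : c < n)
    (hx : G.Adj (f c) x) (hlast : ∀ d, c < d → d ≤ n → ¬ G.Adj (f d) x)
    (hy : ∀ d, c ≤ d → d < n → ¬ G.Adj (f d) y) : Jump G M ∅ x (f n) (1 + (n - c)) := by
  refine ⟨by omega, _, (PathOn.of_adj hx.symm).trans (PathOn.of_fun f n E.ind hc.le le_rfl)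
    (E.sepAt le_rfl hlast), ?_⟩
  have key : ∀ d, c ≤ d → d ≤ n → f d = x ∨ f d = f n ∨ f d ∉ M ∧
      ∀ m ∈ M, G.Adj (f d) m → m = x ∨ m = f n ∨ m ∈ (∅ : Set V) := by
    intro d h1 h2
    rcases Nat.eq_or_lt_of_le h2 with rfl | h2
    · exact Or.inr (Or.inl rfl)
    refine Or.inr (Or.inr ⟨E.not_mem d (by omega) h2, fun m hm e => ?_⟩)
    rcases E.nbr d (by omega) h2 m hm e with h | h | h | h
    · exact absurd (h ▸ e) (E.not_adj_zero hc0 h1 h2 hx)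
    · exact Or.inr (Or.inl h)
    · exact Or.inl h
    · exact absurd (h ▸ e) (hy d h1 h2)
  rintro _ ((rfl | rfl) | ⟨d, h1, h2, rfl⟩)
  · exact Or.inl rfl
  · exact key c le_rfl hc.le
  · exact key d h1 h2

theorem jump_between (E : Excursion G M x y n f) (hxy : x ≠ y) (hadj : ¬ G.Adj x y) {c e : ℕ}
    (hc0 : 0 < c) (hce : c < e) (he : e < n) (hx : G.Adj (f c) x) (hy : G.Adj (f e) y)
    (hlast : ∀ d, c < d → d ≤ e → ¬ G.Adj (f d) x)
    (hfirst : ∀ d, c ≤ d → d < e → ¬ G.Adj (f d) y) : ∃ n, Jump G M ∅ x y n := by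
  have sep : SepAt G True (f e) ({x, f c} ∪ {v | ∃ d, c ≤ d ∧ d ≤ e ∧ v = f d}) {f e, y} := by
    have key : ∀ d, c ≤ d → d ≤ e → (f d = y → f d = f e) ∧ (True → G.Adj (f d) y →
        f d = f e ∨ y = f e) := by
      intro d h1 h2
      refine ⟨fun h => absurd h (E.symm.ne (by omega)), fun _ h => Or.inl ?_⟩
      rcases Nat.eq_or_lt_of_le h2 with rfl | hlt
      · rfl
      · exact absurd h (hfirst d h1 hlt)
    rintro s ((rfl | rfl) | ⟨d, h1, h2, rfl⟩) t (rfl | rfl)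
    · exact ⟨fun h => absurd h.symm (E.ne he.le), fun _ h => Or.inr rfl⟩
    · exact ⟨fun h => absurd h hxy, fun _ h => absurd h hadj⟩
    · exact ⟨fun h => h, fun _ _ => Or.inr rfl⟩
    · exact key c le_rfl hce.le
    · exact ⟨fun h => h, fun _ _ => Or.inr rfl⟩
    · exact key d h1 h2
  refine ⟨_, by omega, _, ((PathOn.of_adj hx.symm).trans (PathOn.of_fun f n E.ind hce.le he.le)
    (E.sepAt he.le hlast)).trans (PathOn.of_adj hy) sep, ?_⟩
  have key : ∀ d, c ≤ d → d ≤ e → f d = x ∨ f d = y ∨ f d ∉ M ∧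
      ∀ m ∈ M, G.Adj (f d) m → m = x ∨ m = y ∨ m ∈ (∅ : Set V) := by
    intro d h1 h2
    refine Or.inr (Or.inr ⟨E.not_mem d (by omega) (by omega), fun m hm h => ?_⟩)
    rcases E.nbr d (by omega) (by omega) m hm h with h' | h' | h' | h'
    · exact absurd (h' ▸ h) (E.not_adj_zero hc0 h1 (by omega) hx)
    · have := (E.ind d n (by omega) le_rfl).2.2 trivial (h' ▸ h)
      obtain rfl : d = e := by omega
      exact absurd (E.one d (by omega) he _ (h' ▸ hm) y E.right.1 (h' ▸ h) hy) E.right.2.2.symm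
    · exact Or.inl h'
    · exact Or.inr (Or.inl h')
  rintro _ (((rfl | rfl) | ⟨d, h1, h2, rfl⟩) | (rfl | rfl))
  · exact Or.inl rfl
  · exact key c le_rfl hce.le
  · exact key d h1 h2
  · exact key e hce.le le_rfl
  · exact Or.inr (Or.inl rfl)

theorem exists_jump_of_lt (E : Excursion G M x y n f) (hxy : x ≠ y) (hadj : ¬ G.Adj x y) {c e : ℕ}
    (hc0 : 0 < c) (hce : c < e) (he : e < n) (hx : G.Adj (f c) x) (hy : G.Adj (f e) y)
    (hlast : ∀ d, c < d → d < n → ¬ G.Adj (f d) x) : ∃ n, Jump G M ∅ x y n := by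
  classical
  have hex : ∃ d, c ≤ d ∧ G.Adj (f d) y := ⟨e, hce.le, hy⟩
  obtain ⟨h1, h2⟩ := Nat.find_spec hex
  have h3 : Nat.find hex ≤ e := Nat.find_min' hex ⟨hce.le, hy⟩
  have h4 := fun m hm => Nat.find_min hex (m := m) hm
  generalize Nat.find hex = d at *
  have hcd : c < d := by
    rcases Nat.eq_or_lt_of_le h1 with rfl | h
    · exact absurd (E.one c hc0 (by omega) x E.left.1 y E.right.1 hx h2) hxy
    · exact h
  exact E.jump_between hxy hadj hc0 hcd (by omega) hx h2
    (fun d' h5 h6 => hlast d' h5 (by omega)) fun d' h5 h6 h7 => h4 d' h6 ⟨h5, h7⟩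

theorem jumps_of_only_left (E : Excursion G M x y n f)
    (hx : ∃ c, 0 < c ∧ c < n ∧ G.Adj (f c) x)
    (hy : ¬ ∃ c, 0 < c ∧ c < n ∧ G.Adj (f c) y) :
    (∃ n', Jump G M {x} (f 0) (f n) n') ∧ (G.Adj x (f n) ∨ ∃ n', Jump G M ∅ x (f n) n') := by
  refine ⟨⟨_, E.jump_of_nbrs ?_⟩, ?_⟩
  · rintro c h1 h2 m (rfl | rfl) h
    · rfl
    · exact absurd ⟨c, h1, h2, h⟩ hy
  · by_cases hadj : G.Adj x (f n)
    · exact Or.inl hadj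
    · obtain ⟨c, h1, h2, h3, h4⟩ := exists_last hx
      refine Or.inr ⟨_, E.jump_from_last h1 h2 h3 (fun d h5 h6 => ?_) fun d h5 h6 h7 =>
        hy ⟨d, by omega, h6, h7⟩⟩
      rcases Nat.eq_or_lt_of_le h6 with rfl | h6
      · exact fun e => hadj e.symm
      · exact h4 d h5 h6

end Excursion

/-- If `v` has exactly two neighbours `x`, `y` in `M`, then some jump leads from `v` to the rest
of `M`, possibly seeing one of `x` and `y` on the way. -/
theorem exists_jump_of_critical (hℓ : 5 ≤ ℓ) (hG : InGFamily ℓ G) (hcrit : VertexCritical 4 G)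
    {M : Set V} {v x y : V} (hv : v ∈ M) (hx : x ∈ M) (hy : y ∈ M) (hvx : G.Adj v x)
    (hvy : G.Adj v y) (hxy : x ≠ y) (hnbr : ∀ m ∈ M, G.Adj v m → m = x ∨ m = y)
    (hone : ∀ w, w ∉ M → ∀ p ∈ M, ∀ q ∈ M, G.Adj w p → G.Adj w q → p = q)
    (hrest : ∃ m ∈ M, m ≠ v ∧ m ≠ x ∧ m ≠ y) (hno : ∀ n, ¬ Jump G M ∅ x y n) :
    ∃ m ∈ M, m ≠ v ∧ m ≠ x ∧ m ≠ y ∧ ((∃ n, Jump G M ∅ v m n) ∨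
      ((∃ n, Jump G M {x} v m n) ∧ (G.Adj x m ∨ ∃ n, Jump G M ∅ x m n)) ∨
      ((∃ n, Jump G M {y} v m n) ∧ (G.Adj y m ∨ ∃ n, Jump G M ∅ y m n))) := by
  set Q : V → Prop := fun m => m ∈ M ∧ m ≠ v ∧ m ≠ x ∧ m ≠ y with hQ
  have hw : ∃ n m, Q m ∧ WalkIn G ({x, y}ᶜ : Set V) v m n := by
    by_contra hcon
    have hvB : v ∈ ({x, y}ᶜ : Set V) := by simp [hvx.ne, hvy.ne]
    have hsub : ∀ z : V, z ∈ ({v, x, y}ᶜ : Set V) → z ∈ ({x, y}ᶜ : Set V) := fun z hz h =>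
      hz (Or.inr h)
    have hmem : ∀ {z m : V} {n : ℕ}, WalkIn G ({v, x, y}ᶜ : Set V) z m n →
        z ∈ ({v, x, y}ᶜ : Set V) := by
      rintro z m n ⟨f, h0, -, hf, -⟩
      exact h0 ▸ hf 0 (Nat.zero_le _)
    refine not_star_cutset hℓ hG hcrit hvx hvy hxy
      (Z := {z | ∃ n m, Q m ∧ WalkIn G ({v, x, y}ᶜ : Set V) z m n}) ?_ ?_ ?_ ?_ ?_
    · obtain ⟨m, h1, h2, h3, h4⟩ := hrest
      exact ⟨m, 0, m, ⟨h1, h2, h3, h4⟩, WalkIn.refl (by simp [h2, h3, h4])⟩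
    · rintro ⟨n, m, -, h⟩
      exact hmem h (by simp)
    · rintro ⟨n, m, -, h⟩
      exact hmem h (by simp)
    · rintro ⟨n, m, -, h⟩
      exact hmem h (by simp)
    · rintro z ⟨n, m, hm, h⟩ w hw hzw
      by_contra hwxy
      push Not at hwxy
      by_cases hwv : w = v
      · subst hwv
        refine hcon ⟨1 + n, m, hm, (WalkIn.of_adj hvB (hsub _ (hmem h)) hzw.symm).trans ?_⟩
        obtain ⟨f, h1, h2, h3, h4⟩ := h
        exact ⟨f, h1, h2, fun c hc => hsub _ (h3 c hc), h4⟩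
      · exact hw ⟨1 + n, m, hm, (WalkIn.of_adj (by simp [hwv, hwxy]) (hmem h) hzw.symm).trans h⟩
  obtain ⟨n, f, rfl, hfn, hfB, hind, hfQ, hadj⟩ := WalkIn.exists_shortest hw
  have hB : ∀ c ≤ n, f c ≠ x ∧ f c ≠ y := fun c hc => by simpa using hfB c hc
  have hn0 : n ≠ 0 := by
    rintro rfl
    exact hfn.2.1 rfl
  have E : Excursion G M x y n f := by
    have hM : ∀ c, 0 < c → c < n → f c ∉ M := fun c h1 h2 h =>
      hfQ c h2 ⟨h, (hind 0 c h1 h2.le).1.symm, hB c h2.le⟩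
    refine ⟨?_, fun a b h1 h2 => ⟨(hind a b h1 h2).1, (hind a b h1 h2).2.1,
      fun _ => (hind a b h1 h2).2.2⟩, hv, hfn.1, hM, fun c h1 h2 m hm e => ?_,
      fun c h1 h2 p hp q hq => hone _ (hM c h1 h2) p hp q hq,
      ⟨hx, hvx.ne.symm, hfn.2.2.1.symm⟩, ⟨hy, hvy.ne.symm, hfn.2.2.2.symm⟩⟩
    · by_contra hlt
      obtain rfl : n = 1 := by omega
      rcases hnbr _ hfn.1 ((hind 0 1 one_pos le_rfl).2.1 rfl) with h | h
      · exact hfn.2.2.1 h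
      · exact hfn.2.2.2 h
    · by_cases m0 : m = f 0
      · exact Or.inl m0
      by_cases mx : m = x
      · exact Or.inr (Or.inr (Or.inl mx))
      by_cases my : m = y
      · exact Or.inr (Or.inr (Or.inr my))
      have := hadj c h2.le m (by simp [mx, my]) ⟨hm, m0, mx, my⟩ e
      exact Or.inr (Or.inl (hone _ (hM c h1 h2) m hm _ hfn.1 e
        ((hind c n h2 le_rfl).2.1 (by omega))))
  refine ⟨f n, hfn.1, hfn.2.1, hfn.2.2.1, hfn.2.2.2, ?_⟩
  by_cases h1 : ∃ c, 0 < c ∧ c < n ∧ G.Adj (f c) x <;>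
    by_cases h2 : ∃ c, 0 < c ∧ c < n ∧ G.Adj (f c) y
  · exfalso
    have hnadj := hG.not_triangle hℓ hvx hvy
    obtain ⟨c, c1, c2, c3, c4⟩ := exists_last h1
    obtain ⟨d, d1, d2, d3, d4⟩ := exists_last h2
    rcases Nat.lt_trichotomy c d with h | rfl | h
    · obtain ⟨n', h⟩ := E.exists_jump_of_lt hxy hnadj c1 h d2 c3 d3 c4
      exact hno n' h
    · exact hxy (E.one c c1 c2 x hx y hy c3 d3)
    · obtain ⟨n', h⟩ := E.symm.exists_jump_of_lt hxy.symm (fun e => hnadj e.symm) d1 h c2 d3 c3 d4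
      exact hno n' h.symm
  · exact Or.inr (Or.inl (E.jumps_of_only_left h1 h2))
  · exact Or.inr (Or.inr (E.symm.jumps_of_only_left h2 h1))
  · refine Or.inl ⟨n, E.jump_of_nbrs ?_⟩
    rintro c c1 c2 m (rfl | rfl) h
    · exact absurd ⟨c, c1, c2, h⟩ h1
    · exact absurd ⟨c, c1, c2, h⟩ h2

end Center

section Arc

variable {G : SimpleGraph V} {ℓ : ℕ}

theorem sepAt_of_jump {M N S T : Set V} {x y : V}
    (hT : ∀ w ∈ T, w = x ∨ w = y ∨ w ∉ M ∧ ∀ m ∈ M, G.Adj w m → m = x ∨ m = y ∨ m ∈ N)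
    (hSM : S ⊆ M) (hS : ∀ s ∈ S, s = x ∨ s ≠ y ∧ ¬ G.Adj s y ∧ s ∉ N) : SepAt G True x S T := by
  intro s hs t ht
  rcases hS s hs with rfl | ⟨h1, h2, h3⟩
  · exact ⟨fun _ => rfl, fun _ _ => Or.inl rfl⟩
  rcases hT t ht with rfl | rfl | ⟨h4, h5⟩
  · exact ⟨fun h => h, fun _ _ => Or.inr rfl⟩
  · exact ⟨fun h => absurd h h1, fun _ h => absurd h h2⟩
  · refine ⟨fun h => absurd (h ▸ hSM hs) h4, fun _ h => ?_⟩
    rcases h5 s (hSM hs) h.symm with h | h | h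
    · exact Or.inl h
    · exact absurd h h1
    · exact absurd h h3

/-- `f 0, …, f q` is an induced path whose inner vertices lie outside `H` and see in `H` at most
its ends. -/
structure Arc (G : SimpleGraph V) (H : Set V) (q : ℕ) (f : ℕ → V) : Prop where
  ind : ∀ a b, a < b → b ≤ q → f a ≠ f b ∧ (b = a + 1 → G.Adj (f a) (f b)) ∧
    (True → G.Adj (f a) (f b) → b = a + 1)
  left_mem : f 0 ∈ H
  right_mem : f q ∈ H
  not_mem : ∀ c, 0 < c → c < q → f c ∉ H
  nbr : ∀ c, 0 < c → c < q → ∀ m ∈ H, G.Adj (f c) m → m = f 0 ∨ m = f q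

theorem Jump.exists_arc {H : Set V} {x y : V} {q : ℕ} (hx : x ∈ H) (hy : y ∈ H)
    (hJ : Jump G H ∅ x y q) : ∃ f, f 0 = x ∧ f q = y ∧ Arc G H q f := by
  obtain ⟨-, T, ⟨f, rfl, rfl, hfT, hf⟩, hT⟩ := hJ
  have key : ∀ c, 0 < c → c < q →
      f c ∉ H ∧ ∀ m ∈ H, G.Adj (f c) m → m = f 0 ∨ m = f q ∨ m ∈ (∅ : Set V) := by
    intro c h1 h2
    rcases hT _ (hfT c h2.le) with h | h | h
    · exact absurd h.symm (hf 0 c h1 h2.le).1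
    · exact absurd h (hf c q h2 le_rfl).1
    · exact h
  refine ⟨f, rfl, rfl, hf, hx, hy, fun c h1 h2 => (key c h1 h2).1, fun c h1 h2 m hm h => ?_⟩
  rcases (key c h1 h2).2 m hm h with h | h | h
  · exact Or.inl h
  · exact Or.inr h
  · exact h.elim

namespace Arc

variable {H N : Set V} {q : ℕ} {f : ℕ → V}

/-- The vertices of `H` and of the path. -/
def union (H : Set V) (q : ℕ) (f : ℕ → V) : Set V := H ∪ {v | ∃ c ≤ q, v = f c}

theorem union_symm (H : Set V) (q : ℕ) (f : ℕ → V) :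
    union H q (fun c => f (q - c)) = union H q f := by
  ext v
  refine or_congr_right ⟨?_, ?_⟩
  · rintro ⟨c, hc, rfl⟩
    exact ⟨q - c, by omega, rfl⟩
  · rintro ⟨c, hc, rfl⟩
    exact ⟨q - c, by omega, by simp [Nat.sub_sub_self hc]⟩

theorem mem_union {c : ℕ} (hc : c ≤ q) : f c ∈ union H q f := Or.inr ⟨c, hc, rfl⟩

theorem ind_symm {N : ℕ} (hf : ∀ a b, a < b → b ≤ N → f a ≠ f b ∧
    (b = a + 1 → G.Adj (f a) (f b)) ∧ (True → G.Adj (f a) (f b) → b = a + 1)) :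
    ∀ a b, a < b → b ≤ N → f (N - a) ≠ f (N - b) ∧
    (b = a + 1 → G.Adj (f (N - a)) (f (N - b))) ∧
      (True → G.Adj (f (N - a)) (f (N - b)) → b = a + 1) := by
  intro a b h1 h2
  obtain ⟨h3, h4, h5⟩ := hf (N - b) (N - a) (by omega) (by omega)
  exact ⟨h3.symm, fun h => (h4 (by omega)).symm, fun h e => by have := h5 h e.symm; omega⟩

theorem symm (A : Arc G H q f) : Arc G H q (fun c => f (q - c)) where
  ind := ind_symm A.ind
  left_mem := A.right_mem
  right_mem := by simpa using A.left_mem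
  not_mem c h1 h2 := A.not_mem _ (by omega) (by omega)
  nbr c h1 h2 m hm h := by
    rcases A.nbr _ (by omega) (by omega) m hm h with h | h
    · exact Or.inr (by simpa using h)
    · exact Or.inl (by simpa using h)

theorem adj (A : Arc G H q f) {c : ℕ} (hc : c < q) : G.Adj (f c) (f (c + 1)) :=
  (A.ind c (c + 1) (by omega) hc).2.1 rfl

theorem eq_iff (A : Arc G H q f) {a b : ℕ} (ha : a ≤ q) (hb : b ≤ q) : f a = f b ↔ a = b := by
  refine ⟨fun h => ?_, fun h => by rw [h]⟩
  rcases Nat.lt_trichotomy a b with h1 | h1 | h1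
  · exact absurd h (A.ind a b h1 hb).1
  · exact h1
  · exact absurd h.symm (A.ind b a h1 ha).1

theorem adj_cases (A : Arc G H q f) {a b : ℕ} (ha : a ≤ q) (hb : b ≤ q)
    (h : G.Adj (f a) (f b)) : b = a + 1 ∨ a = b + 1 := by
  rcases Nat.lt_trichotomy a b with h1 | rfl | h1
  · exact Or.inl ((A.ind a b h1 hb).2.2 trivial h)
  · exact absurd rfl h.ne
  · exact Or.inr ((A.ind b a h1 ha).2.2 trivial h.symm)

theorem path (A : Arc G H q f) {ind : Prop} {a b : ℕ} (hab : a ≤ b) (hb : b ≤ q) :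
    PathOn G ind (f a) (f b) (b - a) {v | ∃ c, a ≤ c ∧ c ≤ b ∧ v = f c} :=
  (PathOn.of_fun f q A.ind hab hb).weaken

theorem exists_path (A : Arc G H q f) {a b : ℕ} (ha : a ≤ q) (hb : b ≤ q) :
    ∃ r ≤ q, PathOn G True (f a) (f b) r {v | ∃ c ≤ q, v = f c} := by
  have sub : ∀ a b, b ≤ q → {v | ∃ c, a ≤ c ∧ c ≤ b ∧ v = f c} ⊆ {v | ∃ c ≤ q, v = f c} := by
    rintro a b hb _ ⟨c, h1, h2, rfl⟩
    exact ⟨c, h2.trans hb, rfl⟩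
  rcases Nat.le_total a b with h | h
  · exact ⟨_, by omega, (A.path h hb).mono (sub a b hb)⟩
  · exact ⟨_, by omega, (A.path h ha).symm.mono (sub b a ha)⟩

theorem mem_iff (A : Arc G H q f) {c : ℕ} (hc : c ≤ q) : f c ∈ H ↔ c = 0 ∨ c = q := by
  refine ⟨fun h => ?_, ?_⟩
  · by_contra hcon
    exact A.not_mem c (by omega) (by omega) h
  · rintro (rfl | rfl)
    exacts [A.left_mem, A.right_mem]

/-- A jump from the path to the path reroutes it. -/
theorem reroute (A : Arc G H q f) {s m n : ℕ} (hsm : s < m) (hm : m ≤ q)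
    (hN : ∀ v ∈ N, ∃ c, s < c ∧ c < m ∧ v = f c)
    (hJ : Jump G (union H q f) N (f s) (f m) n) :
    Jump G H ∅ (f 0) (f q) (s - 0 + n + (q - m)) := by
  obtain ⟨hn, T, hP, hT⟩ := hJ
  have hs2 : s + 2 ≤ m := by
    by_contra hlt
    obtain rfl : m = s + 1 := by omega
    obtain ⟨g, g0, gn, -, hg⟩ := hP
    have := (hg 0 n (by omega) le_rfl).2.2 trivial (by rw [g0, gn]; exact A.adj (by omega))
    omega
  have hT' : ∀ w ∈ T, w = f m ∨ w = f s ∨ w ∉ union H q f ∧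
      ∀ v ∈ union H q f, G.Adj w v → v = f m ∨ v = f s ∨ v ∈ N := by
    intro w hw
    rcases hT w hw with h | h | ⟨h, h'⟩
    · exact Or.inr (Or.inl h)
    · exact Or.inl h
    · refine Or.inr (Or.inr ⟨h, fun v hv e => ?_⟩)
      have := h' v hv e
      tauto
  have hNout : ∀ c, c ≤ q → c ≤ s ∨ m ≤ c → f c ∉ N := by
    intro c hc h hcN
    obtain ⟨d, h1, h2, h3⟩ := hN _ hcN
    have := (A.eq_iff hc (by omega)).1 h3
    omega
  have hadj : ∀ c d, c ≤ s → m ≤ d → d ≤ q → f c ≠ f d ∧ ¬ G.Adj (f c) (f d) := fun c d h1 h2 h3 =>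
    ⟨(A.ind c d (by omega) h3).1, fun h => by
      have := (A.ind c d (by omega) h3).2.2 trivial h
      omega⟩
  refine ⟨by omega, _, ((A.path (Nat.zero_le s) (by omega)).trans hP
    (sepAt_of_jump hT ?_ ?_)).trans (A.path hm le_rfl)
      (SepAt.union_left ?_ (sepAt_of_jump hT' ?_ ?_).symm), ?_⟩
  · rintro _ ⟨c, -, h, rfl⟩
    exact mem_union (by omega)
  · rintro _ ⟨c, -, h, rfl⟩
    exact Or.inr ⟨(hadj c m h le_rfl hm).1, (hadj c m h le_rfl hm).2,
      hNout c (by omega) (Or.inl h)⟩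
  · rintro _ ⟨c, -, h1, rfl⟩ _ ⟨d, h2, h3, rfl⟩
    exact ⟨fun e => absurd e (hadj c d h1 h2 h3).1, fun _ e => absurd e (hadj c d h1 h2 h3).2⟩
  · rintro _ ⟨c, h1, h, rfl⟩
    exact mem_union (by omega)
  · rintro _ ⟨c, h1, h, rfl⟩
    exact Or.inr ⟨(hadj s c le_rfl h1 h).1.symm, fun e => (hadj s c le_rfl h1 h).2 e.symm,
      hNout c h (Or.inr h1)⟩
  · have key : ∀ c ≤ q, f c = f 0 ∨ f c = f q ∨ f c ∉ H ∧
        ∀ v ∈ H, G.Adj (f c) v → v = f 0 ∨ v = f q ∨ v ∈ (∅ : Set V) := by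
      intro c hc
      by_cases h0 : c = 0
      · exact Or.inl (by rw [h0])
      by_cases h1 : c = q
      · exact Or.inr (Or.inl (by rw [h1]))
      refine Or.inr (Or.inr ⟨A.not_mem c (by omega) (by omega), fun v hv h => ?_⟩)
      have := A.nbr c (by omega) (by omega) v hv h
      tauto
    have hH : ∀ c ≤ q, f c ∈ H → f c = f 0 ∨ f c = f q ∨ f c ∈ (∅ : Set V) := by
      intro c hc h
      rcases (A.mem_iff hc).1 h with rfl | rfl
      · exact Or.inl rfl
      · exact Or.inr (Or.inl rfl)
    rintro w ((⟨c, -, h, rfl⟩ | hw) | ⟨c, h1, h, rfl⟩)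
    · exact key c (by omega)
    · rcases hT w hw with rfl | rfl | ⟨h1, h2⟩
      · exact key s (by omega)
      · exact key m hm
      · refine Or.inr (Or.inr ⟨fun h => h1 (Or.inl h), fun v hv e => ?_⟩)
        rcases h2 v (Or.inl hv) e with rfl | rfl | h
        · exact hH s (by omega) hv
        · exact hH m hm hv
        · obtain ⟨c, h3, h4, rfl⟩ := hN v h
          exact hH c (by omega) hv
    · exact key c h

/-- A jump from the path to another vertex of `H` extends to a jump from the start of the path. -/
theorem extend (A : Arc G H q f) {s n : ℕ} {y : V} (hs : s + 2 ≤ q) (hs0 : 0 < s) (hy : y ∈ H)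
    (hy0 : y ≠ f 0) (hyq : y ≠ f q) (hN : ∀ v ∈ N, ∃ c, s < c ∧ c < q ∧ v = f c)
    (hJ : Jump G (union H q f) N (f s) y n) :
    G.Adj (f 0) y ∨ Jump G H ∅ (f 0) y (s - 0 + n) := by
  by_cases hadj : G.Adj (f 0) y
  · exact Or.inl hadj
  obtain ⟨hn, T, hP, hT⟩ := hJ
  refine Or.inr ⟨by omega, _, (A.path (Nat.zero_le s) (by omega)).trans hP
    (sepAt_of_jump hT ?_ ?_), ?_⟩
  · rintro _ ⟨c, -, h, rfl⟩
    exact mem_union (by omega)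
  · rintro _ ⟨c, -, h, rfl⟩
    refine Or.inr ⟨?_, ?_, ?_⟩
    · rintro rfl
      rcases (A.mem_iff (by omega)).1 hy with rfl | rfl
      exacts [hy0 rfl, hyq rfl]
    · intro h'
      rcases Nat.eq_zero_or_pos c with rfl | h0
      · exact hadj h'
      · rcases A.nbr c h0 (by omega) y hy h' with h | h
        exacts [hy0 h, hyq h]
    · intro h'
      obtain ⟨d, h1, h2, h3⟩ := hN _ h'
      have := (A.eq_iff (by omega) (by omega)).1 h3
      omega
  · have key : ∀ c ≤ s, f c = f 0 ∨ f c = y ∨ f c ∉ H ∧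
        ∀ v ∈ H, G.Adj (f c) v → v = f 0 ∨ v = y ∨ v ∈ (∅ : Set V) := by
      intro c hc
      by_cases h0 : c = 0
      · exact Or.inl (by rw [h0])
      refine Or.inr (Or.inr ⟨A.not_mem c (by omega) (by omega), fun v hv h => ?_⟩)
      rcases A.nbr c (by omega) (by omega) v hv h with h' | rfl
      · exact Or.inl h'
      · have := A.adj_cases (by omega) le_rfl h
        omega
    rintro w (⟨c, -, h, rfl⟩ | hw)
    · exact key c h
    · rcases hT w hw with rfl | rfl | ⟨h1, h2⟩
      · exact key s le_rfl
      · exact Or.inr (Or.inl rfl)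
      · refine Or.inr (Or.inr ⟨fun h => h1 (Or.inl h), fun v hv e => ?_⟩)
        rcases h2 v (Or.inl hv) e with rfl | h | h
        · have := (A.mem_iff (by omega)).1 hv
          omega
        · exact Or.inr (Or.inl h)
        · obtain ⟨c, h3, h4, rfl⟩ := hN v h
          have := (A.mem_iff (by omega)).1 hv
          omega

theorem extend_end (A : Arc G H q f) {s n : ℕ} {y : V} (hs : s < q) (hs0 : 2 ≤ s) (hy : y ∈ H)
    (hy0 : y ≠ f 0) (hyq : y ≠ f q) (hN : ∀ v ∈ N, ∃ c, 0 < c ∧ c < s ∧ v = f c)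
    (hJ : Jump G (union H q f) N (f s) y n) :
    G.Adj (f q) y ∨ Jump G H ∅ (f q) y (q - s + n) := by
  rw [← union_symm] at hJ
  have e : f s = f (q - (q - s)) := by rw [Nat.sub_sub_self hs.le]
  rw [e] at hJ
  exact A.symm.extend (s := q - s) (by omega) (by omega) hy hyq (by simpa using hy0) (by
    intro v hv
    obtain ⟨c, h1, h2, rfl⟩ := hN v hv
    exact ⟨q - c, by omega, by omega, by simp [Nat.sub_sub_self (show c ≤ q by omega)]⟩) hJ

theorem jump_two (A : Arc G H q f) {s : ℕ} {w y : V} (hs0 : 0 < s) (hs : s < q) (hy : y ∈ H)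
    (hy0 : y ≠ f 0) (hyq : y ≠ f q) (hw : w ∉ union H q f) (hws : G.Adj w (f s))
    (hwy : G.Adj w y) (h1 : ∀ c ≤ q, G.Adj w (f c) → c = s) (h2 : ∀ m ∈ H, G.Adj w m → m = y) :
    Jump G (union H q f) ∅ (f s) y 2 := by
  refine ⟨le_rfl, _, (PathOn.of_adj hws.symm).trans (PathOn.of_adj hwy) ?_, ?_⟩
  · have hne : f s ≠ y := by
      rintro rfl
      have := (A.mem_iff hs.le).1 hy
      omega
    have hna : ¬ G.Adj (f s) y := fun h => by
      rcases A.nbr s hs0 hs y hy h with h | h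
      exacts [hy0 h, hyq h]
    rintro _ (rfl | rfl) _ (rfl | rfl)
    · exact ⟨fun h => h, fun _ _ => Or.inr rfl⟩
    · exact ⟨fun h => absurd h hne, fun _ h => absurd h hna⟩
    · exact ⟨fun h => h, fun _ _ => Or.inr rfl⟩
    · exact ⟨fun _ => rfl, fun _ _ => Or.inl rfl⟩
  · have key : w ∉ union H q f ∧ ∀ m ∈ union H q f, G.Adj w m → m = f s ∨ m = y ∨
        m ∈ (∅ : Set V) := by
      refine ⟨hw, ?_⟩
      rintro m (hm | ⟨c, hc, rfl⟩) h
      · exact Or.inr (Or.inl (h2 m hm h))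
      · exact Or.inl (by rw [h1 c hc h])
    rintro _ ((rfl | rfl) | (rfl | rfl))
    · exact Or.inl rfl
    · exact Or.inr (Or.inr key)
    · exact Or.inr (Or.inr key)
    · exact Or.inr (Or.inl rfl)

theorem not_short (hℓ : 5 ≤ ℓ) (hG : InGFamily ℓ G) (A : Arc G H q f) (hq : 4 ≤ q)
    (hfour : ∀ x ∈ H, ∀ y ∈ H, ∀ n, Jump G H ∅ x y n → 4 ≤ n) {w y : V} (hy : y ∈ H)
    (hy0 : y ≠ f 0) (hyq : y ≠ f q) (hw : w ∉ union H q f) (hws : G.Adj w (f 1))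
    (hwy : G.Adj w y) (h1 : ∀ c ≤ q, G.Adj w (f c) → c = 1) (h2 : ∀ m ∈ H, G.Adj w m → m = y) :
    False := by
  rcases A.extend (by omega) one_pos hy hy0 hyq (fun v hv => hv.elim)
    (A.jump_two one_pos (by omega) hy hy0 hyq hw hws hwy h1 h2) with h | h
  · refine hG.not_two_nbrs (PathOn.two h.symm (A.adj (by omega)) ?_) (by omega) ?_ ?_ hwy.symm hws
    · rintro rfl
      have := (A.mem_iff (by omega)).1 hy
      omega
    · rintro rfl
      have := (A.mem_iff (by omega)).1 hy
      omega
    · rintro (rfl | rfl | rfl)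
      · exact hw (Or.inl hy)
      · exact hw (Or.inl A.left_mem)
      · exact hw (mem_union (by omega))
  · have := hfour _ A.left_mem _ hy _ h
    omega

theorem one_nbr (hℓ : 5 ≤ ℓ) (hG : InGFamily ℓ G) (A : Arc G H q f) (hq : 4 ≤ q) (hqℓ : q ≤ ℓ)
    (hone : ∀ w, w ∉ H → ∀ x ∈ H, ∀ y ∈ H, G.Adj w x → G.Adj w y → x = y)
    (hfour : ∀ x ∈ H, ∀ y ∈ H, ∀ n, Jump G H ∅ x y n → 4 ≤ n)
    (hE : ∀ y ∈ H, y ≠ f 0 → y ≠ f q → (G.Adj (f 0) y ∨ ∃ n, Jump G H ∅ (f 0) y n) →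
      (G.Adj (f q) y ∨ ∃ n, Jump G H ∅ (f q) y n) → False) :
    ∀ w, w ∉ union H q f → ∀ x ∈ union H q f, ∀ y ∈ union H q f, G.Adj w x → G.Adj w y →
      x = y := by
  intro w hw
  have hwH : w ∉ H := fun h => hw (Or.inl h)
  have hJ : ∀ a ≤ q, ∀ b ≤ q, G.Adj w (f a) → G.Adj w (f b) → f a = f b := by
    intro a ha b hb h1 h2
    by_contra hne
    obtain ⟨r, hr, hP⟩ := A.exists_path ha hb
    exact hG.not_two_nbrs hP (by omega) hne (fun h => hw (Or.inr h)) h1.symm h2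
  have hmix : ∀ s ≤ q, ∀ y ∈ H, G.Adj w (f s) → G.Adj w y → f s = y := by
    intro s hs y hy h1 h2
    by_contra hne
    have hs0 : s ≠ 0 ∧ s ≠ q := by
      constructor <;> rintro rfl
      · exact hne (hone w hwH _ A.left_mem y hy h1 h2)
      · exact hne (hone w hwH _ A.right_mem y hy h1 h2)
    have hy0 : y ≠ f 0 := by
      rintro rfl
      exact hne (hJ s hs 0 (Nat.zero_le q) h1 h2)
    have hyq : y ≠ f q := by
      rintro rfl
      exact hne (hJ s hs q le_rfl h1 h2)
    have hc : ∀ c ≤ q, G.Adj w (f c) → c = s := fun c hc h =>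
      (A.eq_iff hc hs).1 (hJ c hc s hs h h1)
    have hm : ∀ m ∈ H, G.Adj w m → m = y := fun m hm h => hone w hwH m hm y hy h h2
    by_cases hs1 : s = 1
    · subst hs1
      exact A.not_short hℓ hG hq hfour hy hy0 hyq hw h1 h2 hc hm
    by_cases hs2 : s = q - 1
    · subst hs2
      exact A.symm.not_short hℓ hG hq hfour hy hyq (by simpa using hy0) (by rwa [union_symm]) h1 h2
        (fun c h3 h4 => by have := hc _ (by omega) h4; omega) hm
    have J := A.jump_two (by omega) (by omega) hy hy0 hyq hw h1 h2 hc hm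
    exact hE y hy hy0 hyq
      ((A.extend (by omega) (by omega) hy hy0 hyq (fun v hv => hv.elim) J).imp_right fun h => ⟨_, h⟩)
      ((A.extend_end (by omega) (by omega) hy hy0 hyq (fun v hv => hv.elim) J).imp_right
        fun h => ⟨_, h⟩)
  rintro x (hx | ⟨a, ha, rfl⟩) y (hy | ⟨b, hb, rfl⟩) h1 h2
  · exact hone w hwH x hx y hy h1 h2
  · exact (hmix b hb x hx h2 h1).symm
  · exact hmix a ha y hy h1 h2
  · exact hJ a ha b hb h1 h2

theorem false_of_critical (hℓ : 5 ≤ ℓ) (hG : InGFamily ℓ G) (hcrit : VertexCritical 4 G)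
    (A : Arc G H q f) (hq : 4 ≤ q) (hqℓ : q ≤ ℓ)
    (hone : ∀ w, w ∉ H → ∀ x ∈ H, ∀ y ∈ H, G.Adj w x → G.Adj w y → x = y)
    (hfour : ∀ x ∈ H, ∀ y ∈ H, ∀ n, Jump G H ∅ x y n → 4 ≤ n)
    (hlen : ∀ n, Jump G H ∅ (f 0) (f q) n → n = q)
    (hE : ∀ y ∈ H, y ≠ f 0 → y ≠ f q → (G.Adj (f 0) y ∨ ∃ n, Jump G H ∅ (f 0) y n) →
      (G.Adj (f q) y ∨ ∃ n, Jump G H ∅ (f q) y n) → False) : False := by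
  have hre : ∀ {N : Set V} {s m n : ℕ}, s < m → m ≤ q →
      (∀ v ∈ N, ∃ c, s < c ∧ c < m ∧ v = f c) → ¬ Jump G (union H q f) N (f s) (f m) n := by
    intro N s m n hsm hm hN hJ
    have h1 := hlen _ (A.reroute hsm hm hN hJ)
    have h2 := hJ.girth_le hG (A.path (ind := True) hsm.le hm) (by
      rintro _ ⟨c, -, h, rfl⟩
      exact mem_union (by omega))
    omega
  have hne : ∀ a b, a ≤ q → b ≤ q → a ≠ b → f a ≠ f b := fun a b ha hb hab h =>
    hab ((A.eq_iff ha hb).1 h)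
  have N0 : ∀ s m : ℕ, ∀ v ∈ (∅ : Set V), ∃ c, s < c ∧ c < m ∧ v = f c := fun _ _ v hv => hv.elim
  have N1 : ∀ d s m : ℕ, s < d → d < m → ∀ v ∈ ({f d} : Set V), ∃ c, s < c ∧ c < m ∧ v = f c := by
    rintro d s m h1 h2 v rfl
    exact ⟨d, h1, h2, rfl⟩
  obtain ⟨m, hm, m2, m1, m3, hJ⟩ := exists_jump_of_critical hℓ hG hcrit (M := union H q f)
    (v := f 2) (x := f 1) (y := f 3) (mem_union (by omega)) (mem_union (by omega))
    (mem_union (by omega)) (A.adj (by omega)).symm (A.adj (by omega)) (hne 1 3 (by omega) (by omega)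
    (by omega)) (by
      have key : ∀ c ≤ q, G.Adj (f 2) (f c) → f c = f 1 ∨ f c = f 3 := by
        intro c hc h
        rcases A.adj_cases (by omega) hc h with rfl | h
        · exact Or.inr rfl
        · obtain rfl : c = 1 := by omega
          exact Or.inl rfl
      rintro m (hm | ⟨c, hc, rfl⟩) h
      · rcases A.nbr 2 (by omega) (by omega) m hm h with rfl | rfl
        · exact key 0 (by omega) h
        · exact key q le_rfl h
      · exact key c hc h)
    (A.one_nbr hℓ hG hq hqℓ hone hfour hE)
    ⟨f 0, mem_union (by omega), hne _ _ (by omega) (by omega) (by omega),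
      hne _ _ (by omega) (by omega) (by omega), hne _ _ (by omega) (by omega) (by omega)⟩
    (fun n => hre (by omega) (by omega) (N0 _ _))
  have hin : ∀ c ≤ q, m ≠ f c := by
    rintro c hc rfl
    have hc1 : c ≠ 1 := fun h => m1 (by rw [h])
    have hc2 : c ≠ 2 := fun h => m2 (by rw [h])
    have hc3 : c ≠ 3 := fun h => m3 (by rw [h])
    rcases hJ with ⟨n, h⟩ | ⟨⟨n, h⟩, h'⟩ | ⟨⟨n, h⟩, h'⟩
    · rcases Nat.eq_zero_or_pos c with rfl | h0
      · exact hre (by omega) (by omega) (N0 _ _) h.symm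
      · exact hre (by omega) (by omega) (N0 _ _) h
    · rcases Nat.eq_zero_or_pos c with rfl | h0
      · exact hre (by omega) (by omega) (N1 _ _ _ (by omega) (by omega)) h.symm
      · rcases h' with h' | ⟨n, h'⟩
        · have := A.adj_cases (by omega) hc h'
          omega
        · exact hre (by omega) (by omega) (N0 _ _) h'
    · rcases Nat.eq_zero_or_pos c with rfl | h0
      · rcases h' with h' | ⟨n, h'⟩
        · have := A.adj_cases (by omega) hc h'
          omega
        · exact hre (by omega) (by omega) (N0 _ _) h'.symm
      · exact hre (by omega) (by omega) (N1 _ _ _ (by omega) (by omega)) h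
  have hmH : m ∈ H := by
    rcases hm with hm | ⟨c, hc, rfl⟩
    · exact hm
    · exact absurd rfl (hin c hc)
  have m0 := hin 0 (by omega)
  have mq := hin q le_rfl
  have hadj : ∀ c, 0 < c → c < q → ¬ G.Adj (f c) m := fun c h1 h2 h =>
    (A.nbr c h1 h2 m hmH h).elim m0 mq
  refine hE m hmH m0 mq ?_ ?_
  · rcases hJ with ⟨n, h⟩ | ⟨⟨n, h⟩, h'⟩ | ⟨⟨n, h⟩, h'⟩
    · exact (A.extend (by omega) (by omega) hmH m0 mq (N0 _ _) h).imp_right fun h => ⟨_, h⟩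
    · rcases h' with h' | ⟨n, h'⟩
      · exact absurd h' (hadj 1 (by omega) (by omega))
      · exact (A.extend (by omega) (by omega) hmH m0 mq (N0 _ _) h').imp_right fun h => ⟨_, h⟩
    · exact (A.extend (by omega) (by omega) hmH m0 mq (N1 _ _ _ (by omega) (by omega)) h).imp_right
        fun h => ⟨_, h⟩
  · rcases hJ with ⟨n, h⟩ | ⟨⟨n, h⟩, h'⟩ | ⟨⟨n, h⟩, h'⟩
    · exact (A.extend_end (by omega) (by omega) hmH m0 mq (N0 _ _) h).imp_right fun h => ⟨_, h⟩
    · exact (A.extend_end (by omega) (by omega) hmH m0 mq (N1 _ _ _ (by omega)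
        (by omega)) h).imp_right fun h => ⟨_, h⟩
    · rcases h' with h' | ⟨n, h'⟩
      · exact absurd h' (hadj 3 (by omega) (by omega))
      · exact (A.extend_end (by omega) (by omega) hmH m0 mq (N0 _ _) h').imp_right fun h => ⟨_, h⟩

end Arc

end Arc

namespace Frame

variable {G : SimpleGraph V} {ℓ : ℕ} {F : Frame G ℓ} {i j k l : Fin 4}

theorem inner_cases (h : Distinct4 i j k l) {i' j' : Fin 4} (hij : i' ≠ j') {a : ℕ} (ha0 : 0 < a)
    (ha : a < F.len i' j') : ∃ t, 0 < t ∧ ((t < F.len i j ∧ F.pos i' j' a = F.pos i j t) ∨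
      (t < F.len k l ∧ F.pos i' j' a = F.pos k l t) ∨
      (t < F.len i k ∧ F.pos i' j' a = F.pos i k t) ∨
      (t < F.len j l ∧ F.pos i' j' a = F.pos j l t) ∨
      (t < F.len i l ∧ F.pos i' j' a = F.pos i l t) ∨
      (t < F.len j k ∧ F.pos i' j' a = F.pos j k t)) := by
  have e := F.pos_symm i' j' ha.le
  have c := F.len_comm i' j'
  have h1 : 0 < F.len i' j' - a := by omega
  have h2 : F.len i' j' - a < F.len j' i' := by omega
  rcases h.eq_or i' with rfl | rfl | rfl | rfl <;> rcases h.eq_or j' with rfl | rfl | rfl | rfl <;>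
    first
    | exact absurd rfl hij
    | exact ⟨_, ha0, by simp only [ha, true_and, true_or, or_true]⟩
    | exact ⟨_, h1, by simp only [h2, e, true_and, true_or, or_true]⟩

theorem adj_inner (hG : InGFamily ℓ G) (hij : i ≠ j) {s : ℕ} (hs0 : 0 < s) (hs : s < F.len i j)
    {m : V} (hm : m ∈ F.verts) (h : G.Adj (F.pos i j s) m) :
    m = F.pos i j (s - 1) ∨ m = F.pos i j (s + 1) := by
  obtain ⟨k, l, c, hkl, hc, rfl⟩ := hm
  rw [F.adj_iff hG hij hkl hs.le hc] at h
  rw [eq_comm, F.eq_iff hij hkl (by omega) hc, eq_comm (a := F.pos k l c),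
    F.eq_iff hij hkl (by omega) hc]
  unfold AdjCoord at h
  unfold SameCoord
  have l1 := F.len_comm i j
  rcases h with ⟨rfl, rfl, h | h⟩ | ⟨rfl, rfl, h | h⟩ | ⟨rfl, -, h | h⟩ | ⟨rfl, -, h | h⟩ |
    ⟨rfl, -, h | h⟩ | ⟨rfl, -, h | h⟩ | h | h | h | h
  all_goals first | (exfalso; omega) | skip
  all_goals simp [hij, hij.symm]; omega

/-- `x` and `y` are adjacent or joined by a jump. -/
def Near (F : Frame G ℓ) (x y : V) : Prop := G.Adj x y ∨ ∃ n, Jump G F.verts ∅ x y n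

theorem Near.corner (hG : InGFamily ℓ G) (h : Distinct4 i j k l) {s t : ℕ} (hs0 : 0 < s)
    (hs : s < F.len i j) (ht0 : 0 < t) (ht : t < F.len i k)
    (hN : F.Near (F.pos i j s) (F.pos i k t)) : F.len j k = 1 ∧ s = 1 ∧ t = 1 := by
  rcases hN with hN | ⟨n, hN⟩
  · have hne := h.ne_facts
    rw [F.adj_iff hG h.ij h.ik hs.le ht.le] at hN
    unfold AdjCoord at hN
    omega
  · obtain ⟨h1, h2, h3, -⟩ := jump_corner hG h hs0 hs ht0 ht hN
    exact ⟨h1, h2, h3⟩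

theorem not_near_branch (hℓ : 5 ≤ ℓ) (hG : InGFamily ℓ G) (h : Distinct4 i j k l) {t : ℕ}
    (ht0 : 0 < t) (ht : t < F.len i k) : ¬ F.Near (F.pos i k t) (F.br j) := by
  rintro (hN | ⟨n, hN⟩)
  · have hne := h.ne_facts
    rw [← F.pos_zero_eq_br j i, F.adj_iff hG h.ik h.ij.symm ht.le (Nat.zero_le _)] at hN
    unfold AdjCoord at hN
    have := F.len_basic h
    omega
  · exact not_jump_branch hℓ hG h ht0 ht hN.symm

theorem Near.opp (hG : InGFamily ℓ G) (h : Distinct4 i j k l) {a b : ℕ} (ha0 : 0 < a)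
    (ha : a < F.len i j) (hb0 : 0 < b) (hb : b < F.len k l)
    (hN : F.Near (F.pos i j a) (F.pos k l b)) :
    a + b = F.len i j ∨ ℓ + 1 ≤ a + F.len i k ∧ ℓ + 1 ≤ F.len i j - a + F.len i k := by
  rcases hN with hN | ⟨n, hN⟩
  · rw [F.adj_iff_opp hG h ha.le hb.le] at hN
    omega
  · rcases jump_opp hG h ha0 ha hb0 hb hN with ⟨-, h1, -⟩ | ⟨-, -, h1⟩
    exacts [Or.inl h1, Or.inr h1]

theorem not_jump_opp (hℓ : 5 ≤ ℓ) (hG : InGFamily ℓ G) (hcrit : VertexCritical 4 G)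
    (h : Distinct4 i j k l) {a b n : ℕ} (ha0 : 0 < a) (ha : a < F.len i j)
    (hJ : Jump G F.verts ∅ (F.pos i j a) (F.pos k l b) n) (hn : n = F.len i l)
    (hab : a + b = F.len i j) (h1 : ℓ + 1 ≤ a + F.len i l)
    (h2 : ℓ + 1 ≤ F.len i j - a + F.len i l) : False := by
  obtain ⟨e1, e2, e3, e4, e5, e6, e7, e8, e9, e10, e11, e12, e13, e14, e15, e16⟩ :=
    F.len_facts hG h
  have hb0 : 0 < b := by omega
  have hb : b < F.len k l := by omega
  have xa := F.pos_symm i j ha.le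
  have xb := F.pos_symm k l hb.le
  obtain ⟨f, f0, fn, A⟩ := hJ.exists_arc (F.pos_mem_verts h.ij ha.le) (F.pos_mem_verts h.kl hb.le)
  refine A.false_of_critical hℓ hG hcrit (by omega) (by omega)
    (fun w hw x hx y hy hwx hwy => one_nbr hℓ hG hw hx hy hwx hwy)
    (fun x hx y hy n hJ => four_le_of_jump hℓ hG hx hy hJ) ?_ ?_
  · intro n' hJ'
    rw [f0, fn] at hJ'
    rcases jump_opp hG h ha0 ha hb0 hb hJ' with ⟨h3, -⟩ | ⟨-, -, h3, h4⟩ <;> omega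
  · rw [f0, fn]
    intro y hy hy0 hyn hx hx'
    change F.Near _ _ at hx hx'
    rcases F.mem_verts_cases hy with ⟨m, rfl⟩ | ⟨i', j', t', hij', ht0', ht', rfl⟩
    · rcases h.eq_or m with rfl | rfl | rfl | rfl
      · exact not_near_branch hℓ hG (i := k) (j := m) (k := l) (l := j)
          h.swap13.swap24.swap23 hb0 hb hx'
      · exact not_near_branch hℓ hG h.swap_pairs.swap24.swap34 hb0 hb hx'
      · exact not_near_branch hℓ hG h.swap23 ha0 ha hx
      · exact not_near_branch hℓ hG h.swap24.swap34 ha0 ha hx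
    obtain ⟨t, ht0, ⟨ht, e⟩ | ⟨ht, e⟩ | ⟨ht, e⟩ | ⟨ht, e⟩ | ⟨ht, e⟩ | ⟨ht, e⟩⟩ :=
      inner_cases h hij' ht0' ht' <;> rw [e] at hx hx' hy0 hyn
    · rcases hx'.opp hG h.swap_pairs hb0 hb ht0 ht with h3 | h3
      · obtain rfl : t = a := by omega
        exact hy0 rfl
      · omega
    · rcases hx.opp hG h ha0 ha ht0 ht with h3 | h3
      · obtain rfl : t = b := by omega
        exact hyn rfl
      · omega
    · have := hx.corner hG h ha0 ha ht0 ht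
      omega
    · rw [xa] at hx
      have := hx.corner hG h.swap12.swap34 (by omega) (by omega) ht0 ht
      omega
    · have h3 := hx.corner hG h.swap34 ha0 ha ht0 ht
      rw [xb, F.pos_symm i l ht.le] at hx'
      have h4 := hx'.corner hG (i := l) (j := k) (k := i) (l := j)
        h.swap_pairs.swap12 (by omega) (by omega) (by omega) (by omega)
      omega
    · rw [xa] at hx
      have h3 := hx.corner hG h.swap12 (by omega) (by omega) ht0 ht
      rw [F.pos_symm j k ht.le] at hx'
      have h4 := hx'.corner hG (i := k) (j := l) (k := j) (l := i)
        h.swap_pairs.swap34 hb0 hb (by omega) (by omega)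
      omega

/-- In a critical graph, jumps of the subdivision only join neighbours of a common branch
vertex. -/
theorem jump_cases_of_critical (hℓ : 5 ≤ ℓ) (hG : InGFamily ℓ G) (hcrit : VertexCritical 4 G)
    {x y : V} {n : ℕ} (hx : x ∈ F.verts) (hy : y ∈ F.verts) (hJ : Jump G F.verts ∅ x y n) :
    ∃ i j k l, Distinct4 i j k l ∧ F.len j k = 1 ∧ x = F.pos i j 1 ∧ y = F.pos i k 1 := by
  rcases jump_cases hℓ hG hx hy hJ with ⟨i, j, k, l, h, h1, h2, h3, -⟩ |
    ⟨i, j, k, l, a, b, h, ha0, ha, rfl, rfl, h1, h2, h3, h4⟩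
  · exact ⟨i, j, k, l, h, h1, h2, h3⟩
  · exact (not_jump_opp hℓ hG hcrit h ha0 ha hJ h1 h2 h3 h4).elim

theorem not_jump_through (hℓ : 5 ≤ ℓ) (hG : InGFamily ℓ G) (h : Distinct4 i j k l)
    (hjk : F.len j k = 1) {n : ℕ} :
    ¬ Jump G F.verts {F.pos i j 1} (F.pos i j 2) (F.pos i k 1) n := by
  intro hJ
  obtain ⟨e1, e2, e3, e4, e5, e6, e7, e8, e9, e10, e11, e12, e13, e14, e15, e16⟩ :=
    F.len_facts hG h
  have r1 := (F.route_across hG h (s := 2) (t := 1) (by omega) (by omega) (by omega)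
    (by omega)).even_or_eq hG hJ (by
      rintro v - rfl
      exact ⟨1, by omega, by omega, rfl⟩)
  have r2 := (F.route_all hG h.swap23 (s := 1) (t := 2) (by omega) (by omega) (by omega)
    (by omega)).symm.even_or_eq hG hJ (by
      rintro v - rfl
      exact ⟨1, by omega, by omega, rfl⟩)
  have r3 := (F.route_corner hG h (s := 2) (t := 1) (by omega) (by omega)
    (Or.inl (by omega))).girth_le hG hJ
  omega

theorem false_of_critical (F : Frame G ℓ) (hℓ : 5 ≤ ℓ) (hG : InGFamily ℓ G)
    (hcrit : VertexCritical 4 G) : False := by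
  obtain ⟨i, j, k, l, h, hp⟩ : ∃ i j k l, Distinct4 i j k l ∧ 4 ≤ F.len i j := by
    have h : Distinct4 0 1 2 3 := by constructor <;> decide
    have := F.len_facts hG h
    by_cases h1 : 4 ≤ F.len 0 1
    · exact ⟨_, _, _, _, h, h1⟩
    by_cases h2 : 4 ≤ F.len 0 2
    · exact ⟨_, _, _, _, h.swap23, h2⟩
    · exact ⟨_, _, _, _, h.swap24, by omega⟩
  have hv : ∀ s ≤ 4, F.pos i j s ∈ F.verts := fun s hs => F.pos_mem_verts h.ij (by omega)
  have hne : ∀ s t, s ≤ 4 → t ≤ 4 → s ≠ t → F.pos i j s ≠ F.pos i j t := fun s t hs ht hst e =>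
    hst ((F.same i j h.ij s (by omega) t (by omega)).1.1 e)
  have hadj : ∀ s t, s ≤ 4 → t ≤ 4 → s + 1 = t → G.Adj (F.pos i j s) (F.pos i j t) :=
    fun s t hs ht hst => (F.same i j h.ij s (by omega) t (by omega)).2.2 (Or.inl hst)
  have N0 : ∀ A : Set V, ∀ v ∈ F.verts, v ∈ (∅ : Set V) → v ∈ A := fun _ _ _ h => h.elim
  have N1 : ∀ s a b, a ≤ s → s ≤ b → ∀ v ∈ F.verts, v ∈ ({F.pos i j s} : Set V) →
      v ∈ F.seg i j a b := by
    rintro s a b h1 h2 v - rfl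
    exact ⟨s, h1, h2, rfl⟩
  obtain ⟨m, hm, m2, m1, m3, hJ⟩ := exists_jump_of_critical hℓ hG hcrit (M := F.verts)
    (v := F.pos i j 2) (x := F.pos i j 1) (y := F.pos i j 3) (hv 2 (by omega)) (hv 1 (by omega))
    (hv 3 (by omega)) (hadj 1 2 (by omega) (by omega) rfl).symm (hadj 2 3 (by omega) (by omega) rfl)
    (hne 1 3 (by omega) (by omega) (by omega))
    (fun m hm hadj => adj_inner hG h.ij (by omega) (by omega) hm hadj)
    (fun w hw x hx y hy hwx hwy => one_nbr hℓ hG hw hx hy hwx hwy)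
    ⟨F.pos i j 4, hv 4 le_rfl, hne _ _ (by omega) (by omega) (by omega),
      hne _ _ (by omega) (by omega) (by omega), hne _ _ (by omega) (by omega) (by omega)⟩
    (fun n => not_jump_arris hℓ hG h (by omega) (by omega) (N0 _))
  have hp3 := F.len_facts hG h
  rcases hJ with ⟨n, hJ⟩ | ⟨⟨n, hJ⟩, hm' | ⟨n', hJ'⟩⟩ | ⟨⟨n, hJ⟩, hm' | ⟨n', hJ'⟩⟩
  · obtain ⟨i', j', k', l', h', -, e, -⟩ :=
      jump_cases_of_critical hℓ hG hcrit (hv 2 (by omega)) hm hJ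
    have := F.one_le i' j' h'.ij
    rw [F.eq_iff h.ij h'.ij (by omega) (by omega)] at e
    unfold SameCoord at e
    omega
  · rcases adj_inner hG h.ij (by omega) (by omega) hm hm' with rfl | rfl
    · exact not_jump_arris hℓ hG h (by omega) (by omega) (N1 1 _ _ (by omega) (by omega)) hJ.symm
    · exact m2 rfl
  · obtain ⟨i', j', k', l', h', e1, e, rfl⟩ :=
      jump_cases_of_critical hℓ hG hcrit (hv 1 (by omega)) hm hJ'
    have := F.one_le i' j' h'.ij
    rw [F.eq_iff h.ij h'.ij (by omega) (by omega)] at e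
    unfold SameCoord at e
    obtain ⟨rfl, rfl⟩ : i = i' ∧ j = j' := by omega
    exact not_jump_through hℓ hG h' e1 hJ
  · rcases adj_inner hG h.ij (by omega) (by omega) hm hm' with rfl | rfl
    · exact m2 rfl
    · exact not_jump_arris hℓ hG h (by omega) (by omega) (N1 3 _ _ (by omega) (by omega)) hJ
  · obtain ⟨i', j', k', l', h', e1, e, rfl⟩ :=
      jump_cases_of_critical hℓ hG hcrit (hv 3 (by omega)) hm hJ'
    have := F.one_le i' j' h'.ij
    have := F.len_facts hG h'
    have := F.len_comm i j
    rw [F.eq_iff h.ij h'.ij (by omega) (by omega)] at e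
    unfold SameCoord at e
    obtain ⟨rfl, rfl⟩ : i = j' ∧ j = i' := by omega
    omega

end Frame

/-- Theorem 1.2: for every integer `ℓ ≥ 5`, no 4-vertex-critical graph
in `𝒢ℓ` has an odd `K₄`-subdivision. -/
theorem no_oddK4_in_4_critical {V : Type*} (ℓ : ℕ) (hℓ : 5 ≤ ℓ) (G : SimpleGraph V)
    (hG : InGFamily ℓ G) (hcrit : VertexCritical 4 G) :
    IsEmpty (OddK4 G) := by
  exact ⟨fun K => (K.frame hG).false_of_critical hℓ hG hcrit⟩
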